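/- There exist a₀ ∈ (0,1), λ₀ ≥ 8 and a constant C, depending only on the cutoffs, such that for all 0 < h ≤ 1 and 0 < a ≤ a₀ with λ = a^{3/2}/h ≥ λ₀, every integer N with 1 ≤ |N| ≤ λ^{1/3}, every X ≥ 0, Y ∈ ℝ, and every T with |T − 4N| ≤ 1/|N|: |W_{N,a}(T,X,Y)| ≤ C h^{1/3} h^{−2} / ((|N|/λ^{1/3})^{1/4} + |N(T−4N)|^{1/6}). -/

import Mathlib

open Real Complex Filter MeasureTheory

/-- `A₊(z) = e^{-iπ/3} Ai(e^{-iπ/3} z)`. -/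
noncomputable def Aplus (Ai : ℂ → ℂ) (z : ℂ) : ℂ :=
  Complex.exp (-(Real.pi / 3 : ℂ) * Complex.I) * Ai (Complex.exp (-(Real.pi / 3 : ℂ) * Complex.I) * z)

/-- `A₋(z) = e^{iπ/3} Ai(e^{iπ/3} z)`. -/
noncomputable def Aminus (Ai : ℂ → ℂ) (z : ℂ) : ℂ :=
  Complex.exp ((Real.pi / 3 : ℂ) * Complex.I) * Ai (Complex.exp ((Real.pi / 3 : ℂ) * Complex.I) * z)

/-- `B(u) = (4/3)u + π/2 − L(u^{2/3})`. -/
noncomputable def Bfun (L : ℝ → ℝ) (u : ℝ) : ℝ :=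
  (4/3) * u + Real.pi / 2 - L (u ^ ((2 : ℝ)/3))

/-- The phase `Ψ_{N,a}(T,X,Y,Υ,S,A,η)` of the tangential reflected waves, with `λ = a^{3/2}/h`. -/
noncomputable def PsiTan (L : ℝ → ℝ) (h a : ℝ) (N : ℤ) (T X Y Υ S A η : ℝ) : ℝ :=
  η * (Y + Υ ^ 3 / 3 + Υ * (X - A) + S ^ 3 / 3 + S * (1 - A)
      + T * Real.sqrt (1 + a) * (A - 1) / (Real.sqrt (1 + a * A) + Real.sqrt (1 + a))
      - (4/3) * (N : ℝ) * A ^ ((3:ℝ)/2))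
    + ((N : ℝ) / (a ^ ((3:ℝ)/2) / h)) * Bfun L (η * (a ^ ((3:ℝ)/2) / h) * A ^ ((3:ℝ)/2))

/-- The `N`-th tangential reflected wave `W_{N,a}(T,X,Y)`; the integration variables are
`S = v.1`, `Υ = v.2.1`, `A = v.2.2.1`, `η = v.2.2.2`. -/
noncomputable def Wtan (L : ℝ → ℝ) (ψ : ℝ → ℝ) (χ₂ : ℝ × ℝ → ℝ) (ψ₃ : ℝ → ℝ)
    (h a : ℝ) (N : ℤ) (T X Y : ℝ) : ℂ :=
  ((a ^ 2 / (2 * Real.pi * h) ^ 3 : ℝ) : ℂ) * ∫ v : ℝ × ℝ × ℝ × ℝ,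
    Complex.exp (Complex.I *
      (((a ^ ((3:ℝ)/2) / h) * PsiTan L h a N T X Y v.2.1 v.1 v.2.2.1 v.2.2.2 : ℝ) : ℂ)) *
    ((v.2.2.2 ^ 2 * ψ v.2.2.2 * χ₂ (v.1, v.2.1) * ψ₃ v.2.2.1 : ℝ) : ℂ)

/-- `G^♯(T,X,Y) = Σ_{|N| ≤ 2a^{−1/2}} W_{N,a}(T,X,Y)`. -/
noncomputable def Gsharp (L : ℝ → ℝ) (ψ : ℝ → ℝ) (χ₂ : ℝ × ℝ → ℝ) (ψ₃ : ℝ → ℝ)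
    (h a : ℝ) (T X Y : ℝ) : ℂ :=
  ∑' N : ℤ, Set.indicator {N : ℤ | |(N : ℝ)| ≤ 2 / Real.sqrt a}
    (fun N => Wtan L ψ χ₂ ψ₃ h a N T X Y) N

/-- Integration by parts bound for an oscillatory integral without stationary points. -/
theorem norm_oscillatory_le_of_le_abs_deriv {a b : ℝ} (hab : a ≤ b) {φ φ₁ φ₂ : ℝ → ℝ} {g : ℝ → ℂ}
    {ρ G G₁ : ℝ} (hρ : 0 < ρ)
    (hφ : ∀ x ∈ Set.Icc a b, HasDerivAt φ (φ₁ x) x)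
    (hφ₁ : ∀ x ∈ Set.Icc a b, HasDerivAt φ₁ (φ₂ x) x)
    (hφ₂ : ContinuousOn φ₂ (Set.Icc a b))
    (hlow : ∀ x ∈ Set.Icc a b, ρ ≤ |φ₁ x|)
    (hg : ∀ x ∈ Set.Icc a b, DifferentiableAt ℝ g x)
    (hgb : ∀ x ∈ Set.Icc a b, ‖g x‖ ≤ G)
    (hgd : ∀ x ∈ Set.Icc a b, ‖deriv g x‖ ≤ G₁) :
    ‖∫ x in a..b, Complex.exp (I * (φ x : ℂ)) * g x‖
      ≤ (2 * G + G₁ * (b - a)) / ρ + G * ∫ x in a..b, |φ₂ x| / φ₁ x ^ 2 := by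
  have huIcc : Set.uIcc a b = Set.Icc a b := Set.uIcc_of_le hab
  have hne : ∀ x ∈ Set.Icc a b, φ₁ x ≠ 0 := fun x hx h0 => by
    have := hlow x hx; rw [h0, abs_zero] at this; linarith
  have hφc : ContinuousOn φ (Set.Icc a b) := fun x hx => (hφ x hx).continuousAt.continuousWithinAt
  have hφ₁c : ContinuousOn φ₁ (Set.Icc a b) :=
    fun x hx => (hφ₁ x hx).continuousAt.continuousWithinAt
  have hgc : ContinuousOn g (Set.Icc a b) := fun x hx => (hg x hx).continuousAt.continuousWithinAt
  have hG : 0 ≤ G := (norm_nonneg _).trans (hgb a ⟨le_rfl, hab⟩)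
  have hG₁ : 0 ≤ G₁ := (norm_nonneg _).trans (hgd a ⟨le_rfl, hab⟩)
  have hexp : ∀ x : ℝ, ‖Complex.exp (I * (φ x : ℂ))‖ = 1 := fun x => by
    rw [mul_comm]; exact Complex.norm_exp_ofReal_mul_I _
  set w₁ : ℝ → ℂ := fun x => Complex.exp (I * (φ x : ℂ)) * (deriv g x / (I * (φ₁ x : ℂ))) with hw₁
  set w₂ : ℝ → ℂ := fun x => Complex.exp (I * (φ x : ℂ)) *
    (g x * (φ₂ x : ℂ) / (I * (φ₁ x : ℂ) ^ 2)) with hw₂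
  have hder : ∀ x ∈ Set.uIcc a b, HasDerivAt
      (fun x => Complex.exp (I * (φ x : ℂ)) * (g x / (I * (φ₁ x : ℂ))))
      (Complex.exp (I * (φ x : ℂ)) * g x + w₁ x - w₂ x) x := by
    intro x hx
    rw [huIcc] at hx
    have h1 : HasDerivAt (fun x => (φ x : ℂ)) (φ₁ x : ℂ) x := (hφ x hx).ofReal_comp
    have h2 : HasDerivAt (fun x => (φ₁ x : ℂ)) (φ₂ x : ℂ) x := (hφ₁ x hx).ofReal_comp
    have hn : (φ₁ x : ℂ) ≠ 0 := by exact_mod_cast hne x hx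
    have h3 := ((h1.const_mul I).cexp).mul
      ((hg x hx).hasDerivAt.div (h2.const_mul I) (mul_ne_zero I_ne_zero hn))
    refine h3.congr_deriv ?_
    simp only [hw₁, hw₂, Pi.div_apply]
    field_simp
    ring
  have hc1 : ContinuousOn (fun x => (φ₁ x : ℂ)) (Set.Icc a b) :=
    Complex.continuous_ofReal.comp_continuousOn hφ₁c
  have hc0 : ContinuousOn (fun x => Complex.exp (I * (φ x : ℂ))) (Set.Icc a b) := by
    have := Complex.continuous_ofReal.comp_continuousOn hφc
    exact (continuousOn_const.mul this).cexp
  have hc2 : ContinuousOn (fun x => (φ₂ x : ℂ)) (Set.Icc a b) :=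
    Complex.continuous_ofReal.comp_continuousOn hφ₂
  have hi0 : IntervalIntegrable (fun x => Complex.exp (I * (φ x : ℂ)) * g x) volume a b :=
    ContinuousOn.intervalIntegrable (by rw [huIcc]; exact hc0.mul hgc)
  have hi2 : IntervalIntegrable w₂ volume a b := by
    refine ContinuousOn.intervalIntegrable ?_
    rw [huIcc]
    refine hc0.mul ((hgc.mul hc2).div (continuousOn_const.mul (hc1.pow 2)) fun x hx => ?_)
    have hn : (φ₁ x : ℂ) ≠ 0 := by exact_mod_cast hne x hx
    exact mul_ne_zero I_ne_zero (pow_ne_zero _ hn)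
  have hi1 : IntervalIntegrable w₁ volume a b := by
    have hd : IntervalIntegrable (deriv g) volume a b := by
      rw [intervalIntegrable_iff_integrableOn_Icc_of_le hab]
      refine Measure.integrableOn_of_bounded (M := G₁) measure_Icc_lt_top.ne
        (measurable_deriv g).aestronglyMeasurable ?_
      exact (ae_restrict_iff' measurableSet_Icc).2 (Eventually.of_forall hgd)
    have : IntervalIntegrable (fun x => deriv g x *
        (Complex.exp (I * (φ x : ℂ)) / (I * (φ₁ x : ℂ)))) volume a b := by
      refine hd.mul_continuousOn ?_
      rw [huIcc]
      refine hc0.div (continuousOn_const.mul hc1) fun x hx => ?_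
      have hn : (φ₁ x : ℂ) ≠ 0 := by exact_mod_cast hne x hx
      exact mul_ne_zero I_ne_zero hn
    refine this.congr ?_
    intro x _
    simp only [hw₁]
    ring
  have hFTC := intervalIntegral.integral_eq_sub_of_hasDerivAt hder ((hi0.add hi1).sub hi2)
  rw [intervalIntegral.integral_sub (hi0.add hi1) hi2, intervalIntegral.integral_add hi0 hi1] at hFTC
  have hbd : ∀ x ∈ Set.Icc a b,
      ‖Complex.exp (I * (φ x : ℂ)) * (g x / (I * (φ₁ x : ℂ)))‖ ≤ G / ρ := by
    intro x hx
    rw [norm_mul, hexp, one_mul, norm_div, norm_mul, norm_I, one_mul, Complex.norm_real,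
      Real.norm_eq_abs]
    exact div_le_div₀ hG (hgb x hx) hρ (hlow x hx)
  have h1 : ‖∫ x in a..b, w₁ x‖ ≤ G₁ / ρ * |b - a| := by
    refine intervalIntegral.norm_integral_le_of_norm_le_const fun x hx => ?_
    have hx' : x ∈ Set.Icc a b := by
      rw [Set.uIoc_of_le hab] at hx; exact ⟨hx.1.le, hx.2⟩
    simp only [hw₁]
    rw [norm_mul, hexp, one_mul, norm_div, norm_mul, norm_I, one_mul, Complex.norm_real,
      Real.norm_eq_abs]
    exact div_le_div₀ hG₁ (hgd x hx') hρ (hlow x hx')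
  have hir : IntervalIntegrable (fun x => |φ₂ x| / φ₁ x ^ 2) volume a b := by
    refine ContinuousOn.intervalIntegrable ?_
    rw [huIcc]
    exact hφ₂.abs.div (hφ₁c.pow 2) fun x hx => pow_ne_zero _ (hne x hx)
  have h2 : ‖∫ x in a..b, w₂ x‖ ≤ ∫ x in a..b, G * (|φ₂ x| / φ₁ x ^ 2) := by
    refine intervalIntegral.norm_integral_le_of_norm_le hab ?_ (hir.const_mul G)
    refine Eventually.of_forall fun x hx => ?_
    have hx' : x ∈ Set.Icc a b := ⟨hx.1.le, hx.2⟩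
    simp only [hw₂]
    rw [norm_mul, hexp, one_mul, norm_div, norm_mul, norm_mul, norm_I, one_mul, norm_pow,
      Complex.norm_real, Complex.norm_real, Real.norm_eq_abs, Real.norm_eq_abs, sq_abs, mul_div_assoc]
    exact mul_le_mul_of_nonneg_right (hgb x hx') (by positivity)
  rw [intervalIntegral.integral_const_mul] at h2
  have hA := hbd a ⟨le_rfl, hab⟩
  have hB := hbd b ⟨hab, le_rfl⟩
  rw [abs_of_nonneg (sub_nonneg.2 hab)] at h1
  have : (∫ x in a..b, Complex.exp (I * (φ x : ℂ)) * g x) =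
      (Complex.exp (I * (φ b : ℂ)) * (g b / (I * (φ₁ b : ℂ)))
        - Complex.exp (I * (φ a : ℂ)) * (g a / (I * (φ₁ a : ℂ))))
        - (∫ x in a..b, w₁ x) + ∫ x in a..b, w₂ x := by
    rw [← hFTC]; ring
  rw [this]
  refine (norm_add_le _ _).trans ?_
  refine (add_le_add ((norm_sub_le _ _).trans (add_le_add (norm_sub_le _ _) le_rfl)) le_rfl).trans ?_
  have : (2 * G + G₁ * (b - a)) / ρ = G / ρ + G / ρ + G₁ / ρ * (b - a) := by ring
  linarith

/-- First derivative test for a phase with monotone derivative. -/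
theorem norm_oscillatory_le_of_monotone {a b : ℝ} (hab : a ≤ b) {φ φ₁ φ₂ : ℝ → ℝ} {g : ℝ → ℂ}
    {ρ G G₁ ε : ℝ} (hρ : 0 < ρ) (hε : ε = 1 ∨ ε = -1)
    (hφ : ∀ x ∈ Set.Icc a b, HasDerivAt φ (φ₁ x) x)
    (hφ₁ : ∀ x ∈ Set.Icc a b, HasDerivAt φ₁ (φ₂ x) x)
    (hφ₂ : ContinuousOn φ₂ (Set.Icc a b))
    (hlow : ∀ x ∈ Set.Icc a b, ρ ≤ |φ₁ x|)
    (hsign : ∀ x ∈ Set.Icc a b, 0 ≤ ε * φ₂ x)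
    (hg : ∀ x ∈ Set.Icc a b, DifferentiableAt ℝ g x)
    (hgb : ∀ x ∈ Set.Icc a b, ‖g x‖ ≤ G)
    (hgd : ∀ x ∈ Set.Icc a b, ‖deriv g x‖ ≤ G₁) :
    ‖∫ x in a..b, Complex.exp (I * (φ x : ℂ)) * g x‖ ≤ (4 * G + G₁ * (b - a)) / ρ := by
  have hG : 0 ≤ G := (norm_nonneg _).trans (hgb a ⟨le_rfl, hab⟩)
  have hne : ∀ x ∈ Set.Icc a b, φ₁ x ≠ 0 := fun x hx h0 => by
    have := hlow x hx; rw [h0, abs_zero] at this; linarith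
  have hφ₁c : ContinuousOn φ₁ (Set.Icc a b) :=
    fun x hx => (hφ₁ x hx).continuousAt.continuousWithinAt
  refine (norm_oscillatory_le_of_le_abs_deriv hab hρ hφ hφ₁ hφ₂ hlow hg hgb hgd).trans ?_
  have key : ∫ x in a..b, |φ₂ x| / φ₁ x ^ 2 ≤ 2 / ρ := by
    have e1 : ∫ x in a..b, |φ₂ x| / φ₁ x ^ 2 = ∫ x in a..b, ε * (φ₂ x / φ₁ x ^ 2) := by
      refine intervalIntegral.integral_congr fun x hx => ?_
      rw [Set.uIcc_of_le hab] at hx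
      have : |φ₂ x| = ε * φ₂ x := by
        have h := hsign x hx
        rcases hε with rfl | rfl
        · rw [abs_of_nonneg (by linarith)]; ring
        · rw [abs_of_nonpos (by linarith)]; ring
      simp only [this]; ring
    have e2 : ∫ x in a..b, ε * (φ₂ x / φ₁ x ^ 2) = ε * -(φ₁ b)⁻¹ - ε * -(φ₁ a)⁻¹ := by
      refine intervalIntegral.integral_eq_sub_of_hasDerivAt (f := fun x => ε * -(φ₁ x)⁻¹) ?_ ?_
      · intro x hx
        rw [Set.uIcc_of_le hab] at hx
        refine (((hφ₁ x hx).inv (hne x hx)).neg.const_mul ε).congr_deriv ?_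
        ring
      · refine ContinuousOn.intervalIntegrable ?_
        rw [Set.uIcc_of_le hab]
        exact continuousOn_const.mul (hφ₂.div (hφ₁c.pow 2) fun x hx => pow_ne_zero _ (hne x hx))
    have hb : ∀ x ∈ Set.Icc a b, |(φ₁ x)⁻¹| ≤ 1 / ρ := fun x hx => by
      rw [abs_inv, one_div]
      exact inv_anti₀ hρ (hlow x hx)
    have ha' := abs_le.1 (hb a ⟨le_rfl, hab⟩)
    have hb' := abs_le.1 (hb b ⟨hab, le_rfl⟩)
    rw [e1, e2]
    have : 2 / ρ = 1 / ρ + 1 / ρ := by ring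
    rcases hε with rfl | rfl <;> linarith [ha'.1, ha'.2, hb'.1, hb'.2]
  have := mul_le_mul_of_nonneg_left key hG
  have e : (4 * G + G₁ * (b - a)) / ρ = (2 * G + G₁ * (b - a)) / ρ + G * (2 / ρ) := by ring
  rw [e]; linarith

theorem exists_level_split {a b : ℝ} (hab : a ≤ b) {f : ℝ → ℝ} (hf : ContinuousOn f (Set.Icc a b))
    (hm : MonotoneOn f (Set.Icc a b)) (l : ℝ) :
    ∃ c ∈ Set.Icc a b, (a = c ∨ ∀ x ∈ Set.Icc a c, f x ≤ l) ∧
      (c = b ∨ ∀ x ∈ Set.Icc c b, l ≤ f x) := by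
  by_cases h1 : l ≤ f a
  · exact ⟨a, ⟨le_rfl, hab⟩, Or.inl rfl, Or.inr fun x hx => h1.trans (hm ⟨le_rfl, hab⟩ hx hx.1)⟩
  by_cases h2 : f b ≤ l
  · exact ⟨b, ⟨hab, le_rfl⟩, Or.inr fun x hx => (hm hx ⟨hab, le_rfl⟩ hx.2).trans h2, Or.inl rfl⟩
  push Not at h1 h2
  obtain ⟨c, hc, hfc⟩ := intermediate_value_Icc hab hf ⟨h1.le, h2.le⟩
  exact ⟨c, hc, Or.inr fun x hx => hfc ▸ hm ⟨hx.1, hx.2.trans hc.2⟩ hc hx.2,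
    Or.inr fun x hx => hfc ▸ hm hc ⟨hc.1.trans hx.1, hx.2⟩ hx.1⟩

/-- The sublevel set `|f| < r` of an expanding function is contained in a short interval. -/
theorem exists_sublevel_split {a b m r : ℝ} (hab : a ≤ b) (hm : 0 < m) (hr : 0 < r) {f : ℝ → ℝ}
    (hf : ContinuousOn f (Set.Icc a b))
    (hinc : ∀ x ∈ Set.Icc a b, ∀ y ∈ Set.Icc a b, x ≤ y → m * (y - x) ≤ f y - f x) :
    ∃ c₁ c₂ : ℝ, a ≤ c₁ ∧ c₁ ≤ c₂ ∧ c₂ ≤ b ∧ c₂ - c₁ ≤ 2 * r / m ∧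
      (a = c₁ ∨ ∀ x ∈ Set.Icc a c₁, f x ≤ -r) ∧ (c₂ = b ∨ ∀ x ∈ Set.Icc c₂ b, r ≤ f x) := by
  have hmono : MonotoneOn f (Set.Icc a b) := fun x hx y hy hxy => by
    have := hinc x hx y hy hxy
    nlinarith
  obtain ⟨c₁, hc₁, h1, h1'⟩ := exists_level_split hab hf hmono (-r)
  have hsub : Set.Icc c₁ b ⊆ Set.Icc a b := Set.Icc_subset_Icc hc₁.1 le_rfl
  obtain ⟨c₂, hc₂, h2, h2'⟩ := exists_level_split hc₁.2 (hf.mono hsub) (hmono.mono hsub) r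
  refine ⟨c₁, c₂, hc₁.1, hc₂.1, hc₂.2, ?_, h1, h2'⟩
  rcases h2 with h2 | h2
  · rw [h2, sub_self]; positivity
  rcases h1' with h1' | h1'
  · have : c₂ = c₁ := le_antisymm (h1' ▸ hc₂.2) hc₂.1
    rw [this, sub_self]; positivity
  have e1 := h1' c₁ ⟨le_rfl, hc₁.2⟩
  have e2 := h2 c₂ ⟨hc₂.1, le_rfl⟩
  have := hinc c₁ hc₁ c₂ (hsub hc₂) hc₂.1
  rw [le_div_iff₀ hm]
  nlinarith

theorem norm_integral_le_three_pieces {a b c₁ c₂ B₁ B₂ B₃ : ℝ} {f : ℝ → ℂ} (h1 : a ≤ c₁)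
    (h2 : c₁ ≤ c₂) (h3 : c₂ ≤ b)
    (hf : IntervalIntegrable f volume a b)
    (b1 : ‖∫ x in a..c₁, f x‖ ≤ B₁) (b2 : ‖∫ x in c₁..c₂, f x‖ ≤ B₂)
    (b3 : ‖∫ x in c₂..b, f x‖ ≤ B₃) : ‖∫ x in a..b, f x‖ ≤ B₁ + B₂ + B₃ := by
  have hs : ∀ {x y : ℝ}, a ≤ x → x ≤ y → y ≤ b → IntervalIntegrable f volume x y :=
    fun hx hxy hy => hf.mono_set (by
      rw [Set.uIcc_of_le hxy, Set.uIcc_of_le (hx.trans (hxy.trans hy))]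
      exact Set.Icc_subset_Icc hx hy)
  rw [← intervalIntegral.integral_add_adjacent_intervals (hs le_rfl h1 (h2.trans h3))
      (hs h1 (h2.trans h3) le_rfl),
    ← intervalIntegral.integral_add_adjacent_intervals (hs h1 h2 h3) (hs (h1.trans h2) h3 le_rfl)]
  refine (norm_add_le _ _).trans ?_
  have := norm_add_le (∫ x in c₁..c₂, f x) (∫ x in c₂..b, f x)
  linarith

theorem intervalIntegrable_oscillatory {a b : ℝ} (hab : a ≤ b) {φ : ℝ → ℝ} {g : ℝ → ℂ}
    (hφ : ContinuousOn φ (Set.Icc a b)) (hg : ContinuousOn g (Set.Icc a b)) :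
    IntervalIntegrable (fun x => Complex.exp (I * (φ x : ℂ)) * g x) volume a b := by
  refine ContinuousOn.intervalIntegrable ?_
  rw [Set.uIcc_of_le hab]
  exact (continuousOn_const.mul (Complex.continuous_ofReal.comp_continuousOn hφ)).cexp.mul hg

theorem norm_oscillatory_le_length {a b : ℝ} (hab : a ≤ b) {φ : ℝ → ℝ} {g : ℝ → ℂ} {G : ℝ}
    (hgb : ∀ x ∈ Set.Icc a b, ‖g x‖ ≤ G) :
    ‖∫ x in a..b, Complex.exp (I * (φ x : ℂ)) * g x‖ ≤ G * (b - a) := by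
  have := intervalIntegral.norm_integral_le_of_norm_le_const (a := a) (b := b) (C := G)
    (f := fun x => Complex.exp (I * (φ x : ℂ)) * g x) (fun x hx => by
      rw [Set.uIoc_of_le hab] at hx
      rw [norm_mul, mul_comm I, Complex.norm_exp_ofReal_mul_I, one_mul]
      exact hgb x ⟨hx.1.le, hx.2⟩)
  rwa [abs_of_nonneg (sub_nonneg.2 hab)] at this

/-- Second derivative test of van der Corput. -/
theorem norm_oscillatory_le_of_second_deriv {a b : ℝ} (hab : a ≤ b) {φ φ₁ φ₂ : ℝ → ℝ} {g : ℝ → ℂ}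
    {ρ G G₁ ε : ℝ} (hρ : 0 < ρ) (hε : ε = 1 ∨ ε = -1)
    (hφ : ∀ x ∈ Set.Icc a b, HasDerivAt φ (φ₁ x) x)
    (hφ₁ : ∀ x ∈ Set.Icc a b, HasDerivAt φ₁ (φ₂ x) x)
    (hφ₂ : ContinuousOn φ₂ (Set.Icc a b))
    (hlow : ∀ x ∈ Set.Icc a b, ρ ≤ ε * φ₂ x)
    (hg : ∀ x ∈ Set.Icc a b, DifferentiableAt ℝ g x)
    (hgb : ∀ x ∈ Set.Icc a b, ‖g x‖ ≤ G)
    (hgd : ∀ x ∈ Set.Icc a b, ‖deriv g x‖ ≤ G₁) :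
    ‖∫ x in a..b, Complex.exp (I * (φ x : ℂ)) * g x‖ ≤ 10 * (G + G₁ * (b - a)) / √ρ := by
  have hG : 0 ≤ G := (norm_nonneg _).trans (hgb a ⟨le_rfl, hab⟩)
  have hG₁ : 0 ≤ G₁ := (norm_nonneg _).trans (hgd a ⟨le_rfl, hab⟩)
  have hr : 0 < √ρ := Real.sqrt_pos.2 hρ
  have hφ₁c : ContinuousOn φ₁ (Set.Icc a b) :=
    fun x hx => (hφ₁ x hx).continuousAt.continuousWithinAt
  have hinc : ∀ x ∈ Set.Icc a b, ∀ y ∈ Set.Icc a b, x ≤ y →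
      ρ * (y - x) ≤ ε * φ₁ y - ε * φ₁ x := by
    intro x hx y hy hxy
    refine (convex_Icc a b).mul_sub_le_image_sub_of_le_deriv (f := fun x => ε * φ₁ x)
      (continuousOn_const.mul hφ₁c) ?_ ?_ x hx y hy hxy
    · intro z hz
      rw [interior_Icc] at hz
      exact ((hφ₁ z ⟨hz.1.le, hz.2.le⟩).const_mul ε).differentiableAt.differentiableWithinAt
    · intro z hz
      rw [interior_Icc] at hz
      rw [((hφ₁ z ⟨hz.1.le, hz.2.le⟩).const_mul ε).deriv]
      exact hlow z ⟨hz.1.le, hz.2.le⟩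
  obtain ⟨c₁, c₂, h1, h2, h3, hlen, hl, hu⟩ :=
    exists_sublevel_split (f := fun x => ε * φ₁ x) hab hρ hr (continuousOn_const.mul hφ₁c) hinc
  have habs : ∀ x, |φ₁ x| = |ε * φ₁ x| := fun x => by
    rcases hε with rfl | rfl <;> simp
  have outer : ∀ x y : ℝ, a ≤ x → x ≤ y → y ≤ b → (∀ z ∈ Set.Icc x y, √ρ ≤ |φ₁ z|) →
      ‖∫ x in x..y, Complex.exp (I * (φ x : ℂ)) * g x‖ ≤ (4 * G + G₁ * (b - a)) / √ρ := by
    intro x y hx hxy hy hz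
    have hs : Set.Icc x y ⊆ Set.Icc a b := Set.Icc_subset_Icc hx hy
    refine (norm_oscillatory_le_of_monotone hxy hr hε (fun z hz => hφ z (hs hz))
      (fun z hz => hφ₁ z (hs hz)) (hφ₂.mono hs) hz (fun z hz => hρ.le.trans (hlow z (hs hz)))
      (fun z hz => hg z (hs hz)) (fun z hz => hgb z (hs hz)) (fun z hz => hgd z (hs hz))).trans ?_
    gcongr
  have hpos : 0 ≤ (4 * G + G₁ * (b - a)) / √ρ :=
    div_nonneg (by nlinarith [mul_nonneg hG₁ (sub_nonneg.2 hab)]) hr.le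
  have B1 : ‖∫ x in a..c₁, Complex.exp (I * (φ x : ℂ)) * g x‖ ≤ (4 * G + G₁ * (b - a)) / √ρ := by
    rcases hl with rfl | hl
    · simpa using hpos
    · refine outer a c₁ le_rfl h1 (h2.trans h3) fun z hz => ?_
      rw [habs, abs_of_nonpos (by linarith [hl z hz])]
      linarith [hl z hz]
  have B3 : ‖∫ x in c₂..b, Complex.exp (I * (φ x : ℂ)) * g x‖ ≤ (4 * G + G₁ * (b - a)) / √ρ := by
    rcases hu with rfl | hu
    · simpa using hpos
    · refine outer c₂ b (h1.trans h2) h3 le_rfl fun z hz => ?_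
      rw [habs, abs_of_nonneg (by linarith [hu z hz])]
      exact hu z hz
  have B2 : ‖∫ x in c₁..c₂, Complex.exp (I * (φ x : ℂ)) * g x‖ ≤ 2 * G / √ρ := by
    refine (norm_oscillatory_le_length h2 (G := G)
      fun x hx => hgb x ⟨h1.trans hx.1, hx.2.trans h3⟩).trans ?_
    have : 2 * √ρ / ρ = 2 / √ρ := by
      rw [div_eq_div_iff hρ.ne' hr.ne', mul_assoc, Real.mul_self_sqrt hρ.le]
    rw [this] at hlen
    calc G * (c₂ - c₁) ≤ G * (2 / √ρ) := by gcongr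
      _ = _ := by ring
  have h_int : IntervalIntegrable (fun x => Complex.exp (I * (φ x : ℂ)) * g x) volume a b :=
    intervalIntegrable_oscillatory hab
      (fun x hx => (hφ x hx).continuousAt.continuousWithinAt)
      (fun x hx => (hg x hx).continuousAt.continuousWithinAt)
  refine (norm_integral_le_three_pieces h1 h2 h3 h_int B1 B2 B3).trans ?_
  rw [← add_div, ← add_div]
  gcongr
  nlinarith [mul_nonneg hG₁ (sub_nonneg.2 hab)]

theorem norm_integral_le_of_dyadic {f : ℝ → ℂ} {w : ℝ → ℝ} {q : ℝ} (hq0 : 0 ≤ q) (hq : q < 1)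
    (hw : ∀ u, 0 < u → w (2 * u) ≤ q * w u) {R : ℝ} {u : ℝ} (hu : 0 < u) (huR : u ≤ R)
    (hf : IntervalIntegrable f volume u R)
    (hp : ∀ x y, u ≤ x → x ≤ y → y ≤ 2 * x → y ≤ R → ‖∫ t in x..y, f t‖ ≤ w x) :
    ‖∫ t in u..R, f t‖ ≤ w u / (1 - q) := by
  obtain ⟨n, hn⟩ : ∃ n : ℕ, R ≤ 2 ^ n * u := by
    obtain ⟨n, hn⟩ := pow_unbounded_of_one_lt (R / u) (one_lt_two)
    exact ⟨n, by rw [div_lt_iff₀ hu] at hn; exact hn.le⟩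
  have h1q : 0 < 1 - q := by linarith
  induction n generalizing u with
  | zero =>
    have : R = u := by linarith [huR]
    subst this
    have h0 := hp R R le_rfl le_rfl (by linarith) le_rfl
    refine h0.trans ?_
    have := (norm_nonneg _).trans h0
    rw [le_div_iff₀ h1q]
    nlinarith
  | succ n ih =>
    by_cases h2 : R ≤ 2 * u
    · have h0 := hp u R le_rfl huR h2 le_rfl
      refine h0.trans ?_
      have := (norm_nonneg _).trans h0
      rw [le_div_iff₀ h1q]
      nlinarith
    · push Not at h2
      have hsub1 : IntervalIntegrable f volume u (2 * u) := hf.mono_set (by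
        rw [Set.uIcc_of_le (by linarith), Set.uIcc_of_le huR]
        exact Set.Icc_subset_Icc le_rfl h2.le)
      have hsub2 : IntervalIntegrable f volume (2 * u) R := hf.mono_set (by
        rw [Set.uIcc_of_le h2.le, Set.uIcc_of_le huR]
        exact Set.Icc_subset_Icc (by linarith) le_rfl)
      have h0 := hp u (2 * u) le_rfl (by linarith) le_rfl h2.le
      have h3 := ih (u := 2 * u) (by linarith) h2.le hsub2
        (fun x y hx => hp x y (by linarith)) (by rw [pow_succ] at hn; linarith)
      rw [← intervalIntegral.integral_add_adjacent_intervals hsub1 hsub2]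
      refine (norm_add_le _ _).trans ((add_le_add h0 h3).trans ?_)
      have := hw u hu
      rw [le_div_iff₀ h1q] at h3 ⊢
      have e : (w u + w (2 * u) / (1 - q)) * (1 - q) = w u * (1 - q) + w (2 * u) := by
        field_simp
      rw [e]
      linarith

theorem abs_div_sub_sq_bounds {d t : ℝ} (ht0 : 0 < t) :
    (|d| / t - t) ^ 2 ≤ (d / t - t) ^ 2 ∧ (d / t - t) ^ 2 ≤ (|d| / t + t) ^ 2 := by
  have h1 : d / t ≤ |d| / t := by have := le_abs_self d; gcongr
  have e : (|d| / t) ^ 2 = (d / t) ^ 2 := by rw [div_pow, div_pow, sq_abs]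
  have h2 : -(d / t) ≤ |d| / t := by rw [← neg_div]; have := neg_le_abs d; gcongr
  constructor
  · have : (|d| / t - t) ^ 2 = (d / t) ^ 2 - 2 * t * (|d| / t) + t ^ 2 := by rw [← e]; ring
    rw [this]
    nlinarith
  · have : (|d| / t + t) ^ 2 = (d / t) ^ 2 + 2 * t * (|d| / t) + t ^ 2 := by rw [← e]; ring
    rw [this]
    nlinarith

theorem le_abs_of_near {s d r k t : ℝ} (hr1 : r ≤ 1) (hr0 : 0 ≤ r) (hr2 : r ^ 2 = |s|)
    (hsr : s = -r ^ 2) (ht0 : 0 < t) (hts : t ≤ |s| / 50) (hk : |k| ≤ |s| / 10)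
    (hde : 4 * r ≤ |d| / t) :
    (|s| + d ^ 2 / t ^ 2) / 10 ≤ |s + k + (d / t - t) ^ 2 / 4| := by
  refine le_trans ?_ (le_abs_self _)
  have hee := (abs_div_sub_sq_bounds (d := d) ht0).1
  have hd2 : d ^ 2 / t ^ 2 = (|d| / t) ^ 2 := by rw [div_pow, sq_abs]
  have h1 := abs_le.1 hk
  rw [hd2]
  rw [← hr2] at h1 hts ⊢
  generalize |d| / t = e at *
  have : t ≤ r / 50 := by nlinarith
  have : (99 / 100 * e) ^ 2 ≤ (e - t) ^ 2 := by
    apply pow_le_pow_left₀ (by linarith)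
    linarith
  have : (4 * r) ^ 2 ≤ e ^ 2 := pow_le_pow_left₀ (by linarith) hde 2
  linarith

theorem le_abs_of_far {s d r k t : ℝ} (hr1 : r ≤ 1) (hr0 : 0 ≤ r) (hr2 : r ^ 2 = |s|)
    (hsr : s = -r ^ 2) (ht0 : 0 < t) (hts : t ≤ |s| / 50) (hk : |k| ≤ |s| / 10)
    (hde : |d| / t ≤ r) :
    (|s| + d ^ 2 / t ^ 2) / 10 ≤ |s + k + (d / t - t) ^ 2 / 4| := by
  refine le_trans ?_ (neg_le_abs _)
  have hee := (abs_div_sub_sq_bounds (d := d) ht0).2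
  have hd2 : d ^ 2 / t ^ 2 = (|d| / t) ^ 2 := by rw [div_pow, sq_abs]
  have h1 := abs_le.1 hk
  have he0 : 0 ≤ |d| / t := by positivity
  rw [hd2]
  rw [← hr2] at h1 hts ⊢
  generalize |d| / t = e at *
  have : t ≤ r / 50 := by nlinarith
  have : (e + t) ^ 2 ≤ (51 / 50 * r) ^ 2 := by
    apply pow_le_pow_left₀ (by linarith)
    linarith
  have : e ^ 2 ≤ r ^ 2 := pow_le_pow_left₀ he0 hde 2
  linarith [sq_nonneg r]

/-- A phase on the half-line with derivative `s + K(t) + (d/t - t)²/4` and an amplitude of size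
`t^{-1/2}` with symbol-type derivative. -/
structure TangentialPhase (M s d R : ℝ) (H K κ : ℝ → ℝ) (β : ℝ → ℂ) : Prop where
  hM : 1 / 2 ≤ M
  hs : |s| ≤ 1
  hH : ∀ t ∈ Set.Ioc 0 R, HasDerivAt H (s + K t + (d / t - t) ^ 2 / 4) t
  hK : ∀ t ∈ Set.Ioc 0 R, HasDerivAt K (κ t) t
  hKb : ∀ t ∈ Set.Ioc 0 R, |K t| ≤ 5 * t
  hκb : ∀ t ∈ Set.Ioc 0 R, |κ t| ≤ 5
  hκc : ContinuousOn κ (Set.Ioc 0 R)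
  hβ : ∀ t ∈ Set.Ioc 0 R, DifferentiableAt ℝ β t
  hβb : ∀ t ∈ Set.Ioc 0 R, ‖β t‖ ≤ 1 / √t
  hβd : ∀ t ∈ Set.Ioc 0 R, 1 / 2 ≤ M * t → ‖deriv β t‖ ≤ 1 / (t * √t)
  h_int : IntervalIntegrable (fun t => Complex.exp (I * ((M * H t : ℝ) : ℂ)) * β t) volume 0 R

namespace TangentialPhase

variable {M s d R : ℝ} {H K κ : ℝ → ℝ} {β : ℝ → ℂ}

theorem hasDerivAt_two (h : TangentialPhase M s d R H K κ β) {t : ℝ} (ht : t ∈ Set.Ioc 0 R) :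
    HasDerivAt (fun t => s + K t + (d / t - t) ^ 2 / 4) (κ t + t / 2 - d ^ 2 / (2 * t ^ 3)) t := by
  have ht0 : t ≠ 0 := ht.1.ne'
  have h1 : HasDerivAt (fun t : ℝ => d / t) (-d / t ^ 2) t := by
    refine ((hasDerivAt_const t d).div (hasDerivAt_id t) ht0).congr_deriv ?_
    simp
  refine (((h.hK t ht).const_add s).add (((h1.sub (hasDerivAt_id t)).pow 2).div_const 4)).congr_deriv ?_
  simp only [Pi.sub_apply, id]
  have : (t - d / t) * (1 + d / t ^ 2) = t - d ^ 2 / t ^ 3 := by field_simp; ring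
  have e : d ^ 2 / (2 * t ^ 3) = d ^ 2 / t ^ 3 / 2 := by field_simp
  rw [e]
  push_cast
  linear_combination this / 2

theorem continuousOn_two (h : TangentialPhase M s d R H K κ β) :
    ContinuousOn (fun t => κ t + t / 2 - d ^ 2 / (2 * t ^ 3)) (Set.Ioc 0 R) := by
  refine (h.hκc.add (continuousOn_id.div_const 2)).sub (continuousOn_const.div ?_ ?_)
  · exact continuousOn_const.mul (continuousOn_id.pow 3)
  · intro t ht
    have := ht.1
    exact (by positivity : 2 * t ^ 3 ≠ 0)

theorem M_pos (h : TangentialPhase M s d R H K κ β) : 0 < M := by linarith [h.hM]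

theorem Icc_subset {u v : ℝ} (hu : 0 < u) (hv : v ≤ R) : Set.Icc u v ⊆ Set.Ioc 0 R :=
  fun _ ht => ⟨hu.trans_le ht.1, ht.2.trans hv⟩

theorem amp_bounds (h : TangentialPhase M s d R H K κ β) {u v : ℝ} (hu : 0 < u) (hv : v ≤ R)
    (hMu : 1 / 2 ≤ M * u) :
    (∀ t ∈ Set.Icc u v, ‖β t‖ ≤ 1 / √u) ∧ (∀ t ∈ Set.Icc u v, ‖deriv β t‖ ≤ 1 / (u * √u)) := by
  have hM := h.M_pos
  have hsu : 0 < √u := Real.sqrt_pos.2 hu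
  constructor
  · intro t ht
    refine (h.hβb t (Icc_subset hu hv ht)).trans ?_
    have := Real.sqrt_le_sqrt ht.1
    gcongr
  · intro t ht
    have := Real.sqrt_le_sqrt ht.1
    refine (h.hβd t (Icc_subset hu hv ht) (hMu.trans ?_)).trans ?_
    · exact mul_le_mul_of_nonneg_left ht.1 hM.le
    · have := ht.1
      have : 0 < t := by linarith
      gcongr

theorem integrable_sub (h : TangentialPhase M s d R H K κ β) {u v : ℝ} (hu : 0 ≤ u) (huv : u ≤ v)
    (hv : v ≤ R) :
    IntervalIntegrable (fun t => Complex.exp (I * ((M * H t : ℝ) : ℂ)) * β t) volume u v :=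
  h.h_int.mono_set (by
    rw [Set.uIcc_of_le huv, Set.uIcc_of_le (hu.trans (huv.trans hv))]
    exact Set.Icc_subset_Icc hu hv)

theorem norm_le_sqrt (h : TangentialPhase M s d R H K κ β) {u : ℝ} (hu : 0 < u) (huR : u ≤ R) :
    ‖∫ t in (0:ℝ)..u, Complex.exp (I * ((M * H t : ℝ) : ℂ)) * β t‖ ≤ 2 * √u := by
  have hi : IntervalIntegrable (fun t : ℝ => t ^ (-(1/2) : ℝ)) volume 0 u :=
    intervalIntegral.intervalIntegrable_rpow' (by norm_num)
  have := intervalIntegral.norm_integral_le_of_norm_le hu.le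
    (f := fun t => Complex.exp (I * ((M * H t : ℝ) : ℂ)) * β t) (Eventually.of_forall fun t ht => ?_) hi
  · refine this.trans (le_of_eq ?_)
    rw [integral_rpow (Or.inl (by norm_num))]
    rw [Real.sqrt_eq_rpow]
    norm_num
    ring
  · rw [norm_mul, mul_comm I, Complex.norm_exp_ofReal_mul_I, one_mul]
    refine (h.hβb t ⟨ht.1, ht.2.trans huR⟩).trans (le_of_eq ?_)
    rw [Real.rpow_neg ht.1.le, Real.sqrt_eq_rpow, one_div]

/-- Second derivative test on a piece of bounded ratio. -/
theorem norm_le_of_two (h : TangentialPhase M s d R H K κ β) {u v ρ ε : ℝ} (hu : 0 < u)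
    (huv : u ≤ v) (hv : v ≤ R) (hMu : 1 / 2 ≤ M * u) (hρ : 0 < ρ) (hε : ε = 1 ∨ ε = -1)
    (hG : v ≤ 4 * u)
    (hlow : ∀ t ∈ Set.Icc u v, ρ ≤ M * (ε * (κ t + t / 2 - d ^ 2 / (2 * t ^ 3)))) :
    ‖∫ t in u..v, Complex.exp (I * ((M * H t : ℝ) : ℂ)) * β t‖ ≤ 40 * (1 / √u) / √ρ := by
  have hsub := Icc_subset hu hv
  have hsu : 0 < √u := Real.sqrt_pos.2 hu
  obtain ⟨hb, hd⟩ := h.amp_bounds hu hv hMu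
  refine (norm_oscillatory_le_of_second_deriv (φ := fun t => M * H t)
    (φ₁ := fun t => M * (s + K t + (d / t - t) ^ 2 / 4))
    (φ₂ := fun t => M * (κ t + t / 2 - d ^ 2 / (2 * t ^ 3))) huv hρ hε
    (fun t ht => (h.hH t (hsub ht)).const_mul M)
    (fun t ht => (h.hasDerivAt_two (hsub ht)).const_mul M)
    (continuousOn_const.mul (h.continuousOn_two.mono hsub))
    (fun t ht => (hlow t ht).trans (le_of_eq (by ring))) (fun t ht => h.hβ t (hsub ht)) hb hd).trans ?_
  have : 1 / (u * √u) * (v - u) ≤ 1 / (u * √u) * (3 * u) := by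
    gcongr
    linarith
  have e : 1 / (u * √u) * (3 * u) = 3 * (1 / √u) := by field_simp
  have e2 : 40 * (1 / √u) = 10 * (4 * (1 / √u)) := by ring
  rw [e2]
  gcongr
  linarith

theorem norm_le_length (h : TangentialPhase M s d R H K κ β) {u x y : ℝ} (hu : 0 < u)
    (hx : u ≤ x) (hxy : x ≤ y) (hy : y ≤ R) :
    ‖∫ t in x..y, Complex.exp (I * ((M * H t : ℝ) : ℂ)) * β t‖ ≤ 1 / √u * (y - x) := by
  refine norm_oscillatory_le_length (φ := fun t => M * H t) hxy fun t ht => ?_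
  refine (h.hβb t ⟨hu.trans_le (hx.trans ht.1), ht.2.trans hy⟩).trans ?_
  have hsu : 0 < √u := Real.sqrt_pos.2 hu
  have := Real.sqrt_le_sqrt (hx.trans ht.1)
  gcongr

/-- A piece on which the second derivative is small only on a short interval. -/
theorem norm_le_of_split (h : TangentialPhase M s d R H K κ β) {u v m τ z : ℝ} {F : ℝ → ℝ}
    (hu : 0 < u) (huv : u ≤ v) (hv : v ≤ R) (h2 : v ≤ 2 * u) (hMu : 1 / 2 ≤ M * u)
    (hz : 0 < z) (hm : 0 < m) (hτ : 0 < τ) (hτm : τ ≤ 2 * (m * z))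
    (hF : ContinuousOn F (Set.Icc u v))
    (hinc : ∀ x ∈ Set.Icc u v, ∀ y ∈ Set.Icc u v, x ≤ y → m * (y - x) ≤ F y - F x)
    (hlow : ∀ ε : ℝ, (ε = 1 ∨ ε = -1) → ∀ t ∈ Set.Icc u v, τ ≤ ε * F t →
      1 / (8 * z ^ 2) ≤ M * (ε * (κ t + t / 2 - d ^ 2 / (2 * t ^ 3)))) :
    ‖∫ t in u..v, Complex.exp (I * ((M * H t : ℝ) : ℂ)) * β t‖ ≤ 300 * (z * (1 / √u)) := by
  have hM := h.M_pos
  have hsu : 0 < √u := Real.sqrt_pos.2 hu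
  obtain ⟨c₁, c₂, h1, h12, h3, hlen, hl, hr⟩ := exists_sublevel_split huv hm hτ hF hinc
  have hρ : 0 < 1 / (8 * z ^ 2) := by positivity
  have hout : 40 * (1 / √u) / √(1 / (8 * z ^ 2)) ≤ 120 * (z * (1 / √u)) := by
    rw [div_le_iff₀ (Real.sqrt_pos.2 hρ)]
    have : 1 / (3 * z) ≤ √(1 / (8 * z ^ 2)) := by
      apply Real.le_sqrt_of_sq_le
      rw [div_pow, one_pow]
      apply one_div_le_one_div_of_le (by positivity)
      nlinarith [sq_nonneg z]
    calc 40 * (1 / √u) = 120 * (z * (1 / √u)) * (1 / (3 * z)) := by field_simp; norm_num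
      _ ≤ _ := by gcongr
  have hp : 0 ≤ 120 * (z * (1 / √u)) := by positivity
  have outer : ∀ x y ε, u ≤ x → x ≤ y → y ≤ v → (ε = 1 ∨ ε = -1) →
      (∀ t ∈ Set.Icc x y, τ ≤ ε * F t) →
      ‖∫ t in x..y, Complex.exp (I * ((M * H t : ℝ) : ℂ)) * β t‖ ≤ 120 * (z * (1 / √u)) := by
    intro x y ε hx hxy hy hε ht
    have hx0 : 0 < x := hu.trans_le hx
    refine (h.norm_le_of_two hx0 hxy (hy.trans hv) (hMu.trans (by gcongr)) hρ hε (by linarith)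
      (fun t htt => hlow ε hε t ⟨hx.trans htt.1, htt.2.trans hy⟩ (ht t htt))).trans ?_
    refine le_trans ?_ hout
    have := Real.sqrt_le_sqrt hx
    gcongr
  have B1 : ‖∫ t in u..c₁, Complex.exp (I * ((M * H t : ℝ) : ℂ)) * β t‖ ≤ 120 * (z * (1 / √u)) := by
    rcases hl with rfl | hl
    · simpa using hp
    · exact outer u c₁ (-1) le_rfl h1 (h12.trans h3) (Or.inr rfl) fun t ht => by linarith [hl t ht]
  have B3 : ‖∫ t in c₂..v, Complex.exp (I * ((M * H t : ℝ) : ℂ)) * β t‖ ≤ 120 * (z * (1 / √u)) := by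
    rcases hr with rfl | hr
    · simpa using hp
    · exact outer c₂ v 1 (h1.trans h12) h3 le_rfl (Or.inl rfl) fun t ht => by linarith [hr t ht]
  have B2 : ‖∫ t in c₁..c₂, Complex.exp (I * ((M * H t : ℝ) : ℂ)) * β t‖ ≤ 4 * (z * (1 / √u)) := by
    refine (h.norm_le_length hu h1 h12 (h3.trans hv)).trans ?_
    have : c₂ - c₁ ≤ 4 * z := by
      refine hlen.trans ?_
      rw [div_le_iff₀ hm]
      linarith
    calc 1 / √u * (c₂ - c₁) ≤ 1 / √u * (4 * z) := by gcongr
      _ = _ := by ring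
  have hz' : 0 ≤ z * (1 / √u) := by positivity
  refine (norm_integral_le_three_pieces h1 h12 h3 (h.integrable_sub hu.le huv hv) B1 B2 B3).trans ?_
  linarith


theorem norm_le_of_nonstationary (h : TangentialPhase M s d R H K κ β) {u v : ℝ} (hu : 0 < u)
    (huv : u ≤ v) (hv : v ≤ R) (h2 : v ≤ 2 * u) (hMu : 1 / 2 ≤ M * u) (hs0 : 0 < |s|)
    (hvs : v ≤ |s| / 50)
    (hlow : ∀ t ∈ Set.Icc u v, (|s| + d ^ 2 / t ^ 2) / 10 ≤ |s + K t + (d / t - t) ^ 2 / 4|) :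
    ‖∫ t in u..v, Complex.exp (I * ((M * H t : ℝ) : ℂ)) * β t‖ ≤ 100 * (1 / √u) / (M * |s|) := by
  have hsub := Icc_subset hu hv
  have hM := h.M_pos
  have hsu : 0 < √u := Real.sqrt_pos.2 hu
  obtain ⟨hb, hd⟩ := h.amp_bounds hu hv hMu
  have hρ : 0 < M * |s| / 10 := by positivity
  have habs : ∀ t ∈ Set.Icc u v, M * |s| / 10 ≤ |M * (s + K t + (d / t - t) ^ 2 / 4)| := by
    intro t ht
    rw [abs_mul, abs_of_pos hM]
    have h1 := hlow t ht
    have h2 : 0 ≤ d ^ 2 / t ^ 2 := by positivity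
    have : |s| / 10 ≤ |s + K t + (d / t - t) ^ 2 / 4| := by linarith
    calc M * |s| / 10 = M * (|s| / 10) := by ring
      _ ≤ _ := by gcongr
  have main := norm_oscillatory_le_of_le_abs_deriv (φ := fun t => M * H t)
    (φ₁ := fun t => M * (s + K t + (d / t - t) ^ 2 / 4))
    (φ₂ := fun t => M * (κ t + t / 2 - d ^ 2 / (2 * t ^ 3))) huv hρ
    (fun t ht => (h.hH t (hsub ht)).const_mul M)
    (fun t ht => (h.hasDerivAt_two (hsub ht)).const_mul M)
    (continuousOn_const.mul (h.continuousOn_two.mono hsub))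
    habs (fun t ht => h.hβ t (hsub ht)) hb hd
  refine main.trans ?_
  have hI : ∫ t in u..v, |M * (κ t + t / 2 - d ^ 2 / (2 * t ^ 3))| /
      (M * (s + K t + (d / t - t) ^ 2 / 4)) ^ 2 ≤ 62 / (M * |s|) := by
    have hb : ∀ t ∈ Set.uIoc u v, ‖|M * (κ t + t / 2 - d ^ 2 / (2 * t ^ 3))| /
      (M * (s + K t + (d / t - t) ^ 2 / 4)) ^ 2‖ ≤ 62 / (M * u * |s|) := by
      intro t ht
      rw [Set.uIoc_of_le huv] at ht
      have ht' : t ∈ Set.Icc u v := ⟨ht.1.le, ht.2⟩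
      have ht0 : 0 < t := hu.trans ht.1
      have h1 := hlow t ht'
      have hκ := h.hκb t (hsub ht')
      have hs1 := h.hs
      set p := d ^ 2 / t ^ 2 with hp
      have hp0 : 0 ≤ p := by positivity
      have hq : d ^ 2 / (2 * t ^ 3) = p / (2 * t) := by rw [hp]; field_simp
      rw [hq, Real.norm_eq_abs, abs_of_nonneg (by positivity), abs_mul, abs_of_pos hM,
        ← sq_abs (M * _), abs_mul, abs_of_pos hM]
      have hnum : |κ t + t / 2 - p / (2 * t)| ≤ (6 / 50 * |s| + p / 2) / t := by
        have e1 : |κ t + t / 2 - p / (2 * t)| ≤ |κ t| + |t / 2| + |p / (2 * t)| :=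
          (abs_sub _ _).trans (by linarith [abs_add_le (κ t) (t / 2)])
        rw [abs_of_pos (by positivity : 0 < t / 2), abs_of_nonneg (by positivity : 0 ≤ p / (2 * t))] at e1
        have e2 : (6 / 50 * |s| + p / 2) / t = 6 / 50 * |s| / t + p / (2 * t) := by field_simp
        have e3 : 6 ≤ 6 / 50 * |s| / t := by
          rw [le_div_iff₀ ht0]; linarith [ht'.2]
        linarith [ht'.2]
      have hden : (M * ((|s| + p) / 10)) ^ 2 ≤ (M * |s + K t + (d / t - t) ^ 2 / 4|) ^ 2 := by
        gcongr
      have hpos : 0 < (M * ((|s| + p) / 10)) ^ 2 := by positivity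
      calc _ ≤ M * ((6 / 50 * |s| + p / 2) / t) / (M * ((|s| + p) / 10)) ^ 2 := by gcongr
        _ ≤ 62 / (M * t * |s|) := by
          rw [div_le_div_iff₀ hpos (by positivity)]
          have e : M * ((6 / 50 * |s| + p / 2) / t) * (M * t * |s|)
            = M ^ 2 * ((6 / 50 * |s| + p / 2) * |s|) := by field_simp
          rw [e]
          have : (6 / 50 * |s| + p / 2) * |s| ≤ 62 / 100 * (|s| + p) ^ 2 := by nlinarith
          nlinarith [sq_nonneg M]
        _ ≤ _ := by have := ht'.1; gcongr
    have hh := intervalIntegral.norm_integral_le_of_norm_le_const hb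
    refine (le_abs_self _).trans (hh.trans ?_)
    rw [abs_of_nonneg (sub_nonneg.2 huv)]
    have : v - u ≤ u := by linarith
    calc 62 / (M * u * |s|) * (v - u) ≤ 62 / (M * u * |s|) * u := by gcongr
      _ = _ := by field_simp
  have e1 : (2 * (1 / √u) + 1 / (u * √u) * (v - u)) / (M * |s| / 10) ≤ 30 * (1 / √u) / (M * |s|) := by
    have : 1 / (u * √u) * (v - u) ≤ 1 / (u * √u) * u := by gcongr; linarith
    have e : 1 / (u * √u) * u = 1 / √u := by field_simp
    rw [div_le_div_iff₀ hρ (by positivity)]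
    have : 0 < M * |s| := by positivity
    nlinarith
  have e2 := mul_le_mul_of_nonneg_left hI (by positivity : 0 ≤ 1 / √u)
  have e3 : 1 / √u * (62 / (M * |s|)) = 62 * (1 / √u) / (M * |s|) := by ring
  have e4 : 100 * (1 / √u) / (M * |s|) = 30 * (1 / √u) / (M * |s|) + 62 * (1 / √u) / (M * |s|)
    + 8 * (1 / √u) / (M * |s|) := by ring
  have : 0 ≤ 8 * (1 / √u) / (M * |s|) := by positivity
  linarith

/-- Sum over dyadic pieces of a nonstationary zone. -/
theorem norm_le_of_nonstationary_zone (h : TangentialPhase M s d R H K κ β) {u v : ℝ} (hu : 0 < u)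
    (huv : u ≤ v) (hv : v ≤ R) (hMs : 1 ≤ M * |s| * u) (hs0 : 0 < |s|)
    (hvs : v ≤ |s| / 50)
    (hlow : ∀ t ∈ Set.Icc u v, (|s| + d ^ 2 / t ^ 2) / 10 ≤ |s + K t + (d / t - t) ^ 2 / 4|) :
    ‖∫ t in u..v, Complex.exp (I * ((M * H t : ℝ) : ℂ)) * β t‖ ≤ 1000 * (1 / √(M * |s|)) := by
  have hM := h.M_pos
  have hMu : 1 / 2 ≤ M * u := by
    have := h.hs
    have : M * |s| * u ≤ M * 1 * u := by gcongr
    linarith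
  have key := norm_integral_le_of_dyadic (f := fun t => Complex.exp (I * ((M * H t : ℝ) : ℂ)) * β t)
    (w := fun u => 100 * (1 / √u) / (M * |s|)) (q := 9 / 10) (by norm_num) (by norm_num) ?_
    hu huv (h.integrable_sub hu.le huv hv) ?_
  · refine key.trans ?_
    have h1 : 0 < √(M * |s|) := Real.sqrt_pos.2 (by positivity)
    have h2 : M * |s| = √(M * |s|) * √(M * |s|) := (Real.mul_self_sqrt (by positivity)).symm
    have h3 : 1 / √u ≤ √(M * |s|) := by
      have := Real.sqrt_le_sqrt hMs
      rw [Real.sqrt_one, Real.sqrt_mul (by positivity)] at this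
      rw [div_le_iff₀ (Real.sqrt_pos.2 hu)]
      exact this
    have h4 : 100 * (1 / √u) / (M * |s|) / (1 - 9 / 10) = 1000 * (1 / √u) / (M * |s|) := by ring
    simp only [h4]
    calc 1000 * (1 / √u) / (M * |s|) ≤ 1000 * √(M * |s|) / (M * |s|) := by gcongr
      _ = 1000 * √(M * |s|) / (√(M * |s|) * √(M * |s|)) := by rw [← h2]
      _ = _ := by field_simp
  · intro x hx
    have h1 : √(2 * x) = √2 * √x := Real.sqrt_mul (by norm_num) x
    have h2 : 0 < √x := Real.sqrt_pos.2 hx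
    have h3 : 10 / 9 ≤ √2 := Real.le_sqrt_of_sq_le (by norm_num)
    simp only [h1]
    have : 1 / (√2 * √x) ≤ 9 / 10 * (1 / √x) := by
      rw [div_le_iff₀ (by positivity)]
      have : 9 / 10 * (1 / √x) * (√2 * √x) = 9 / 10 * √2 := by field_simp
      rw [this]; linarith
    calc 100 * (1 / (√2 * √x)) / (M * |s|) ≤ 100 * (9 / 10 * (1 / √x)) / (M * |s|) := by gcongr
      _ = _ := by ring
  · intro x y hx hxy hy2 hy
    refine h.norm_le_of_nonstationary (hu.trans_le hx) hxy (hy.trans hv) hy2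
      (hMu.trans (by gcongr)) hs0 (hy.trans hvs) fun t ht => hlow t ⟨hx.trans ht.1, ht.2.trans hy⟩

set_option maxHeartbeats 800000 in
theorem norm_low_le (h : TangentialPhase M s d R H K κ β) {v : ℝ} (hv0 : 0 < v) (hv : v ≤ R)
    (hs0 : 0 < |s|) (hvs : v ≤ |s| / 50) :
    ‖∫ t in (0:ℝ)..v, Complex.exp (I * ((M * H t : ℝ) : ℂ)) * β t‖ ≤ 2500 * (1 / √(M * |s|)) := by
  have hM := h.M_pos
  have hMs : 0 < M * |s| := by positivity
  have hq : 0 < 1 / √(M * |s|) := by have := Real.sqrt_pos.2 hMs; positivity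
  set u₀ := 1 / (M * |s|) with hu₀
  have hu₀p : 0 < u₀ := by positivity
  have hsq : √u₀ = 1 / √(M * |s|) := by rw [hu₀, Real.sqrt_div' _ hMs.le, Real.sqrt_one]
  by_cases hvu : v ≤ u₀
  · refine (h.norm_le_sqrt hv0 hv).trans ?_
    have := Real.sqrt_le_sqrt hvu
    rw [hsq] at this
    linarith
  push Not at hvu
  have I0 : ‖∫ t in (0:ℝ)..u₀, Complex.exp (I * ((M * H t : ℝ) : ℂ)) * β t‖ ≤ 2 * (1 / √(M * |s|)) := by
    rw [← hsq]; exact h.norm_le_sqrt hu₀p (hvu.le.trans hv)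
  have hMu0 : M * |s| * u₀ = 1 := by rw [hu₀]; field_simp
  have hone : ∀ t, u₀ ≤ t → 1 ≤ M * |s| * t := fun t ht => by
    rw [← hMu0]; gcongr
  have hKs : ∀ t ∈ Set.Icc u₀ v, |K t| ≤ |s| / 10 := fun t ht =>
    (h.hKb t ⟨hu₀p.trans_le ht.1, ht.2.trans hv⟩).trans (by linarith [ht.2])
  have hs1 := h.hs
  have hadd : ∀ {x y : ℝ}, 0 ≤ x → x ≤ y → y ≤ v →
      (∫ t in (0:ℝ)..y, Complex.exp (I * ((M * H t : ℝ) : ℂ)) * β t) =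
      (∫ t in (0:ℝ)..x, Complex.exp (I * ((M * H t : ℝ) : ℂ)) * β t) +
      ∫ t in x..y, Complex.exp (I * ((M * H t : ℝ) : ℂ)) * β t := fun hx hxy hy =>
    (intervalIntegral.integral_add_adjacent_intervals
      (h.integrable_sub le_rfl hx (hxy.trans (hy.trans hv)))
      (h.integrable_sub hx hxy (hy.trans hv))).symm
  rcases lt_or_ge 0 s with hsp | hsn
  · have hz := h.norm_le_of_nonstationary_zone hu₀p hvu.le hv hMu0.ge hs0 hvs (fun t ht => by
      have h1 := abs_le.1 (hKs t ht)
      have ht0 : 0 < t := hu₀p.trans_le ht.1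
      have hts : t ≤ |s| / 50 := ht.2.trans hvs
      rw [abs_of_pos hsp] at h1 hts ⊢
      refine le_trans ?_ (le_abs_self _)
      set e := d / t with he
      rw [← div_pow, ← he]
      rw [abs_of_pos hsp] at hs1
      nlinarith [sq_nonneg (3 * e - 5 * t), sq_nonneg (e - 2 * t)])
    rw [hadd hu₀p.le hvu.le le_rfl]
    refine (norm_add_le _ _).trans ?_
    linarith
  have hsn' : s < 0 := lt_of_le_of_ne hsn fun h0 => by rw [h0, abs_zero] at hs0; exact lt_irrefl _ hs0
  set r := √|s| with hr
  have hrp : 0 < r := Real.sqrt_pos.2 hs0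
  have hr2 : r ^ 2 = |s| := Real.sq_sqrt hs0.le
  have hr1 : r ≤ 1 := Real.sqrt_le_one.2 hs1
  have hsr : s = -r ^ 2 := by rw [hr2, abs_of_neg hsn']; ring
  set t₁ := max u₀ (min (|d| / (4 * r)) v) with ht₁
  set t₂ := max t₁ (min (|d| / r) v) with ht₂
  have a1 : u₀ ≤ t₁ := le_max_left _ _
  have a2 : t₁ ≤ t₂ := le_max_left _ _
  have a1v : t₁ ≤ v := max_le hvu.le (min_le_right _ _)
  have a2v : t₂ ≤ v := max_le a1v (min_le_right _ _)
  have hnear : t₁ = u₀ ∨ t₁ ≤ |d| / (4 * r) := by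
    rcases le_total (min (|d| / (4 * r)) v) u₀ with h' | h'
    · left; exact max_eq_left h'
    · right; rw [ht₁, max_eq_right h']; exact min_le_left _ _
  have hmidl : |d| / (4 * r) ≤ t₁ ∨ t₁ = v := by
    rcases le_total (|d| / (4 * r)) v with h' | h'
    · left; rw [ht₁, min_eq_left h']; exact le_max_right _ _
    · right; rw [ht₁, min_eq_right h']; exact max_eq_right hvu.le
  have hmidr : t₂ = t₁ ∨ t₂ ≤ |d| / r := by
    rcases le_total (min (|d| / r) v) t₁ with h' | h'
    · left; exact max_eq_left h'
    · right; rw [ht₂, max_eq_right h']; exact min_le_left _ _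
  have hfar : |d| / r ≤ t₂ ∨ t₂ = v := by
    rcases le_total (|d| / r) v with h' | h'
    · left; rw [ht₂, min_eq_left h']; exact le_max_right _ _
    · right; rw [ht₂, min_eq_right h']; exact max_eq_right a1v
  have Bnear : ‖∫ t in u₀..t₁, Complex.exp (I * ((M * H t : ℝ) : ℂ)) * β t‖ ≤
      1000 * (1 / √(M * |s|)) := by
    rcases hnear with h' | h'
    · rw [h']; simpa using hq.le
    refine h.norm_le_of_nonstationary_zone hu₀p a1 (a1v.trans hv) hMu0.ge hs0 (a1v.trans hvs)
      fun t ht => ?_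
    refine le_abs_of_near hr1 hrp.le hr2 hsr (hu₀p.trans_le ht.1) (ht.2.trans (a1v.trans hvs))
      (hKs t ⟨ht.1, ht.2.trans a1v⟩) ?_
    rw [le_div_iff₀ (hu₀p.trans_le ht.1)]
    have := ht.2.trans h'
    rw [le_div_iff₀ (by positivity)] at this
    linarith
  have Bfar : ‖∫ t in t₂..v, Complex.exp (I * ((M * H t : ℝ) : ℂ)) * β t‖ ≤
      1000 * (1 / √(M * |s|)) := by
    rcases hfar with h' | h'
    swap
    · rw [h']; simpa using hq.le
    refine h.norm_le_of_nonstationary_zone (hu₀p.trans_le (a1.trans a2)) a2v hv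
      (hone _ (a1.trans a2)) hs0 hvs fun t ht => ?_
    have ht0 : 0 < t := hu₀p.trans_le ((a1.trans a2).trans ht.1)
    refine le_abs_of_far hr1 hrp.le hr2 hsr ht0 (ht.2.trans hvs)
      (hKs t ⟨(a1.trans a2).trans ht.1, ht.2⟩) ?_
    rw [div_le_iff₀ ht0]
    have := h'.trans ht.1
    rw [div_le_iff₀ hrp] at this
    linarith
  have Bmid : ‖∫ t in t₁..t₂, Complex.exp (I * ((M * H t : ℝ) : ℂ)) * β t‖ ≤
      160 * (1 / √(M * |s|)) := by
    rcases hmidr with h' | h'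
    · rw [h']; simpa using hq.le
    rcases hmidl with h'' | h''
    swap
    · have : t₂ = t₁ := le_antisymm (h''.symm ▸ a2v) a2
      rw [this]; simpa using hq.le
    have ht10 : 0 < t₁ := hu₀p.trans_le a1
    have h4 : t₂ ≤ 4 * t₁ := by
      refine h'.trans ?_
      have : |d| / r = 4 * (|d| / (4 * r)) := by field_simp
      linarith
    refine (h.norm_le_of_two (ρ := M * (|s| / (16 * t₁))) (ε := -1) ht10 a2 (a2v.trans hv) ?_
      (by positivity) (Or.inr rfl) h4 fun t ht => ?_).trans ?_
    · have h1 := hone t₁ a1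
      have : M * |s| * t₁ ≤ M * 1 * t₁ := by gcongr
      linarith
    · have ht0 : 0 < t := ht10.trans_le ht.1
      have hts : t ≤ |s| / 50 := ht.2.trans (a2v.trans hvs)
      have hκ := (abs_le.1 (h.hκb t ⟨ht0, ht.2.trans (a2v.trans hv)⟩)).2
      have hde : r ≤ |d| / t := by
        rw [le_div_iff₀ ht0]
        have := ht.2.trans h'
        rw [le_div_iff₀ hrp] at this
        linarith
      have hd2 : d ^ 2 / (2 * t ^ 3) = (|d| / t) ^ 2 / (2 * t) := by
        rw [div_pow, sq_abs]; field_simp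
      have e1 : |s| / (2 * t) ≤ d ^ 2 / (2 * t ^ 3) := by
        rw [hd2, ← hr2]; gcongr
      have e2 : 25 ≤ |s| / (2 * t) := by rw [le_div_iff₀ (by positivity)]; linarith
      have e3 : |s| / (16 * t₁) ≤ |s| / (4 * t) :=
        div_le_div_of_nonneg_left hs0.le (by positivity) (by linarith [ht.2])
      have e4 : |s| / (2 * t) = 2 * (|s| / (4 * t)) := by field_simp; norm_num
      gcongr
      linarith
    · have hst : 0 < √t₁ := Real.sqrt_pos.2 ht10
      have e : √(M * (|s| / (16 * t₁))) = √(M * |s|) / (4 * √t₁) := by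
        have e' : M * (|s| / (16 * t₁)) = (√(M * |s|) / (4 * √t₁)) ^ 2 := by
          rw [div_pow, mul_pow, Real.sq_sqrt hMs.le, Real.sq_sqrt ht10.le]
          ring
        rw [e', Real.sqrt_sq (by positivity)]
      rw [e]
      have : 0 < √(M * |s|) := Real.sqrt_pos.2 hMs
      apply le_of_eq
      field_simp
      norm_num
  rw [hadd (hu₀p.le.trans (a1.trans a2)) a2v le_rfl, hadd (hu₀p.le.trans a1) a2 a2v,
    hadd hu₀p.le a1 a1v]
  refine (norm_add_le _ _).trans ?_
  refine (add_le_add ((norm_add_le _ _).trans (add_le_add (norm_add_le _ _) le_rfl)) le_rfl).trans ?_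
  linarith

end TangentialPhase

namespace TangentialPhase

variable {M s d R : ℝ} {H K κ : ℝ → ℝ} {β : ℝ → ℂ}

theorem half_le_mul {M u : ℝ} (hM : 1 / 2 ≤ M) (hu : 0 < u) (h : 1 ≤ M * u ^ 2) :
    1 / 2 ≤ M * u := by
  have h1 : 0 < M * u := by positivity
  have : 1 / 2 ≤ (M * u) ^ 2 := by nlinarith
  nlinarith

theorem cbrt_cube {x : ℝ} (hx : 0 ≤ x) : (x ^ ((1:ℝ)/3)) ^ 3 = x := by
  rw [← Real.rpow_natCast, ← Real.rpow_mul hx]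
  norm_num

theorem mul_sub_le_of_hasDerivAt {u v m : ℝ} {F F₁ : ℝ → ℝ}
    (hF : ∀ t ∈ Set.Icc u v, HasDerivAt F (F₁ t) t) (hm : ∀ t ∈ Set.Icc u v, m ≤ F₁ t) :
    ∀ x ∈ Set.Icc u v, ∀ y ∈ Set.Icc u v, x ≤ y → m * (y - x) ≤ F y - F x := by
  intro x hx y hy hxy
  refine (convex_Icc u v).mul_sub_le_image_sub_of_le_deriv
    (fun t ht => (hF t ht).continuousAt.continuousWithinAt) ?_ ?_ x hx y hy hxy
  · intro z hz
    exact (hF z (interior_subset hz)).differentiableAt.differentiableWithinAt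
  · intro z hz
    rw [(hF z (interior_subset hz)).deriv]
    exact hm z (interior_subset hz)

/-- Dyadic piece on the side where `κ > 0`. -/
theorem piece_of_pos (h : TangentialPhase M s d R H K κ β) {κ₁ : ℝ → ℝ}
    (hκl : ∀ t ∈ Set.Ioc 0 R, 3 / 10 ≤ κ t)
    (hκ₁ : ∀ t ∈ Set.Ioc 0 R, HasDerivAt κ (κ₁ t) t)
    (hκ₁l : ∀ t ∈ Set.Ioc 0 R, -1 ≤ κ₁ t) {u v : ℝ} (hu : 0 < u) (huv : u ≤ v) (h2 : v ≤ 2 * u)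
    (hv : v ≤ R) (hMu : 1 ≤ M * u ^ 2) :
    ‖∫ t in u..v, Complex.exp (I * ((M * H t : ℝ) : ℂ)) * β t‖ ≤
      600 * ((u / M) ^ ((1:ℝ)/3) * (1 / √u)) := by
  have hM := h.M_pos
  have hsub := Icc_subset hu hv
  have hx : 0 < u / M := by positivity
  set z := (u / M) ^ ((1:ℝ)/3) with hz
  have hz0 : 0 < z := Real.rpow_pos_of_pos hx _
  have hz3 : z ^ 3 = u / M := cbrt_cube hx.le
  have hsu : 0 < √u := Real.sqrt_pos.2 hu
  have hF : ∀ t ∈ Set.Icc u v, HasDerivAt (fun t => t ^ 4 / 2 + κ t * t ^ 3 - d ^ 2 / 2)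
      (2 * t ^ 3 + (κ₁ t * t ^ 3 + κ t * (3 * t ^ 2))) t := by
    intro t ht
    refine ((((hasDerivAt_pow 4 t).div_const 2).add ((hκ₁ t (hsub ht)).mul
      (hasDerivAt_pow 3 t))).sub_const (d ^ 2 / 2)).congr_deriv ?_
    norm_num
    ring
  have key := h.norm_le_of_split (F := fun t => t ^ 4 / 2 + κ t * t ^ 3 - d ^ 2 / 2)
    (m := 9 / 10 * u ^ 2) (τ := u ^ 2 * z) hu huv hv h2 (half_le_mul h.hM hu hMu) hz0 (by positivity)
    (by positivity) (by nlinarith [mul_pos (pow_pos hu 2) hz0])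
    (fun t ht => (hF t ht).continuousAt.continuousWithinAt)
    (mul_sub_le_of_hasDerivAt hF fun t ht => ?_) ?_
  · refine key.trans ?_
    have : 0 < z * (1 / √u) := by positivity
    linarith
  · have h1 := hκl t (hsub ht)
    have h2 := hκ₁l t (hsub ht)
    have ht0 : 0 < t := hu.trans_le ht.1
    have h3 : u ^ 2 ≤ t ^ 2 := pow_le_pow_left₀ hu.le ht.1 2
    have h4 : 0 < t ^ 3 := by positivity
    nlinarith
  · intro ε _ t ht hle
    have ht0 : 0 < t := hu.trans_le ht.1
    have e : M * (ε * (κ t + t / 2 - d ^ 2 / (2 * t ^ 3))) =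
        M * (ε * (t ^ 4 / 2 + κ t * t ^ 3 - d ^ 2 / 2)) / t ^ 3 := by
      field_simp
      ring
    have e2 : 1 / (8 * z ^ 2) = M * (u ^ 2 * z) / (2 * u) ^ 3 := by
      have : u = M * z ^ 3 := by rw [hz3]; field_simp
      rw [div_eq_div_iff (by positivity) (by positivity), this]
      ring
    rw [e, e2]
    have ht2 : t ≤ 2 * u := ht.2.trans h2
    have hnn : 0 ≤ M * (u ^ 2 * z) := by positivity
    have hle' : M * (u ^ 2 * z) ≤ M * (ε * (t ^ 4 / 2 + κ t * t ^ 3 - d ^ 2 / 2)) := by gcongr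
    exact div_le_div₀ (hnn.trans hle') hle' (by positivity) (by gcongr)

theorem norm_le_of_concave (h : TangentialPhase M s d R H K κ β) {u v : ℝ} (hu : 0 < u)
    (huv : u ≤ v) (h2 : v ≤ 2 * u) (hv : v ≤ R) (hMu : 1 ≤ M * u ^ 2)
    (hc : ∀ t ∈ Set.Icc u v, κ t + t / 2 ≤ -(1 / 10)) :
    ‖∫ t in u..v, Complex.exp (I * ((M * H t : ℝ) : ℂ)) * β t‖ ≤
      600 * ((u / M) ^ ((1:ℝ)/3) * (1 / √u)) := by
  have hM := h.M_pos
  have hx : 0 < u / M := by positivity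
  set z := (u / M) ^ ((1:ℝ)/3) with hz
  have hz0 : 0 < z := Real.rpow_pos_of_pos hx _
  have hz3 : z ^ 3 = u / M := cbrt_cube hx.le
  have hsu : 0 < √u := Real.sqrt_pos.2 hu
  refine (h.norm_le_of_two (ρ := M / 10) (ε := -1) hu huv hv (half_le_mul h.hM hu hMu) (by positivity)
    (Or.inr rfl) (by linarith) fun t ht => ?_).trans ?_
  · have ht0 : 0 < t := hu.trans_le ht.1
    have h1 := hc t ht
    have : 0 ≤ d ^ 2 / (2 * t ^ 3) := by positivity
    rw [div_eq_mul_one_div]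
    gcongr
    linarith
  · have hzM : 1 ≤ z ^ 2 * M := by
      by_contra hcon
      push Not at hcon
      have h3 : (z ^ 2 * M) ^ 3 < 1 := pow_lt_one₀ (by positivity) hcon (by norm_num)
      have h4 : (z ^ 2 * M) ^ 3 = M * u ^ 2 := by
        have : (z ^ 2 * M) ^ 3 = (z ^ 3) ^ 2 * M ^ 3 := by ring
        rw [this, hz3]; field_simp
      linarith
    have : 1 / (4 * z) ≤ √(M / 10) := by
      apply Real.le_sqrt_of_sq_le
      rw [div_pow, div_le_div_iff₀ (by positivity) (by norm_num)]
      nlinarith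
    rw [div_le_iff₀ (Real.sqrt_pos.2 (by positivity))]
    calc 40 * (1 / √u) ≤ 600 * (z * (1 / √u)) * (1 / (4 * z)) := by
          have : 600 * (z * (1 / √u)) * (1 / (4 * z)) = 150 * (1 / √u) := by field_simp; norm_num
          rw [this]; gcongr; norm_num
      _ ≤ _ := by gcongr

/-- Dyadic piece on the side where `κ < 0`. -/
theorem piece_of_neg (h : TangentialPhase M s d R H K κ β) {κ₁ : ℝ → ℝ}
    (hκl : ∀ t ∈ Set.Ioc 0 R, κ t ≤ -(7 / 10))
    (hκ₁ : ∀ t ∈ Set.Ioc 0 R, HasDerivAt κ (κ₁ t) t)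
    (hκ₁l : ∀ t ∈ Set.Ioc 0 R, -(1 / 4) ≤ κ₁ t) {u v : ℝ} (hu : 0 < u) (huv : u ≤ v)
    (h2 : v ≤ 2 * u) (hv : v ≤ R) (hMu : 1 ≤ M * u ^ 2) :
    ‖∫ t in u..v, Complex.exp (I * ((M * H t : ℝ) : ℂ)) * β t‖ ≤
      600 * ((u / M) ^ ((1:ℝ)/3) * (1 / √u)) := by
  have hM := h.M_pos
  have hsub := Icc_subset hu hv
  rcases le_total u (1 / 2) with hu1 | hu1
  · exact h.norm_le_of_concave hu huv h2 hv hMu fun t ht => by linarith [hκl t (hsub ht), ht.2]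
  have hx : 0 < u / M := by positivity
  set z := (u / M) ^ ((1:ℝ)/3) with hz
  have hz0 : 0 < z := Real.rpow_pos_of_pos hx _
  have hz3 : z ^ 3 = u / M := cbrt_cube hx.le
  have hsu : 0 < √u := Real.sqrt_pos.2 hu
  have hy : 0 < 1 / M := by positivity
  set y := (1 / M) ^ ((1:ℝ)/3) with hy'
  have hy0 : 0 < y := Real.rpow_pos_of_pos hy _
  have hy3 : y ^ 3 = 1 / M := cbrt_cube hy.le
  have hyz : y ≤ 2 * z := by
    refine le_of_pow_le_pow_left₀ (n := 3) (by norm_num) (by positivity) ?_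
    rw [mul_pow, hz3, hy3, ← mul_div_assoc]
    gcongr
    linarith
  have hF : ∀ t ∈ Set.Icc u v, HasDerivAt (fun t => κ t + t / 2 - d ^ 2 / (2 * t ^ 3))
      (κ₁ t + 1 / 2 + 3 * d ^ 2 / (2 * t ^ 4)) t := by
    intro t ht
    have ht0 : 0 < t := hu.trans_le ht.1
    refine (((hκ₁ t (hsub ht)).add ((hasDerivAt_id t).div_const 2)).sub
      ((hasDerivAt_const t (d ^ 2)).div ((hasDerivAt_pow 3 t).const_mul 2)
        (by positivity))).congr_deriv ?_
    field_simp
    norm_num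
    ring
  have key := h.norm_le_of_split (F := fun t => κ t + t / 2 - d ^ 2 / (2 * t ^ 3))
    (m := 1 / 4) (τ := y / 2) hu huv hv h2 (half_le_mul h.hM hu hMu) hy0 (by positivity)
    (by positivity) (by linarith)
    (fun t ht => (hF t ht).continuousAt.continuousWithinAt)
    (mul_sub_le_of_hasDerivAt hF fun t ht => ?_) ?_
  · refine key.trans ?_
    have : y * (1 / √u) ≤ 2 * z * (1 / √u) := by gcongr
    linarith
  · have ht0 : 0 < t := hu.trans_le ht.1
    have h2 := hκ₁l t (hsub ht)
    have : 0 ≤ 3 * d ^ 2 / (2 * t ^ 4) := by positivity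
    linarith
  · intro ε _ t ht hle
    have e2 : 1 / (8 * y ^ 2) = M * (y / 8) := by
      rw [div_eq_iff (by positivity)]
      have : M * (y / 8) * (8 * y ^ 2) = M * y ^ 3 := by ring
      rw [this, hy3]; field_simp
    rw [e2]
    gcongr
    linarith

theorem norm_tail_le (h : TangentialPhase M s d R H K κ β)
    (hp : ∀ u v : ℝ, 0 < u → u ≤ v → v ≤ 2 * u → v ≤ R → 1 ≤ M * u ^ 2 →
      ‖∫ t in u..v, Complex.exp (I * ((M * H t : ℝ) : ℂ)) * β t‖ ≤
        600 * ((u / M) ^ ((1:ℝ)/3) * (1 / √u))) {u : ℝ} (hu : 0 < u) (huR : u ≤ R)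
    (hMu : 1 ≤ M * u ^ 2) :
    ‖∫ t in u..R, Complex.exp (I * ((M * H t : ℝ) : ℂ)) * β t‖ ≤
      6000 * (M ^ (-(1:ℝ)/3) * u ^ (-(1:ℝ)/6)) := by
  have hM := h.M_pos
  have hw : ∀ u : ℝ, 0 < u → (u / M) ^ ((1:ℝ)/3) * (1 / √u) = M ^ (-(1:ℝ)/3) * u ^ (-(1:ℝ)/6) := by
    intro u hu
    rw [Real.div_rpow hu.le hM.le, Real.sqrt_eq_rpow, one_div (u ^ _), ← Real.rpow_neg hu.le,
      div_eq_mul_inv, ← Real.rpow_neg hM.le]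
    rw [mul_comm (u ^ _), mul_assoc, ← Real.rpow_add hu]
    norm_num
  have := norm_integral_le_of_dyadic (f := fun t => Complex.exp (I * ((M * H t : ℝ) : ℂ)) * β t)
    (w := fun u => 600 * (M ^ (-(1:ℝ)/3) * u ^ (-(1:ℝ)/6))) (q := 9 / 10) (by norm_num) (by norm_num)
    ?_ hu huR (h.integrable_sub hu.le huR le_rfl) ?_
  · refine this.trans (le_of_eq ?_)
    ring
  · intro x hx
    have h1 : (2:ℝ) ^ (-(1:ℝ)/6) ≤ 9 / 10 := by
      have h0 : (0:ℝ) ≤ 2 ^ (-(1:ℝ)/6) := by positivity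
      refine le_of_pow_le_pow_left₀ (n := 6) (by norm_num) (by norm_num) ?_
      rw [← Real.rpow_natCast, ← Real.rpow_mul (by norm_num)]
      norm_num
    rw [Real.mul_rpow (by norm_num) hx.le]
    have : 0 ≤ M ^ (-(1:ℝ)/3) * x ^ (-(1:ℝ)/6) := by positivity
    nlinarith
  · intro x y hx hxy hy2 hy
    have hx0 := hu.trans_le hx
    refine (hp x y hx0 hxy hy2 hy (hMu.trans ?_)).trans (le_of_eq ?_)
    · gcongr
    · rw [hw x hx0]

/-- Bound for the oscillatory integral on a half-line, degenerate case. -/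
theorem norm_le_degenerate (h : TangentialPhase M s d R H K κ β) (hR : 0 < R)
    (hp : ∀ u v : ℝ, 0 < u → u ≤ v → v ≤ 2 * u → v ≤ R → 1 ≤ M * u ^ 2 →
      ‖∫ t in u..v, Complex.exp (I * ((M * H t : ℝ) : ℂ)) * β t‖ ≤
        600 * ((u / M) ^ ((1:ℝ)/3) * (1 / √u))) :
    ‖∫ t in (0:ℝ)..R, Complex.exp (I * ((M * H t : ℝ) : ℂ)) * β t‖ ≤ 10000 * M ^ (-(1:ℝ)/4) := by
  have hM := h.M_pos
  set u := M ^ (-(1:ℝ)/2) with hu'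
  have hu : 0 < u := by positivity
  have hsq : √u = M ^ (-(1:ℝ)/4) := by
    rw [hu', Real.sqrt_eq_rpow, ← Real.rpow_mul hM.le]; norm_num
  have hq : 0 < M ^ (-(1:ℝ)/4) := by positivity
  rcases le_total R u with hRu | hRu
  · refine (h.norm_le_sqrt hR le_rfl).trans ?_
    have := Real.sqrt_le_sqrt hRu
    rw [hsq] at this
    linarith
  have hMu : 1 ≤ M * u ^ 2 := by
    rw [hu', ← Real.rpow_natCast, ← Real.rpow_mul hM.le]
    norm_num
    rw [Real.rpow_neg_one, mul_inv_cancel₀ hM.ne']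
  have h1 := h.norm_le_sqrt hu hRu
  have h2 := h.norm_tail_le hp hu hRu hMu
  have e : M ^ (-(1:ℝ)/3) * u ^ (-(1:ℝ)/6) = M ^ (-(1:ℝ)/4) := by
    rw [hu', ← Real.rpow_mul hM.le, ← Real.rpow_add hM]
    norm_num
  rw [e] at h2
  rw [hsq] at h1
  rw [← intervalIntegral.integral_add_adjacent_intervals (h.integrable_sub le_rfl hu.le hRu)
    (h.integrable_sub hu.le hRu le_rfl)]
  refine (norm_add_le _ _).trans ?_
  linarith

/-- Bound for the oscillatory integral on a half-line, away from the degenerate case. -/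
theorem norm_le_nondegenerate (h : TangentialPhase M s d R H K κ β) (hR : 0 < R)
    (hp : ∀ u v : ℝ, 0 < u → u ≤ v → v ≤ 2 * u → v ≤ R → 1 ≤ M * u ^ 2 →
      ‖∫ t in u..v, Complex.exp (I * ((M * H t : ℝ) : ℂ)) * β t‖ ≤
        600 * ((u / M) ^ ((1:ℝ)/3) * (1 / √u)))
    (hs0 : 0 < |s|) (hMs : 1 ≤ M * (|s| / 50) ^ 2) :
    ‖∫ t in (0:ℝ)..R, Complex.exp (I * ((M * H t : ℝ) : ℂ)) * β t‖ ≤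
      20000 * (M ^ (-(1:ℝ)/3) * |s| ^ (-(1:ℝ)/6)) := by
  have hM := h.M_pos
  set q := M ^ (-(1:ℝ)/3) * |s| ^ (-(1:ℝ)/6) with hq'
  have hq : 0 < q := by positivity
  have hlow : 1 / √(M * |s|) ≤ q := by
    have h1 : 1 ≤ M * |s| ^ 2 := by nlinarith [sq_nonneg |s|]
    have h2 : 1 ≤ (M * |s| ^ 2) ^ ((1:ℝ)/6) := Real.one_le_rpow h1 (by norm_num)
    have h3 : 1 / √(M * |s|) * (M * |s| ^ 2) ^ ((1:ℝ)/6) = q := by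
      rw [hq', Real.sqrt_eq_rpow, Real.mul_rpow hM.le hs0.le, Real.mul_rpow hM.le (by positivity),
        ← Real.rpow_natCast, ← Real.rpow_mul hs0.le, one_div, mul_inv, ← Real.rpow_neg hM.le,
        ← Real.rpow_neg hs0.le, mul_mul_mul_comm, ← Real.rpow_add hM, ← Real.rpow_add hs0]
      norm_num
    rw [← h3]
    exact le_mul_of_one_le_right (by positivity) h2
  have hu : 0 < |s| / 50 := by positivity
  rcases le_total R (|s| / 50) with hRu | hRu
  · refine (h.norm_low_le hR le_rfl hs0 hRu).trans ?_
    linarith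
  have h1 := h.norm_low_le hu hRu hs0 le_rfl
  have h2 := h.norm_tail_le hp hu hRu hMs
  have e : M ^ (-(1:ℝ)/3) * (|s| / 50) ^ (-(1:ℝ)/6) ≤ 2 * q := by
    have h50 : (1 / 50 : ℝ) ^ (-(1:ℝ)/6) ≤ 2 := by
      refine le_of_pow_le_pow_left₀ (n := 6) (by norm_num) (by norm_num) ?_
      rw [← Real.rpow_natCast, ← Real.rpow_mul (by norm_num)]
      norm_num [Real.rpow_neg_one]
    rw [div_eq_mul_one_div |s|, Real.mul_rpow hs0.le (by norm_num), ← mul_assoc, mul_comm _ ((1/50:ℝ)^_)]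
    gcongr
  rw [← intervalIntegral.integral_add_adjacent_intervals (h.integrable_sub le_rfl hu.le hRu)
    (h.integrable_sub hu.le hRu le_rfl)]
  refine (norm_add_le _ _).trans ?_
  linarith

end TangentialPhase

/-- The Laplace-type integral `∫₀^∞ t^p exp(-ω t - t³/12) dt`, which represents `Ai² + Bi²`
(up to a constant) when `p = -1/2`. -/
noncomputable def airyLaplace (p ω : ℝ) : ℝ :=
  ∫ t in Set.Ioi (0:ℝ), t ^ p * rexp (-(ω * t) - t ^ 3 / 12)

theorem exp_cubic_le {ω t : ℝ} (hω : -1 ≤ ω) (ht : 0 < t) :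
    rexp (-(ω * t) - t ^ 3 / 12) ≤ rexp 2 * rexp (-(1/24) * t ^ (3:ℝ)) := by
  rw [← Real.exp_add]
  apply Real.exp_le_exp.2
  have e : t ^ (3:ℝ) = t ^ 3 := by norm_cast
  rw [e]
  nlinarith [mul_nonneg ht.le (sq_nonneg (t - 14/5)), mul_nonneg ht.le (by linarith : 0 ≤ ω + 1), sq_nonneg (t - 14/5)]

theorem integrable_airyLaplace_bound {p : ℝ} (hp : -1 < p) :
    IntegrableOn (fun t : ℝ => t ^ p * (rexp 2 * rexp (-(1/24) * t ^ (3:ℝ)))) (Set.Ioi 0) := by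
  have := (integrableOn_rpow_mul_exp_neg_mul_rpow (s := p) (p := 3) (b := 1/24) hp (by norm_num)
    (by norm_num)).const_mul (rexp 2)
  refine this.congr (ae_of_all _ fun t => ?_)
  ring

theorem aestronglyMeasurable_airyLaplace (p ω : ℝ) :
    AEStronglyMeasurable (fun t : ℝ => t ^ p * rexp (-(ω * t) - t ^ 3 / 12))
      (volume.restrict (Set.Ioi 0)) := by
  apply Measurable.aestronglyMeasurable
  fun_prop

theorem integrable_airyLaplace {p ω : ℝ} (hp : -1 < p) (hω : -1 ≤ ω) :
    IntegrableOn (fun t : ℝ => t ^ p * rexp (-(ω * t) - t ^ 3 / 12)) (Set.Ioi 0) := by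
  refine (integrable_airyLaplace_bound hp).mono' (aestronglyMeasurable_airyLaplace p ω) ?_
  refine (ae_restrict_mem measurableSet_Ioi).mono fun t (ht : 0 < t) => ?_
  rw [Real.norm_of_nonneg (by positivity)]
  gcongr
  exact exp_cubic_le hω ht

theorem hasDerivAt_airyLaplace {p ω : ℝ} (hp : -1 < p) (hω : -1 < ω) :
    HasDerivAt (airyLaplace p) (-(airyLaplace (p + 1) ω)) ω := by
  have key := hasDerivAt_integral_of_dominated_loc_of_deriv_le
    (μ := volume.restrict (Set.Ioi (0:ℝ)))
    (F := fun ω t : ℝ => t ^ p * rexp (-(ω * t) - t ^ 3 / 12))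
    (F' := fun ω t : ℝ => -(t ^ (p + 1) * rexp (-(ω * t) - t ^ 3 / 12)))
    (x₀ := ω) (s := Set.Ioi (-1))
    (bound := fun t : ℝ => t ^ (p+1) * (rexp 2 * rexp (-(1/24) * t ^ (3:ℝ))))
    (Ioi_mem_nhds hω) (Eventually.of_forall fun x => aestronglyMeasurable_airyLaplace p x)
    (integrable_airyLaplace hp hω.le) (aestronglyMeasurable_airyLaplace (p+1) ω).neg
    ?_ (integrable_airyLaplace_bound (by linarith)) ?_
  · have := key.2
    rw [integral_neg] at this
    exact this
  · refine (ae_restrict_mem measurableSet_Ioi).mono fun t (ht : 0 < t) x hx => ?_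
    rw [norm_neg, Real.norm_of_nonneg (by positivity)]
    gcongr
    exact exp_cubic_le (le_of_lt hx) ht
  · refine (ae_restrict_mem measurableSet_Ioi).mono fun t (ht : 0 < t) x hx => ?_
    have h1 : HasDerivAt (fun x : ℝ => -(x * t) - t ^ 3 / 12) (-t) x := by
      simpa using (((hasDerivAt_id x).mul_const t).neg.sub_const (t^3/12))
    have h2 := (h1.exp).const_mul (t ^ p)
    refine h2.congr_deriv ?_
    rw [Real.rpow_add_one ht.ne']
    ring

theorem airyLaplace_pos {p ω : ℝ} (hp : -1 < p) (hω : -1 ≤ ω) : 0 < airyLaplace p ω := by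
  unfold airyLaplace
  rw [setIntegral_pos_iff_support_of_nonneg_ae]
  · have : Function.support (fun t : ℝ => t ^ p * rexp (-(ω * t) - t ^ 3 / 12)) ∩ Set.Ioi 0
        = Set.Ioi 0 := by
      ext t
      simp only [Set.mem_inter_iff, Function.mem_support, Set.mem_Ioi, and_iff_right_iff_imp]
      intro ht
      positivity
    rw [this]
    simp
  · refine (ae_restrict_mem measurableSet_Ioi).mono fun t (ht : 0 < t) => ?_
    simp only [Pi.zero_apply]
    positivity
  · exact integrable_airyLaplace hp hω

/-- Recurrence in `p`, from integration by parts. -/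
theorem airyLaplace_recurrence {p ω : ℝ} (hp : -1 < p) (hω : -1 ≤ ω) :
    (p + 1) * airyLaplace p ω = ω * airyLaplace (p + 1) ω + airyLaplace (p + 3) ω / 4 := by
  have hI0 := integrable_airyLaplace hp hω
  have hI1 := integrable_airyLaplace (p := p + 1) (by linarith) hω
  have hI3 := integrable_airyLaplace (p := p + 3) (by linarith) hω
  have key := integral_Ioi_of_hasDerivAt_of_tendsto (a := 0) (m := 0)
    (f := fun t : ℝ => t ^ (p + 1) * rexp (-(ω * t) - t ^ 3 / 12))
    (f' := fun t : ℝ => (p + 1) * (t ^ p * rexp (-(ω * t) - t ^ 3 / 12))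
      - ω * (t ^ (p + 1) * rexp (-(ω * t) - t ^ 3 / 12))
      - (t ^ (p + 3) * rexp (-(ω * t) - t ^ 3 / 12)) / 4) ?_ ?_ ?_ ?_
  · simp only [zero_pow, ne_eq, OfNat.ofNat_ne_zero, not_false_eq_true] at key
    rw [Real.zero_rpow (by linarith : p + 1 ≠ 0)] at key
    have s1 := integral_sub ((hI0.const_mul (p + 1)).sub (hI1.const_mul ω)) (hI3.div_const 4)
    have s2 := integral_sub (hI0.const_mul (p + 1)) (hI1.const_mul ω)
    simp only [Pi.sub_apply] at s1
    rw [s1, s2, integral_const_mul, integral_const_mul, integral_div] at key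
    unfold airyLaplace
    linarith
  · have h1 : ContinuousAt (fun t : ℝ => t ^ (p + 1)) 0 :=
      Real.continuousAt_rpow_const _ _ (Or.inr (by linarith))
    exact (h1.mul (by fun_prop)).continuousWithinAt
  · intro t (ht : 0 < t)
    have h1 : HasDerivAt (fun t : ℝ => t ^ (p + 1)) ((p + 1) * t ^ p) t := by
      have := Real.hasDerivAt_rpow_const (x := t) (p := p + 1) (Or.inl ht.ne')
      simpa using this
    have h2 : HasDerivAt (fun t : ℝ => -(ω * t) - t ^ 3 / 12) (-ω - t ^ 2 / 4) t := by
      have := (((hasDerivAt_id t).const_mul ω).neg.sub ((hasDerivAt_pow 3 t).div_const 12))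
      refine this.congr_deriv ?_
      simp
      ring
    refine (h1.mul h2.exp).congr_deriv ?_
    have e1 : t ^ (p + 3) = t ^ (p + 1) * t ^ 2 := by
      rw [← Real.rpow_natCast t 2, ← Real.rpow_add ht]; congr 1; push_cast; ring
    rw [e1]
    ring
  · exact ((hI0.const_mul _).sub (hI1.const_mul _)).sub (hI3.div_const _)
  · have hb : Tendsto (fun t : ℝ => rexp 2 * (t ^ (p + 1) * rexp (-(1/24) * t ^ (3:ℝ)))) atTop
        (nhds 0) := by
      have h0 := tendsto_rpow_mul_exp_neg_mul_atTop_nhds_zero ((p + 1) / 3) (1/24) (by norm_num)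
      have h1 := h0.comp (tendsto_rpow_atTop (y := 3) (by norm_num))
      have h2 := h1.const_mul (rexp 2)
      rw [mul_zero] at h2
      refine h2.congr' ?_
      filter_upwards [eventually_gt_atTop 0] with t ht
      simp only [Function.comp]
      rw [← Real.rpow_mul ht.le]
      congr 3
      ring
    refine squeeze_zero' ?_ ?_ hb
    · filter_upwards [eventually_gt_atTop 0] with t ht
      positivity
    · filter_upwards [eventually_gt_atTop 0] with t ht
      have := exp_cubic_le hω ht
      have h3 : 0 < t ^ (p + 1) := by positivity
      nlinarith

theorem airyLaplace_zero {p : ℝ} (hp : -1 < p) :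
    airyLaplace p 0 = (1/12) ^ (-(p + 1) / 3) * (1 / 3) * Real.Gamma ((p + 1) / 3) := by
  have := _root_.integral_rpow_mul_exp_neg_mul_rpow (p := 3) (q := p) (b := 1/12) (by norm_num) hp
    (by norm_num)
  rw [← this, airyLaplace]
  refine setIntegral_congr_fun measurableSet_Ioi fun t (ht : 0 < t) => ?_
  have e : t ^ (3:ℝ) = t ^ 3 := by norm_cast
  simp only [e]
  congr 2
  ring

theorem abs_airyLaplace_sub_le {p ω : ℝ} (hp : -1 < p) (hω : 0 < ω) :
    |airyLaplace p ω - Real.Gamma (p + 1) * ω ^ (-(p + 1))|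
      ≤ Real.Gamma (p + 4) / 12 * ω ^ (-(p + 4)) := by
  have hg : ∀ q : ℝ, -1 < q → ∫ t in Set.Ioi (0:ℝ), t ^ q * rexp (-(ω * t))
      = Real.Gamma (q + 1) * ω ^ (-(q + 1)) := by
    intro q hq
    have := Real.integral_rpow_mul_exp_neg_mul_Ioi (a := q + 1) (r := ω) (by linarith) hω
    rw [add_sub_cancel_right] at this
    rw [this, one_div, Real.inv_rpow hω.le, Real.rpow_neg hω.le, mul_comm]
  have hi : ∀ q : ℝ, -1 < q → IntegrableOn (fun t : ℝ => t ^ q * rexp (-(ω * t))) (Set.Ioi 0) := by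
    intro q hq
    have := integrableOn_rpow_mul_exp_neg_mul_rpow (s := q) (p := 1) (b := ω) hq (by norm_num) hω
    simpa using this
  rw [← hg p hp, airyLaplace, ← integral_sub (integrable_airyLaplace hp (by linarith)) (hi p hp)]
  have e4 : p + 4 = p + 3 + 1 := by ring
  have : Real.Gamma (p + 4) / 12 * ω ^ (-(p + 4))
      = ∫ t in Set.Ioi (0:ℝ), t ^ (p+3) * rexp (-(ω * t)) / 12 := by
    rw [integral_div, hg _ (by linarith), ← e4]; ring
  rw [this, ← Real.norm_eq_abs]
  refine norm_integral_le_of_norm_le ((hi (p+3) (by linarith)).div_const _) ?_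
  refine (ae_restrict_mem measurableSet_Ioi).mono fun t (ht : 0 < t) => ?_
  have e1 : t ^ (p + 3) = t ^ p * t ^ 3 := by
    rw [← Real.rpow_natCast t 3, ← Real.rpow_add ht]; congr 1
  have e2 : t ^ p * rexp (-(ω * t) - t ^ 3 / 12) - t ^ p * rexp (-(ω * t))
      = - (t ^ p * rexp (-(ω * t)) * (1 - rexp (-(t ^ 3 / 12)))) := by
    rw [sub_eq_add_neg (-(ω * t)), Real.exp_add]; ring
  have h3 : rexp (-(t ^ 3 / 12)) ≤ 1 := Real.exp_le_one_iff.2 (by have := pow_pos ht 3; linarith)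
  have h4 := Real.add_one_le_exp (-(t ^ 3 / 12))
  rw [e2, norm_neg, Real.norm_of_nonneg (mul_nonneg (by positivity) (by linarith)), e1]
  have h5 : t ^ p * rexp (-(ω * t)) * (1 - rexp (-(t ^ 3 / 12)))
      ≤ t ^ p * rexp (-(ω * t)) * (t ^ 3 / 12) := by gcongr; linarith
  linarith

theorem one_div_twelve_rpow (r : ℝ) :
    ((1:ℝ)/12) ^ r = ((3:ℝ) ^ ((1:ℝ)/6) * (2:ℝ) ^ ((1:ℝ)/3)) ^ (-6 * r) := by
  rw [Real.mul_rpow (by positivity) (by positivity), ← Real.rpow_mul (by norm_num),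
    ← Real.rpow_mul (by norm_num)]
  have : (1:ℝ)/12 = (3 * 2 ^ (2:ℝ))⁻¹ := by norm_num
  rw [this, Real.inv_rpow (by positivity), ← Real.rpow_neg (by positivity), Real.mul_rpow (by norm_num) (by positivity),
    ← Real.rpow_mul (by norm_num)]
  congr 2 <;> ring

theorem airyLaplace_zero_sq :
    2 * airyLaplace (1/2) 0 ^ 2 = airyLaplace (-1/2) 0 * airyLaplace (3/2) 0 := by
  rw [airyLaplace_zero (by norm_num), airyLaplace_zero (by norm_num),
    airyLaplace_zero (by norm_num)]
  simp only [one_div_twelve_rpow]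
  have h1 := Real.Gamma_mul_Gamma_one_sub (1/6)
  rw [show (1:ℝ) - 1/6 = 5/6 by norm_num, show Real.pi * (1/6) = Real.pi / 6 by ring,
    Real.sin_pi_div_six] at h1
  have h2 := Real.Gamma_one_half_eq
  have h3 := Real.sq_sqrt Real.pi_pos.le
  rw [← h2] at h3
  generalize (3:ℝ) ^ ((1:ℝ)/6) * (2:ℝ) ^ ((1:ℝ)/3) = z
  rw [show -6 * (-((1:ℝ)/2 + 1)/3) = (3:ℕ) by norm_num,
    show -6 * (-(-(1:ℝ)/2 + 1)/3) = (1:ℕ) by norm_num,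
    show -6 * (-((3:ℝ)/2 + 1)/3) = (5:ℕ) by norm_num]
  simp only [Real.rpow_natCast]
  rw [show ((1:ℝ)/2+1)/3 = 1/2 by norm_num, show (-(1:ℝ)/2+1)/3 = 1/6 by norm_num,
    show ((3:ℝ)/2+1)/3 = 5/6 by norm_num]
  calc _ = 2 / 9 * z ^ 6 * Real.Gamma (1/2) ^ 2 := by ring
    _ = 1 / 9 * z ^ 6 * (Real.pi / (1/2)) := by rw [h3]; ring
    _ = _ := by rw [← h1]; ring

theorem airyLaplace_zero_ratio :
    (3:ℝ) ^ (-(1:ℝ)/3) / Real.Gamma (1/3) * airyLaplace (-1/2) 0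
      = (3:ℝ) ^ (-(2:ℝ)/3) / Real.Gamma (2/3) * airyLaplace (1/2) 0 := by
  rw [airyLaplace_zero (by norm_num), airyLaplace_zero (by norm_num)]
  simp only [one_div_twelve_rpow]
  have h1 := Real.Gamma_mul_Gamma_add_half (1/6)
  rw [show (1:ℝ)/6+1/2 = 2/3 by norm_num, show (2:ℝ) * (1/6) = 1/3 by ring] at h1
  have h2 := Real.Gamma_one_half_eq
  have e1 : (3:ℝ) ^ (-(1:ℝ)/3) = (((3:ℝ) ^ ((1:ℝ)/6)) ^ 2)⁻¹ := by
    rw [← Real.rpow_natCast, ← Real.rpow_neg (by positivity), ← Real.rpow_mul (by norm_num)]; norm_num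
  have e2 : (3:ℝ) ^ (-(2:ℝ)/3) = (((3:ℝ) ^ ((1:ℝ)/6)) ^ 4)⁻¹ := by
    rw [← Real.rpow_natCast, ← Real.rpow_neg (by positivity), ← Real.rpow_mul (by norm_num)]; norm_num
  have e3 : (2:ℝ) ^ (1 - (1:ℝ)/3) = ((2:ℝ) ^ ((1:ℝ)/3)) ^ 2 := by
    rw [← Real.rpow_natCast, ← Real.rpow_mul (by norm_num)]; norm_num
  rw [e1, e2]
  rw [e3] at h1
  have hu : 0 < (3:ℝ) ^ ((1:ℝ)/6) := by positivity
  generalize (3:ℝ) ^ ((1:ℝ)/6) = u at *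
  generalize (2:ℝ) ^ ((1:ℝ)/3) = v at *
  rw [show -6 * (-((1:ℝ)/2 + 1)/3) = (3:ℕ) by norm_num,
    show -6 * (-(-(1:ℝ)/2 + 1)/3) = (1:ℕ) by norm_num]
  simp only [Real.rpow_natCast]
  rw [show ((1:ℝ)/2+1)/3 = 1/2 by norm_num, show (-(1:ℝ)/2+1)/3 = 1/6 by norm_num, h2]
  have g1 : 0 < Real.Gamma (1/3) := Real.Gamma_pos_of_pos (by norm_num)
  have g2 : 0 < Real.Gamma (2/3) := Real.Gamma_pos_of_pos (by norm_num)
  field_simp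
  linear_combination v * h1

theorem hasDerivAt_airyLaplace_third {ω : ℝ} (hω : -1 < ω) :
    HasDerivAt (airyLaplace (3/2))
      (-2 * airyLaplace (-1/2) ω + 4 * ω * airyLaplace (1/2) ω) ω := by
  refine (hasDerivAt_airyLaplace (by norm_num) hω).congr_deriv ?_
  have := airyLaplace_recurrence (p := -1/2) (by norm_num) hω.le
  norm_num at this ⊢
  linarith

/-- Uniqueness for `m''' = -4 ω m' - 2 m` on `[0, ∞)`. -/
theorem eq_of_airyProduct_ode {f f' f'' g g' g'' : ℝ → ℂ}
    (hf : ∀ x, 0 ≤ x → HasDerivAt f (f' x) x) (hf' : ∀ x, 0 ≤ x → HasDerivAt f' (f'' x) x)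
    (hf'' : ∀ x : ℝ, 0 ≤ x → HasDerivAt f'' (-4 * x * f' x - 2 * f x) x)
    (hg : ∀ x, 0 ≤ x → HasDerivAt g (g' x) x) (hg' : ∀ x, 0 ≤ x → HasDerivAt g' (g'' x) x)
    (hg'' : ∀ x : ℝ, 0 ≤ x → HasDerivAt g'' (-4 * x * g' x - 2 * g x) x)
    (h0 : f 0 = g 0) (h0' : f' 0 = g' 0) (h0'' : f'' 0 = g'' 0) {x : ℝ} (hx : 0 ≤ x) :
    f x = g x := by
  have key := ODE_solution_unique_of_mem_Icc_right (E := ℂ × ℂ × ℂ)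
    (v := fun t p => (p.2.1, p.2.2, -4 * (t:ℂ) * p.2.1 - 2 * p.1)) (s := fun _ => Set.univ)
    (K := Real.toNNReal (4 * x + 3))
    (f := fun t => (f t, f' t, f'' t)) (g := fun t => (g t, g' t, g'' t)) (a := 0) (b := x)
    ?_ ?_ ?_ ?_ ?_ ?_ ?_ ?_
  · have := key (Set.right_mem_Icc.2 hx)
    exact congrArg Prod.fst this
  · intro t ht
    refine LipschitzOnWith.of_dist_le_mul fun p _ q _ => ?_
    rw [Real.coe_toNNReal _ (by positivity)]
    simp only [dist_eq_norm, Prod.fst_sub, Prod.snd_sub, Prod.norm_def]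
    have e : -4 * (t:ℂ) * p.2.1 - 2 * p.1 - (-4 * (t:ℂ) * q.2.1 - 2 * q.1)
        = -4 * (t:ℂ) * (p.2.1 - q.2.1) - 2 * (p.1 - q.1) := by ring
    rw [e]
    set A := ‖p.1 - q.1‖
    set B := ‖p.2.1 - q.2.1‖
    set D := ‖p.2.2 - q.2.2‖
    have hm1 : A ≤ max A (max B D) := le_max_left _ _
    have hm2 : B ≤ max A (max B D) := (le_max_left _ _).trans (le_max_right _ _)
    have hm3 : D ≤ max A (max B D) := (le_max_right _ _).trans (le_max_right _ _)
    have hA : 0 ≤ A := norm_nonneg _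
    have h1 : ‖-4 * (t:ℂ) * (p.2.1 - q.2.1) - 2 * (p.1 - q.1)‖ ≤ 4 * t * B + 2 * A := by
      refine (norm_sub_le _ _).trans ?_
      rw [norm_mul, norm_mul, norm_mul]
      simp [abs_of_nonneg ht.1, A, B]
    generalize max A (max B D) = m at *
    have ht1 := ht.1
    have ht2 := ht.2
    have hm : 0 ≤ m := hA.trans hm1
    refine max_le ?_ (max_le ?_ (h1.trans ?_))
    · nlinarith
    · nlinarith
    · nlinarith
  · intro t ht
    exact ((hf t ht.1).continuousAt.prodMk ((hf' t ht.1).continuousAt.prodMk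
      (hf'' t ht.1).continuousAt)).continuousWithinAt
  · intro t ht
    exact ((hf t ht.1).prodMk ((hf' t ht.1).prodMk (hf'' t ht.1))).hasDerivWithinAt
  · simp
  · intro t ht
    exact ((hg t ht.1).continuousAt.prodMk ((hg' t ht.1).continuousAt.prodMk
      (hg'' t ht.1).continuousAt)).continuousWithinAt
  · intro t ht
    exact ((hg t ht.1).prodMk ((hg' t ht.1).prodMk (hg'' t ht.1))).hasDerivWithinAt
  · simp
  · simp [h0'', h0', h0]

/-- The derivative of a continuous phase of a unimodular function. -/
theorem hasDerivAt_phase {L : ℝ → ℝ} (hL : Continuous L) {g : ℝ → ℂ} {g' : ℂ} {ω : ℝ}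
    (hg : HasDerivAt g g' ω) (he : ∀ x, Complex.exp (-(L x : ℂ) * Complex.I) = g x) :
    HasDerivAt L (Complex.I * (g' / g ω)).re ω := by
  have hg0 : g ω ≠ 0 := by rw [← he]; exact Complex.exp_ne_zero _
  have h1 : HasDerivAt (fun x => g x / g ω) (g' / g ω) ω := hg.div_const _
  have h2 : HasDerivAt (fun x => Complex.log (g x / g ω)) (g' / g ω) ω := by
    have := h1.clog_real (by rw [div_self hg0]; exact Complex.one_mem_slitPlane)
    simpa [div_self hg0] using this
  have h3 : HasDerivAt (fun x => L ω + (Complex.I * Complex.log (g x / g ω)).re)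
      (Complex.I * (g' / g ω)).re ω := by
    have h4 := (Complex.reCLM.hasFDerivAt.comp_hasDerivAt ω (h2.const_mul Complex.I))
    exact (h4.const_add (L ω))
  refine h3.congr_of_eventuallyEq ?_
  have hev : ∀ᶠ x in nhds ω, |L x - L ω| < Real.pi := by
    have := hL.continuousAt (x := ω)
    rw [Metric.continuousAt_iff'] at this
    simpa [Real.dist_eq] using this Real.pi Real.pi_pos
  filter_upwards [hev] with x hx
  rw [← he, ← he, ← Complex.exp_sub]
  have e : -(L x : ℂ) * Complex.I - -(L ω : ℂ) * Complex.I = ((-(L x - L ω) : ℝ) : ℂ) * Complex.I := by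
    push_cast; ring
  rw [abs_lt] at hx
  rw [e, Complex.log_exp (by simp; linarith) (by simp; linarith)]
  have : Complex.I * (((-(L x - L ω) : ℝ) : ℂ) * Complex.I) = ((L x - L ω : ℝ) : ℂ) := by
    push_cast
    linear_combination -((L x : ℂ) - L ω) * Complex.I_mul_I
  rw [this, Complex.ofReal_re]
  ring

theorem hasDerivAt_airy_ray {Ai : ℂ → ℂ} (h1 : Differentiable ℂ Ai)
    (e : ℂ) (ω : ℝ) :
    HasDerivAt (fun x : ℝ => e * Ai (e * x)) (e ^ 2 * deriv Ai (e * ω)) ω := by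
  have h0 : HasDerivAt (fun z : ℂ => e * Ai (e * z)) (e ^ 2 * deriv Ai (e * ω)) (ω : ℂ) := by
    have h3 : HasDerivAt (fun z : ℂ => e * z) e (ω : ℂ) := by
      simpa using (hasDerivAt_id (ω : ℂ)).const_mul e
    have h4 := ((h1 (e * ω)).hasDerivAt.comp (ω : ℂ) h3).const_mul e
    refine h4.congr_deriv ?_
    ring
  exact h0.comp_ofReal

theorem hasDerivAt_airy_ray' {Ai : ℂ → ℂ} (h2 : Differentiable ℂ (deriv Ai))
    (hode : ∀ z : ℂ, deriv (deriv Ai) z = z * Ai z) {e : ℂ} (he : e ^ 3 = -1) (ω : ℝ) :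
    HasDerivAt (fun x : ℝ => e ^ 2 * deriv Ai (e * x)) (-ω * (e * Ai (e * ω))) ω := by
  have h0 : HasDerivAt (fun z : ℂ => e ^ 2 * deriv Ai (e * z)) (-ω * (e * Ai (e * ω))) (ω : ℂ) := by
    have h3 : HasDerivAt (fun z : ℂ => e * z) e (ω : ℂ) := by
      simpa using (hasDerivAt_id (ω : ℂ)).const_mul e
    have h4 := ((h2 (e * ω)).hasDerivAt.comp (ω : ℂ) h3).const_mul (e ^ 2)
    refine h4.congr_deriv ?_
    rw [hode]
    linear_combination (e * ω * Ai (e * ω)) * he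
  exact h0.comp_ofReal

section
variable {Ai : ℂ → ℂ}

theorem airy_rotation_cube :
    Complex.exp (-(Real.pi / 3 : ℂ) * Complex.I) ^ 3 = -1 ∧
    Complex.exp ((Real.pi / 3 : ℂ) * Complex.I) ^ 3 = -1 ∧
    Complex.exp (-(Real.pi / 3 : ℂ) * Complex.I) * Complex.exp ((Real.pi / 3 : ℂ) * Complex.I) = 1 ∧
    Complex.exp (-(Real.pi / 3 : ℂ) * Complex.I) + Complex.exp ((Real.pi / 3 : ℂ) * Complex.I) = 1 ∧
    Complex.exp ((Real.pi / 3 : ℂ) * Complex.I) - Complex.exp (-(Real.pi / 3 : ℂ) * Complex.I)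
      = (√3 : ℝ) * Complex.I := by
  have e0 : (Real.pi / 3 : ℂ) = ((Real.pi / 3 : ℝ) : ℂ) := by push_cast; rfl
  have e1 : Complex.exp ((Real.pi / 3 : ℂ) * Complex.I) = (1/2 : ℝ) + (√3 / 2 : ℝ) * Complex.I := by
    rw [e0, Complex.exp_mul_I, ← Complex.ofReal_cos, ← Complex.ofReal_sin, Real.cos_pi_div_three,
      Real.sin_pi_div_three]
  have e2 : Complex.exp (-(Real.pi / 3 : ℂ) * Complex.I) = (1/2 : ℝ) - (√3 / 2 : ℝ) * Complex.I := by
    rw [e0, ← Complex.ofReal_neg, Complex.exp_mul_I, ← Complex.ofReal_cos, ← Complex.ofReal_sin,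
      Real.cos_neg, Real.sin_neg, Real.cos_pi_div_three, Real.sin_pi_div_three]
    push_cast; ring
  refine ⟨?_, ?_, ?_, ?_, ?_⟩
  · rw [← Complex.exp_nat_mul, show ((3:ℕ):ℂ) * (-(Real.pi / 3 : ℂ) * Complex.I)
      = -(Real.pi * Complex.I) by push_cast; ring, Complex.exp_neg, Complex.exp_pi_mul_I]
    norm_num
  · rw [← Complex.exp_nat_mul, show ((3:ℕ):ℂ) * ((Real.pi / 3 : ℂ) * Complex.I)
      = (Real.pi * Complex.I) by push_cast; ring, Complex.exp_pi_mul_I]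
  · rw [← Complex.exp_add]; simp
  · rw [e1, e2]; push_cast; ring
  · rw [e1, e2]; push_cast; ring

/-- `A₊ A₋` is a multiple of the Laplace integral, and the derivative of the Airy phase is
`2 √π / airyLaplace (-1/2)`. -/
theorem hasDerivAt_airyPhase
    (hAi_diff : Differentiable ℂ Ai)
    (hAi_diff' : Differentiable ℂ (deriv Ai))
    (hAi_ode : ∀ z : ℂ, deriv (deriv Ai) z = z * Ai z)
    (hAi_zero : Ai 0 = (3 : ℂ) ^ (-(2 : ℂ)/3) / Complex.Gamma (2/3))
    (hAi_zero' : deriv Ai 0 = -((3 : ℂ) ^ (-(1 : ℂ)/3)) / Complex.Gamma (1/3))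
    {L : ℝ → ℝ} (hL_cont : Continuous L)
    (hAp_ne : ∀ w : ℝ, Aplus Ai w ≠ 0)
    (hL_char : ∀ w : ℝ, Complex.exp (-(L w : ℂ) * Complex.I) = -(Aminus Ai w) / (Aplus Ai w))
    {ω : ℝ} (hω : 0 ≤ ω) :
    HasDerivAt L (2 * √Real.pi / airyLaplace (-1/2) ω) ω := by
  obtain ⟨hc1, hc2, hprod, hsum, hdiff⟩ := airy_rotation_cube
  unfold Aplus Aminus at *
  set e₁ := Complex.exp (-(Real.pi / 3 : ℂ) * Complex.I)
  set e₂ := Complex.exp ((Real.pi / 3 : ℂ) * Complex.I)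
  set α : ℝ := (3:ℝ) ^ (-(2:ℝ)/3) / Real.Gamma (2/3) with hα
  set α' : ℝ := -((3:ℝ) ^ (-(1:ℝ)/3) / Real.Gamma (1/3)) with hα'
  have hz : Ai 0 = α := by
    rw [hAi_zero, hα]
    push_cast [Complex.ofReal_cpow (show (0:ℝ) ≤ 3 by norm_num)]
    rw [← Complex.Gamma_ofReal]
    push_cast
    rfl
  have hz' : deriv Ai 0 = α' := by
    rw [hAi_zero', hα']
    push_cast [Complex.ofReal_cpow (show (0:ℝ) ≤ 3 by norm_num)]
    rw [← Complex.Gamma_ofReal]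
    push_cast
    rw [neg_div]
  set a₀ : ℝ → ℂ := fun x => e₁ * Ai (e₁ * x)
  set a₁ : ℝ → ℂ := fun x => e₁ ^ 2 * deriv Ai (e₁ * x)
  set b₀ : ℝ → ℂ := fun x => e₂ * Ai (e₂ * x)
  set b₁ : ℝ → ℂ := fun x => e₂ ^ 2 * deriv Ai (e₂ * x)
  have ha₀ : ∀ x, HasDerivAt a₀ (a₁ x) x := hasDerivAt_airy_ray hAi_diff e₁
  have hb₀ : ∀ x, HasDerivAt b₀ (b₁ x) x := hasDerivAt_airy_ray hAi_diff e₂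
  have ha₁ : ∀ x : ℝ, HasDerivAt a₁ (-x * a₀ x) x := hasDerivAt_airy_ray' hAi_diff' hAi_ode hc1
  have hb₁ : ∀ x : ℝ, HasDerivAt b₁ (-x * b₀ x) x := hasDerivAt_airy_ray' hAi_diff' hAi_ode hc2
  have va₀ : a₀ 0 = e₁ * α := by simp [a₀, hz]
  have vb₀ : b₀ 0 = e₂ * α := by simp [b₀, hz]
  have va₁ : a₁ 0 = e₁ ^ 2 * α' := by simp [a₁, hz']
  have vb₁ : b₁ 0 = e₂ ^ 2 * α' := by simp [b₁, hz']
  have hW : b₁ ω * a₀ ω - b₀ ω * a₁ ω = (√3 : ℝ) * Complex.I * (α * α') := by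
    have hd : ∀ x : ℝ, HasDerivAt (fun x => b₁ x * a₀ x - b₀ x * a₁ x) 0 x := by
      intro x
      refine (((hb₁ x).mul (ha₀ x)).sub ((hb₀ x).mul (ha₁ x))).congr_deriv ?_
      ring
    have := is_const_of_deriv_eq_zero (fun x => (hd x).differentiableAt) (fun x => (hd x).deriv) ω 0
    rw [this, va₀, vb₀, va₁, vb₁]
    linear_combination (α * α' * (e₂ - e₁)) * hprod + (α * α') * hdiff
  have hG0 : airyLaplace (-1/2) 0 ≠ 0 := (airyLaplace_pos (by norm_num) (by norm_num)).ne'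
  have hratio : -α' * airyLaplace (-1/2) 0 = α * airyLaplace (1/2) 0 := by
    rw [hα, hα', neg_neg]; exact airyLaplace_zero_ratio
  have hsq := airyLaplace_zero_sq
  set G0 := airyLaplace (-1/2) 0
  set G1 := airyLaplace (1/2) 0
  set G2 := airyLaplace (3/2) 0
  have hαpos : 0 < α := by rw [hα]; exact div_pos (by positivity) (Real.Gamma_pos_of_pos (by norm_num))
  have hα'v : α' = -(α * G1 / G0) := by
    field_simp
    linarith
  set c : ℝ := α ^ 2 / G0
  have hGa : ∀ x : ℝ, 0 ≤ x → HasDerivAt (fun x : ℝ => ((c * airyLaplace (-1/2) x : ℝ) : ℂ))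
      ((-(c * airyLaplace (1/2) x) : ℝ) : ℂ) x := by
    intro x hx
    apply HasDerivAt.ofReal_comp
    refine ((hasDerivAt_airyLaplace (by norm_num) (by linarith)).const_mul c).congr_deriv ?_
    norm_num
  have hGb : ∀ x : ℝ, 0 ≤ x → HasDerivAt (fun x : ℝ => ((-(c * airyLaplace (1/2) x) : ℝ) : ℂ))
      ((c * airyLaplace (3/2) x : ℝ) : ℂ) x := by
    intro x hx
    apply HasDerivAt.ofReal_comp
    refine ((hasDerivAt_airyLaplace (by norm_num) (by linarith)).const_mul c).neg.congr_deriv ?_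
    norm_num
  have hGc : ∀ x : ℝ, 0 ≤ x → HasDerivAt (fun x : ℝ => ((c * airyLaplace (3/2) x : ℝ) : ℂ))
      (-4 * (x : ℂ) * ((-(c * airyLaplace (1/2) x) : ℝ) : ℂ)
        - 2 * ((c * airyLaplace (-1/2) x : ℝ) : ℂ)) x := by
    intro x hx
    refine ((hasDerivAt_airyLaplace_third (by linarith)).const_mul c).ofReal_comp.congr_deriv ?_
    push_cast
    ring
  have hm : a₀ ω * b₀ ω = ((c * airyLaplace (-1/2) ω : ℝ) : ℂ) := by
    refine eq_of_airyProduct_ode (f := fun x => a₀ x * b₀ x) (f' := fun x => a₁ x * b₀ x + a₀ x * b₁ x)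
      (f'' := fun x => 2 * (a₁ x * b₁ x) - 2 * x * (a₀ x * b₀ x)) ?_ ?_ ?_ hGa hGb hGc ?_ ?_ ?_ hω
    · exact fun x _ => (ha₀ x).mul (hb₀ x)
    · intro x _
      refine (((ha₁ x).mul (hb₀ x)).add ((ha₀ x).mul (hb₁ x))).congr_deriv ?_
      ring
    · intro x _
      have hx : HasDerivAt (fun x : ℝ => 2 * (x : ℂ)) 2 x := by
        simpa using (Complex.ofRealCLM.hasDerivAt (x := x)).const_mul (2:ℂ)
      refine ((((ha₁ x).mul (hb₁ x)).const_mul 2).sub (hx.mul ((ha₀ x).mul (hb₀ x)))).congr_deriv ?_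
      simp only [Pi.mul_apply]
      ring
    · simp only [va₀, vb₀]
      rw [show c * airyLaplace (-1/2) 0 = α ^ 2 from div_mul_cancel₀ _ hG0]
      push_cast
      linear_combination (α : ℂ) ^ 2 * hprod
    · simp only [va₀, vb₀, va₁, vb₁]
      have : -(c * G1) = α * α' := by rw [hα'v]; simp only [c]; field_simp
      rw [show -(c * airyLaplace (1/2) 0) = α * α' from this]
      push_cast
      linear_combination (α * α' * (e₁ + e₂)) * hprod + (α * α') * hsum
    · simp only [va₀, vb₀, va₁, vb₁]
      have : c * G2 = 2 * α' ^ 2 := by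
        rw [hα'v]; simp only [c]; field_simp; linear_combination -hsq
      rw [show c * airyLaplace (3/2) 0 = 2 * α' ^ 2 from this]
      push_cast
      linear_combination (2 * α' ^ 2 * (e₁ * e₂ + 1)) * hprod
  have ha_ne : a₀ ω ≠ 0 := hAp_ne ω
  have hm_pos : 0 < airyLaplace (-1/2) ω := airyLaplace_pos (by norm_num) (by linarith)
  have hc0 : c ≠ 0 := div_ne_zero (by positivity) hG0
  have hb_ne : b₀ ω ≠ 0 := by
    intro h0
    rw [h0, mul_zero] at hm
    exact mul_ne_zero hc0 hm_pos.ne' (by exact_mod_cast hm.symm)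
  have hg : HasDerivAt (fun x => -b₀ x / a₀ x)
      (-(b₁ ω * a₀ ω - b₀ ω * a₁ ω) / a₀ ω ^ 2) ω := by
    refine ((hb₀ ω).neg.div (ha₀ ω) ha_ne).congr_deriv ?_
    simp only [Pi.neg_apply]
    ring
  have key := hasDerivAt_phase hL_cont hg hL_char
  refine key.congr_deriv ?_
  have e1 : -(b₁ ω * a₀ ω - b₀ ω * a₁ ω) / a₀ ω ^ 2 / (-b₀ ω / a₀ ω)
      = (b₁ ω * a₀ ω - b₀ ω * a₁ ω) / (a₀ ω * b₀ ω) := by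
    field_simp
  rw [e1, hW, hm]
  have e2 : Complex.I * ((√3 : ℝ) * Complex.I * (α * α') / ((c * airyLaplace (-1/2) ω : ℝ) : ℂ))
      = ((-(√3 * α * α' / (c * airyLaplace (-1/2) ω)) : ℝ) : ℂ) := by
    push_cast
    linear_combination ((√3 : ℝ) * (α * α') / ((c : ℂ) * airyLaplace (-1/2) ω)) * Complex.I_mul_I
  rw [e2, Complex.ofReal_re, hα'v]
  have hG1 : G1 = 12 ^ ((1:ℝ)/2) / 3 * √Real.pi := by
    simp only [G1]
    rw [airyLaplace_zero (by norm_num), show ((1:ℝ)/2+1)/3 = 1/2 by norm_num, Real.Gamma_one_half_eq,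
      show -((1:ℝ)/2+1)/3 = -(1/2) by norm_num, one_div 12, Real.inv_rpow (by norm_num),
      Real.rpow_neg (by norm_num), inv_inv]
    ring
  have h12 : (12:ℝ) ^ ((1:ℝ)/2) = 2 * √3 := by
    rw [← Real.sqrt_eq_rpow, show (12:ℝ) = 2 ^ 2 * 3 by norm_num, Real.sqrt_mul (by norm_num),
      Real.sqrt_sq (by norm_num)]
  rw [hG1, h12]
  simp only [c]
  have h3 : √3 ^ 2 = (3:ℝ) := Real.sq_sqrt (by norm_num)
  field_simp
  rw [h3]
end

theorem airyLaplace_asymptotics {ω : ℝ} (hω : 1 ≤ ω) :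
    ∃ δ δ' : ℝ, |δ| ≤ 1 / (4 * ω ^ 2) ∧ |δ'| ≤ 5 / (4 * ω ^ 2) ∧
      airyLaplace (-1/2) ω = √Real.pi / √ω * (1 + δ) ∧
      airyLaplace (1/2) ω = √Real.pi / (2 * ω * √ω) * (1 + δ') := by
  have hω0 : 0 < ω := by linarith
  have hpi : 0 < √Real.pi := Real.sqrt_pos.2 Real.pi_pos
  have hs : 0 < √ω := Real.sqrt_pos.2 hω0
  have g3 : Real.Gamma (3/2) = √Real.pi / 2 := by
    rw [show (3:ℝ)/2 = 1/2 + 1 by norm_num, Real.Gamma_add_one (by norm_num), Real.Gamma_one_half_eq]; ring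
  have g5 : Real.Gamma (5/2) = 3 * √Real.pi / 4 := by
    rw [show (5:ℝ)/2 = 3/2 + 1 by norm_num, Real.Gamma_add_one (by norm_num), g3]; ring
  have g7 : Real.Gamma (7/2) = 15 * √Real.pi / 8 := by
    rw [show (7:ℝ)/2 = 5/2 + 1 by norm_num, Real.Gamma_add_one (by norm_num), g5]; ring
  have g9 : Real.Gamma (9/2) = 105 * √Real.pi / 16 := by
    rw [show (9:ℝ)/2 = 7/2 + 1 by norm_num, Real.Gamma_add_one (by norm_num), g7]; ring
  have r : ∀ n : ℕ, ω ^ (-((n:ℝ) + 1/2)) = 1 / (ω ^ n * √ω) := by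
    intro n
    rw [Real.rpow_neg hω0.le, Real.rpow_add hω0, Real.rpow_natCast, Real.sqrt_eq_rpow, ← one_div]
  have r0 : ω ^ (-(-1/2+1) : ℝ) = 1 / √ω := by
    have := r 0; norm_num at this ⊢; exact this
  have r1 : ω ^ (-(1/2+1) : ℝ) = 1 / (ω * √ω) := by
    have := r 1; norm_num at this ⊢; exact this
  have r3 : ω ^ (-(-1/2+4) : ℝ) = 1 / (ω ^ 3 * √ω) := by
    have := r 3; norm_num at this ⊢; exact this
  have r4 : ω ^ (-(1/2+4) : ℝ) = 1 / (ω ^ 4 * √ω) := by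
    have := r 4; norm_num at this ⊢; exact this
  have h1 := abs_airyLaplace_sub_le (p := -1/2) (by norm_num) hω0
  have h2 := abs_airyLaplace_sub_le (p := 1/2) (by norm_num) hω0
  rw [r0, r3, show (-1/2+1:ℝ) = 1/2 by norm_num, show (-1/2+4:ℝ) = 7/2 by norm_num, g7,
    Real.Gamma_one_half_eq] at h1
  rw [r1, r4, show (1/2+1:ℝ) = 3/2 by norm_num, show (1/2+4:ℝ) = 9/2 by norm_num, g9, g3] at h2
  have hω3 : ω ^ 2 ≤ ω ^ 3 := pow_le_pow_right₀ hω (by norm_num)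
  refine ⟨airyLaplace (-1/2) ω / (√Real.pi / √ω) - 1,
    airyLaplace (1/2) ω / (√Real.pi / (2 * ω * √ω)) - 1, ?_, ?_, ?_, ?_⟩
  · have e : airyLaplace (-1/2) ω / (√Real.pi / √ω) - 1
        = (airyLaplace (-1/2) ω - √Real.pi * (1 / √ω)) * (√ω / √Real.pi) := by field_simp
    rw [e, abs_mul, abs_of_pos (div_pos hs hpi)]
    refine (mul_le_mul_of_nonneg_right h1 (by positivity)).trans ?_
    have : 15 * √Real.pi / 8 / 12 * (1 / (ω ^ 3 * √ω)) * (√ω / √Real.pi) = 15 / 96 / ω ^ 3 := by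
      field_simp; norm_num
    rw [this, div_le_div_iff₀ (by positivity) (by positivity)]
    nlinarith
  · have e : airyLaplace (1/2) ω / (√Real.pi / (2 * ω * √ω)) - 1
        = (airyLaplace (1/2) ω - √Real.pi / 2 * (1 / (ω * √ω))) * (2 * ω * √ω / √Real.pi) := by
      field_simp
    rw [e, abs_mul, abs_of_pos (a := 2 * ω * √ω / √Real.pi) (by positivity)]
    refine (mul_le_mul_of_nonneg_right h2 (by positivity)).trans ?_
    have : 105 * √Real.pi / 16 / 12 * (1 / (ω ^ 4 * √ω)) * (2 * ω * √ω / √Real.pi)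
        = 105 / 96 / ω ^ 3 := by
      field_simp; norm_num
    rw [this, div_le_div_iff₀ (by positivity) (by positivity)]
    nlinarith
  · field_simp; ring
  · field_simp; ring

/-- Quantitative asymptotics of the first two derivatives of the Airy phase. -/
theorem exists_airyPhase_bounds {Ai : ℂ → ℂ}
    (hAi_diff : Differentiable ℂ Ai)
    (hAi_diff' : Differentiable ℂ (deriv Ai))
    (hAi_ode : ∀ z : ℂ, deriv (deriv Ai) z = z * Ai z)
    (hAi_zero : Ai 0 = (3 : ℂ) ^ (-(2 : ℂ)/3) / Complex.Gamma (2/3))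
    (hAi_zero' : deriv Ai 0 = -((3 : ℂ) ^ (-(1 : ℂ)/3)) / Complex.Gamma (1/3))
    {L : ℝ → ℝ} (hL_cont : Continuous L)
    (hAp_ne : ∀ w : ℝ, Aplus Ai w ≠ 0)
    (hL_char : ∀ w : ℝ, Complex.exp (-(L w : ℂ) * Complex.I) = -(Aminus Ai w) / (Aplus Ai w)) :
    ∃ L₁ L₂ : ℝ → ℝ, (∀ ω, 0 < ω → HasDerivAt L (L₁ ω) ω) ∧
      (∀ ω, 0 < ω → HasDerivAt L₁ (L₂ ω) ω) ∧
      (∀ ω, 1 ≤ ω → |2 * √ω - L₁ ω| ≤ 1 / (ω * √ω)) ∧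
      ∀ ω, 1 ≤ ω → |1 / √ω - L₂ ω| ≤ 8 / (ω ^ 2 * √ω) := by
  refine ⟨fun ω => 2 * √Real.pi / airyLaplace (-1/2) ω,
    fun ω => 2 * √Real.pi * airyLaplace (1/2) ω / airyLaplace (-1/2) ω ^ 2, ?_, ?_, ?_, ?_⟩
  · intro ω hω
    exact hasDerivAt_airyPhase hAi_diff hAi_diff' hAi_ode hAi_zero hAi_zero' hL_cont hAp_ne hL_char
      hω.le
  · intro ω hω
    have hG := (airyLaplace_pos (p := -1/2) (ω := ω) (by norm_num) (by linarith)).ne'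
    have h := hasDerivAt_airyLaplace (p := -1/2) (ω := ω) (by norm_num) (by linarith)
    norm_num at h
    refine ((hasDerivAt_const ω (2 * √Real.pi)).div (by norm_num; exact h) hG).congr_deriv ?_
    ring
  · intro ω hω
    have hω0 : 0 < ω := by linarith
    obtain ⟨δ, δ', hδ, -, hG, -⟩ := airyLaplace_asymptotics hω
    have hpi : 0 < √Real.pi := Real.sqrt_pos.2 Real.pi_pos
    have hs : 0 < √ω := Real.sqrt_pos.2 hω0
    have hss : √ω ^ 2 = ω := Real.sq_sqrt hω0.le
    have hδ1 : |δ| ≤ 1 / 4 := hδ.trans (by rw [div_le_div_iff₀ (by positivity) (by positivity)]; nlinarith)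
    have hd : 3/4 ≤ 1 + δ := by linarith [(abs_le.1 hδ1).1]
    have hd0 : 0 < 1 + δ := by linarith
    simp only [hG]
    have e : 2 * √ω - 2 * √Real.pi / (√Real.pi / √ω * (1 + δ)) = 2 * √ω * (δ / (1 + δ)) := by
      field_simp; ring
    rw [e, abs_mul, abs_div, abs_of_pos hd0, abs_of_pos (a := 2 * √ω) (by positivity)]
    calc 2 * √ω * (|δ| / (1 + δ)) ≤ 2 * √ω * (1 / (4 * ω ^ 2) / (3/4)) := by gcongr
      _ = (2 / 3) * (1 / (ω * √ω)) := by
        field_simp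
        rw [hss]
      _ ≤ _ := by
        have : 0 < 1 / (ω * √ω) := by positivity
        linarith
  · intro ω hω
    have hω0 : 0 < ω := by linarith
    obtain ⟨δ, δ', hδ, hδ', hG, hG1⟩ := airyLaplace_asymptotics hω
    have hpi : 0 < √Real.pi := Real.sqrt_pos.2 Real.pi_pos
    have hs : 0 < √ω := Real.sqrt_pos.2 hω0
    have hss : √ω ^ 2 = ω := Real.sq_sqrt hω0.le
    have hδ1 : |δ| ≤ 1 / 4 := hδ.trans (by rw [div_le_div_iff₀ (by positivity) (by positivity)]; nlinarith)
    have hd : 3/4 ≤ 1 + δ := by linarith [(abs_le.1 hδ1).1]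
    have hd0 : 0 < 1 + δ := by linarith
    simp only [hG, hG1]
    have e : 1 / √ω - 2 * √Real.pi * (√Real.pi / (2 * ω * √ω) * (1 + δ')) / (√Real.pi / √ω * (1 + δ)) ^ 2
        = 1 / √ω * ((2 * δ + δ ^ 2 - δ') / (1 + δ) ^ 2) := by
      field_simp
      rw [hss]; field_simp; ring
    rw [e, abs_mul, abs_div (_ - δ'), abs_of_pos (a := (1 + δ) ^ 2) (by positivity),
      abs_of_pos (a := 1 / √ω) (by positivity)]
    have hn : |2 * δ + δ ^ 2 - δ'| ≤ 4 / (2 * ω ^ 2) := by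
      have h1 : |2 * δ + δ ^ 2 - δ'| ≤ 2 * |δ| + |δ| * |δ| + |δ'| := by
        refine (abs_sub _ _).trans (add_le_add ((abs_add_le _ _).trans ?_) le_rfl)
        rw [abs_mul, abs_pow, abs_two, sq]
      have h2 : |δ| * |δ| ≤ |δ| := by nlinarith [abs_nonneg δ]
      have e1 : 1 / (4 * ω ^ 2) = 1 / ω ^ 2 / 4 := by field_simp
      have e2 : 5 / (4 * ω ^ 2) = 5 / 4 * (1 / ω ^ 2) := by field_simp
      have e3 : 4 / (2 * ω ^ 2) = 2 * (1 / ω ^ 2) := by field_simp; norm_num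
      rw [e1] at hδ
      rw [e2] at hδ'
      rw [e3]
      linarith
    have hd2 : 1 / 2 ≤ (1 + δ) ^ 2 := by nlinarith
    calc 1 / √ω * (|2 * δ + δ ^ 2 - δ'| / (1 + δ) ^ 2) ≤ 1 / √ω * (4 / (2 * ω ^ 2) / (1 / 2)) := by gcongr
      _ = 4 / (ω ^ 2 * √ω) := by field_simp
      _ ≤ _ := by gcongr; norm_num

/-- The `A`-derivative, divided by `N`, of the phase of the `A`-integral (with `θ = T√(1+a)/N`). -/
noncomputable def prof (a θ A : ℝ) : ℝ := θ / (2 * √(1 + a * A)) - 2 * √A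

/-- The primitive of `prof`. -/
noncomputable def profInt (a θ A : ℝ) : ℝ :=
  θ * (A - 1) / (√(1 + a * A) + √(1 + a)) - (4/3) * A ^ ((3:ℝ)/2)

/-- Minus the derivative of `prof`. -/
noncomputable def profW (a θ A : ℝ) : ℝ := θ * a / (4 * √(1 + a * A) ^ 3) + 1 / √A

/-- The derivative of `profW`. -/
noncomputable def profW' (a θ A : ℝ) : ℝ :=
  -(3 * θ * a ^ 2 / (8 * √(1 + a * A) ^ 5) + 1 / (2 * A * √A))

section
variable {a θ : ℝ} (ha : 0 < a)
include ha

theorem hasDerivAt_sqrt_one_add {A : ℝ} (hA : 0 < A) :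
    HasDerivAt (fun A => √(1 + a * A)) (a / (2 * √(1 + a * A))) A := by
  have h1 : HasDerivAt (fun A : ℝ => 1 + a * A) a A := by
    simpa using ((hasDerivAt_id A).const_mul a).const_add 1
  exact h1.sqrt (by positivity)

theorem hasDerivAt_profInt {A : ℝ} (hA : 0 < A) :
    HasDerivAt (profInt a θ) (prof a θ A) A := by
  have h0 : ∀ B, 0 ≤ B → θ * (B - 1) / (√(1 + a * B) + √(1 + a)) = θ / a * (√(1 + a * B) - √(1 + a)) := by
    intro B hB
    have e1 : √(1 + a * B) ^ 2 = 1 + a * B := Real.sq_sqrt (by positivity)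
    have e2 : √(1 + a) ^ 2 = 1 + a := Real.sq_sqrt (by positivity)
    have : 0 < √(1 + a * B) + √(1 + a) := by positivity
    generalize √(1 + a * B) = u at *
    generalize √(1 + a) = v at *
    field_simp
    linear_combination θ * (e2 - e1)
  have h1 := ((hasDerivAt_sqrt_one_add ha hA).sub_const (√(1 + a))).const_mul (θ / a)
  have h2 := (Real.hasDerivAt_rpow_const (x := A) (p := (3:ℝ)/2) (Or.inl hA.ne')).const_mul (4/3 : ℝ)
  have h3 := h1.sub h2
  have e : θ / a * (a / (2 * √(1 + a * A))) - 4 / 3 * (3 / 2 * A ^ ((3:ℝ) / 2 - 1)) = prof a θ A := by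
    rw [prof, Real.sqrt_eq_rpow A, show (3:ℝ)/2 - 1 = 1/2 by norm_num]
    field_simp
    ring
  rw [e] at h3
  refine h3.congr_of_eventuallyEq ?_
  filter_upwards [lt_mem_nhds hA] with B hB
  simp only [profInt, h0 B hB.le, Pi.sub_apply]

theorem hasDerivAt_prof {A : ℝ} (hA : 0 < A) :
    HasDerivAt (prof a θ) (-profW a θ A) A := by
  have h1 := hasDerivAt_sqrt_one_add ha hA
  have hb : 0 < √(1 + a * A) := by positivity
  have h2 := (Real.hasDerivAt_sqrt hA.ne').const_mul 2
  have h3 := ((hasDerivAt_const A θ).div (h1.const_mul 2) (by positivity)).sub h2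
  refine h3.congr_deriv ?_
  have hs : 0 < √A := Real.sqrt_pos.2 hA
  rw [profW]
  field_simp
  ring

theorem hasDerivAt_profW {A : ℝ} (hA : 0 < A) :
    HasDerivAt (profW a θ) (profW' a θ A) A := by
  have h1 := hasDerivAt_sqrt_one_add ha hA
  have hb : 0 < √(1 + a * A) := by positivity
  have hs : 0 < √A := Real.sqrt_pos.2 hA
  have h2 := Real.hasDerivAt_sqrt hA.ne'
  have h3 := ((hasDerivAt_const A (θ * a)).div ((h1.pow 3).const_mul 4)
    (by simp only [Pi.pow_apply]; positivity)).add
    ((hasDerivAt_const A 1).div h2 hs.ne')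
  refine h3.congr_deriv ?_
  have hss : √A ^ 2 = A := Real.sq_sqrt hA.le
  rw [profW']
  simp only [Pi.pow_apply]
  have e2 : (0 * √A - 1 * (1 / (2 * √A))) / √A ^ 2 = -(1 / (2 * A * √A)) := by
    rw [hss]; field_simp; ring
  rw [e2]
  field_simp
  ring

variable (hθ : 3 ≤ θ)
include hθ

theorem one_div_sqrt_le_profW {A : ℝ} (hA : 0 < A) : 1 / √A ≤ profW a θ A := by
  rw [profW]
  have : 0 ≤ θ * a / (4 * √(1 + a * A) ^ 3) := by positivity
  linarith

theorem profW_pos {A : ℝ} (hA : 0 < A) : 0 < profW a θ A :=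
  lt_of_lt_of_le (by have := Real.sqrt_pos.2 hA; positivity) (one_div_sqrt_le_profW ha hθ hA)

theorem prof_sub_ge {A B : ℝ} (hA : 0 < A) (hAB : A ≤ B) (hB : B ≤ 20) :
    (B - A) / 5 ≤ prof a θ A - prof a θ B := by
  have h1 : √(1 + a * A) ≤ √(1 + a * B) := by gcongr
  have h2 : 0 < √(1 + a * A) := by positivity
  have h3 : θ / (2 * √(1 + a * B)) ≤ θ / (2 * √(1 + a * A)) := by gcongr
  have hsA : √A ^ 2 = A := Real.sq_sqrt hA.le
  have hsB : √B ^ 2 = B := Real.sq_sqrt (hA.le.trans hAB)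
  have hm : √A ≤ √B := Real.sqrt_le_sqrt hAB
  have hp : 0 < √A := Real.sqrt_pos.2 hA
  have h4 : √B ≤ 5 := by nlinarith
  have h5 : (B - A) / 5 ≤ 2 * √B - 2 * √A := by
    nlinarith
  rw [prof, prof]
  linarith

variable (ha' : a ≤ 1/1000) (hθ' : θ ≤ 51/10)
omit hθ
include ha' hθ'

theorem profW_le {A : ℝ} (hA : 0 < A) : profW a θ A ≤ 1 / √A + 13/10000 := by
  rw [profW]
  have h1 : 1 ≤ √(1 + a * A) := Real.one_le_sqrt.2 (by nlinarith)
  have h2 : 1 ≤ √(1 + a * A) ^ 3 := one_le_pow₀ h1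
  have : θ * a / (4 * √(1 + a * A) ^ 3) ≤ 13/10000 := by
    rw [div_le_iff₀ (by positivity)]
    nlinarith
  linarith

include hθ in
theorem abs_profW'_le {A : ℝ} (hA : 0 < A) (hA' : A ≤ 20) :
    |profW' a θ A| ≤ 6 / 10 * (1 / (A * √A)) := by
  have hs : 0 < √A := Real.sqrt_pos.2 hA
  have hss : √A ^ 2 = A := Real.sq_sqrt hA.le
  have hs5 : √A ≤ 9/2 := by nlinarith
  have h1 : 1 ≤ √(1 + a * A) := Real.one_le_sqrt.2 (by nlinarith)
  have h2 : 1 ≤ √(1 + a * A) ^ 5 := one_le_pow₀ h1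
  rw [profW', abs_neg, abs_of_pos (by positivity)]
  have h3 : 3 * θ * a ^ 2 / (8 * √(1 + a * A) ^ 5) ≤ 1 / 100000 := by
    rw [div_le_iff₀ (by positivity)]
    nlinarith
  have h4 : 1 / (2 * A * √A) = 5/10 * (1 / (A * √A)) := by field_simp; norm_num
  have h5 : 1 / 90 ≤ 1 / (A * √A) := by
    apply one_div_le_one_div_of_le (by positivity)
    nlinarith
  rw [h4]
  linarith

include hθ

/-- The inverse function of `prof`, with its derivative. -/
theorem exists_prof_inverse :
    ∃ c : ℝ → ℝ, (∀ x ∈ Set.Icc (-(61/10)) (81/100 : ℝ), c x ∈ Set.Icc (1/10) 20 ∧ prof a θ (c x) = x)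
      ∧ (∀ x ∈ Set.Icc (-(61/10)) (81/100 : ℝ), ∀ y ∈ Set.Icc (-(61/10)) (81/100 : ℝ),
        |c y - c x| ≤ 5 * |y - x|)
      ∧ ∀ x ∈ Set.Ioo (-(61/10)) (81/100 : ℝ), HasDerivAt c (-(1 / profW a θ (c x))) x := by
  have hcont : ContinuousOn (prof a θ) (Set.Icc (1/10) 20) := fun A hA =>
    (hasDerivAt_prof ha (by linarith [hA.1])).continuousAt.continuousWithinAt
  have hlo : 81/100 ≤ prof a θ (1/10) := by
    have h1 : √(1 + a * (1/10)) ≤ 101/100 := by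
      rw [Real.sqrt_le_left (by norm_num)]; linarith
    have h2 : √(1/10) ≤ 32/100 := by rw [Real.sqrt_le_left (by norm_num)]; norm_num
    have h3 : 0 < √(1 + a * (1/10)) := by positivity
    have h4 : 148/100 ≤ θ / (2 * √(1 + a * (1/10))) := by
      rw [le_div_iff₀ (by positivity)]; linarith
    rw [prof]; linarith
  have hhi : prof a θ 20 ≤ -(61/10) := by
    have h1 : 1 ≤ √(1 + a * 20) := Real.one_le_sqrt.2 (by linarith)
    have h2 : 44/10 ≤ √20 := by apply Real.le_sqrt_of_sq_le; norm_num
    have h4 : θ / (2 * √(1 + a * 20)) ≤ 26/10 := by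
      rw [div_le_iff₀ (by positivity)]; linarith
    rw [prof]; linarith
  have hex : ∀ x ∈ Set.Icc (-(61/10)) (81/100 : ℝ), ∃ A ∈ Set.Icc (1/10 : ℝ) 20, prof a θ A = x := by
    intro x hx
    have := intermediate_value_Icc' (by norm_num) hcont ⟨hhi.trans hx.1, hx.2.trans hlo⟩
    exact this
  choose! c hc hpc using hex
  have hlip : ∀ x ∈ Set.Icc (-(61/10)) (81/100 : ℝ), ∀ y ∈ Set.Icc (-(61/10)) (81/100 : ℝ),
      |c y - c x| ≤ 5 * |y - x| := by
    intro x hx y hy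
    have hx1 := hc x hx
    have hy1 := hc y hy
    have hx2 := hpc x hx
    have hy2 := hpc y hy
    rcases le_total (c x) (c y) with h | h
    · have := prof_sub_ge ha hθ (by linarith [hx1.1]) h hy1.2
      rw [abs_of_nonneg (by linarith), abs_sub_comm]
      have := le_abs_self (x - y)
      linarith
    · have := prof_sub_ge ha hθ (by linarith [hy1.1]) h hx1.2
      rw [abs_of_nonpos (by linarith)]
      have := le_abs_self (y - x)
      linarith
  refine ⟨c, fun x hx => ⟨hc x hx, hpc x hx⟩, hlip, fun x hx => ?_⟩
  have hxI : x ∈ Set.Icc (-(61/10)) (81/100 : ℝ) := ⟨hx.1.le, hx.2.le⟩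
  have hcpos : 0 < c x := by linarith [(hc x hxI).1]
  have hcc : ContinuousAt c x := by
    have h0 : Tendsto (fun y => 5 * |y - x|) (nhds x) (nhds 0) := by
      have : ContinuousAt (fun y : ℝ => 5 * |y - x|) x := by fun_prop
      simpa [ContinuousAt] using this
    rw [ContinuousAt, tendsto_iff_norm_sub_tendsto_zero]
    refine squeeze_zero' (Eventually.of_forall fun _ => norm_nonneg _) ?_ h0
    filter_upwards [Ioo_mem_nhds hx.1 hx.2] with y hy
    exact hlip x hxI y ⟨hy.1.le, hy.2.le⟩
  have hd := hasDerivAt_prof (θ := θ) ha hcpos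
  have := hd.of_local_left_inverse hcc (neg_ne_zero.2 (profW_pos ha hθ hcpos).ne') (by
    filter_upwards [Ioo_mem_nhds hx.1 hx.2] with y hy
    exact hpc y ⟨hy.1.le, hy.2.le⟩)
  refine this.congr_deriv ?_
  rw [inv_neg, one_div]
end

/-- `g` has two derivatives on `S`, and these are bounded by `K`. -/
def BddC2 (S : Set ℝ) (K : ℝ) (g : ℝ → ℂ) : Prop :=
  ∃ g₁ g₂ : ℝ → ℂ, ∀ x ∈ S, HasDerivAt g (g₁ x) x ∧ HasDerivAt g₁ (g₂ x) x ∧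
    ‖g x‖ ≤ K ∧ ‖g₁ x‖ ≤ K ∧ ‖g₂ x‖ ≤ K

namespace BddC2

variable {S : Set ℝ} {K K' : ℝ} {f g : ℝ → ℂ}

theorem mono (h : BddC2 S K f) (hK : K ≤ K') : BddC2 S K' f := by
  obtain ⟨f₁, f₂, hf⟩ := h
  exact ⟨f₁, f₂, fun x hx => ⟨(hf x hx).1, (hf x hx).2.1, (hf x hx).2.2.1.trans hK,
    (hf x hx).2.2.2.1.trans hK, (hf x hx).2.2.2.2.trans hK⟩⟩

theorem const (c : ℂ) (hK : ‖c‖ ≤ K) : BddC2 S K (fun _ => c) := by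
  have : 0 ≤ K := (norm_nonneg _).trans hK
  exact ⟨fun _ => 0, fun _ => 0, fun x _ => ⟨hasDerivAt_const _ _, hasDerivAt_const _ _, hK,
    by simpa, by simpa⟩⟩

theorem add (hf : BddC2 S K f) (hg : BddC2 S K' g) : BddC2 S (K + K') (fun x => f x + g x) := by
  obtain ⟨f₁, f₂, hf⟩ := hf
  obtain ⟨g₁, g₂, hg⟩ := hg
  refine ⟨fun x => f₁ x + g₁ x, fun x => f₂ x + g₂ x, fun x hx => ?_⟩
  obtain ⟨a1, a2, a3, a4, a5⟩ := hf x hx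
  obtain ⟨b1, b2, b3, b4, b5⟩ := hg x hx
  exact ⟨a1.add b1, a2.add b2, (norm_add_le _ _).trans (add_le_add a3 b3),
    (norm_add_le _ _).trans (add_le_add a4 b4), (norm_add_le _ _).trans (add_le_add a5 b5)⟩

theorem mul (hf : BddC2 S K f) (hg : BddC2 S K' g) (hK : 0 ≤ K) (hK' : 0 ≤ K') :
    BddC2 S (4 * (K * K')) (fun x => f x * g x) := by
  obtain ⟨f₁, f₂, hf⟩ := hf
  obtain ⟨g₁, g₂, hg⟩ := hg
  refine ⟨fun x => f₁ x * g x + f x * g₁ x, fun x => f₂ x * g x + 2 * (f₁ x * g₁ x) + f x * g₂ x,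
    fun x hx => ?_⟩
  obtain ⟨a1, a2, a3, a4, a5⟩ := hf x hx
  obtain ⟨b1, b2, b3, b4, b5⟩ := hg x hx
  have hKK : 0 ≤ K * K' := mul_nonneg hK hK'
  have m : ∀ u v : ℂ, ‖u‖ ≤ K → ‖v‖ ≤ K' → ‖u * v‖ ≤ K * K' := fun u v hu hv => by
    rw [norm_mul]; exact mul_le_mul hu hv (norm_nonneg _) hK
  refine ⟨a1.mul b1, ?_, ?_, ?_, ?_⟩
  · refine ((a2.mul b1).add (a1.mul b2)).congr_deriv ?_
    ring
  · linarith [m _ _ a3 b3]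
  · linarith [norm_add_le (f₁ x * g x) (f x * g₁ x), m _ _ a4 b3, m _ _ a3 b4]
  · have h1 := norm_add_le (f₂ x * g x + 2 * (f₁ x * g₁ x)) (f x * g₂ x)
    have h2 := norm_add_le (f₂ x * g x) (2 * (f₁ x * g₁ x))
    rw [norm_mul 2, Complex.norm_ofNat] at h2
    linarith [m _ _ a5 b3, m _ _ a4 b4, m _ _ a3 b5]

theorem inv (hf : BddC2 S K f) (hK : 1 ≤ K) {m : ℝ} (hm : 0 < m) (hm1 : m ≤ 1)
    (hlow : ∀ x ∈ S, m ≤ ‖f x‖) :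
    BddC2 S (3 * K ^ 2 / m ^ 3) (fun x => (f x)⁻¹) := by
  obtain ⟨f₁, f₂, hf⟩ := hf
  refine ⟨fun x => -f₁ x / f x ^ 2, fun x => 2 * f₁ x ^ 2 / f x ^ 3 - f₂ x / f x ^ 2,
    fun x hx => ?_⟩
  obtain ⟨a1, a2, a3, a4, a5⟩ := hf x hx
  have hl := hlow x hx
  have hpos : 0 < ‖f x‖ := hm.trans_le hl
  have hne : f x ≠ 0 := norm_pos_iff.1 hpos
  have hKK : K ≤ K ^ 2 := by nlinarith
  have i1 : K / ‖f x‖ ^ 2 ≤ K ^ 2 / m ^ 3 := by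
    have : m ^ 3 ≤ ‖f x‖ ^ 2 := (pow_le_pow_of_le_one hm.le hm1 (by norm_num)).trans
      (pow_le_pow_left₀ hm.le hl 2)
    gcongr
  have i0 : 0 ≤ K ^ 2 / m ^ 3 := by positivity
  refine ⟨a1.inv hne, ?_, ?_, ?_, ?_⟩
  · refine (a2.neg.div (a1.pow 2) (pow_ne_zero _ hne)).congr_deriv ?_
    simp only [Pi.neg_apply, Pi.pow_apply]
    field_simp
    push_cast
    ring
  · rw [norm_inv]
    have : m ^ 3 ≤ m := by
      calc m ^ 3 ≤ m ^ 1 := pow_le_pow_of_le_one hm.le hm1 (by norm_num)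
        _ = m := pow_one m
    rw [inv_eq_one_div, div_le_div_iff₀ hpos (by positivity)]
    nlinarith [mul_le_mul hK hK (by norm_num) (by linarith)]
  · rw [norm_div, norm_neg, norm_pow]
    have : ‖f₁ x‖ / ‖f x‖ ^ 2 ≤ K / ‖f x‖ ^ 2 := by gcongr
    have e : 3 * K ^ 2 / m ^ 3 = 3 * (K ^ 2 / m ^ 3) := by ring
    linarith
  · refine (norm_sub_le _ _).trans ?_
    rw [norm_div, norm_div, norm_mul, norm_pow, norm_pow, norm_pow, Complex.norm_ofNat]
    have h1 : ‖f₂ x‖ / ‖f x‖ ^ 2 ≤ K / ‖f x‖ ^ 2 := by gcongr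
    have h2 : 2 * ‖f₁ x‖ ^ 2 / ‖f x‖ ^ 3 ≤ 2 * K ^ 2 / m ^ 3 := by gcongr
    have e : 3 * K ^ 2 / m ^ 3 = K ^ 2 / m ^ 3 + 2 * K ^ 2 / m ^ 3 := by ring
    linarith

theorem conj (hf : BddC2 S K f) : BddC2 S K (fun x => (starRingEnd ℂ) (f x)) := by
  obtain ⟨f₁, f₂, hf⟩ := hf
  refine ⟨fun x => (starRingEnd ℂ) (f₁ x), fun x => (starRingEnd ℂ) (f₂ x), fun x hx => ?_⟩
  obtain ⟨a1, a2, a3, a4, a5⟩ := hf x hx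
  refine ⟨?_, ?_, by simpa, by simpa, by simpa⟩
  · exact Complex.conjCLE.toContinuousLinearMap.hasFDerivAt.comp_hasDerivAt x a1
  · exact Complex.conjCLE.toContinuousLinearMap.hasFDerivAt.comp_hasDerivAt x a2

theorem sqrt_affine {α a : ℝ} (ha : 0 ≤ a) (ha1 : a ≤ 1) (hαa : 4/5 ≤ α + a * (4/5))
    (hα1 : α ≤ 1) :
    BddC2 (Set.Icc (4/5) 7) 3 (fun A : ℝ => ((√(α + a * A) : ℝ) : ℂ)) := by
  refine ⟨fun A => ((a / (2 * √(α + a * A)) : ℝ) : ℂ),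
    fun A => ((-(a ^ 2 / (4 * (α + a * A) * √(α + a * A))) : ℝ) : ℂ), fun A hA => ?_⟩
  have h1 : 4/5 ≤ α + a * A := by nlinarith [hA.1]
  have h2 : α + a * A ≤ 8 := by nlinarith [hA.2]
  have hpos : 0 < α + a * A := by linarith
  have hd : HasDerivAt (fun A : ℝ => α + a * A) a A := by
    simpa using ((hasDerivAt_id A).const_mul a).const_add α
  have hs := hd.sqrt hpos.ne'
  have hb : 8/10 ≤ √(α + a * A) := Real.le_sqrt_of_sq_le (by linarith)
  have hb' : √(α + a * A) ≤ 3 := (Real.sqrt_le_left (by norm_num)).2 (by linarith)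
  have hss : √(α + a * A) ^ 2 = α + a * A := Real.sq_sqrt hpos.le
  refine ⟨hs.ofReal_comp, ?_, ?_, ?_, ?_⟩
  · apply HasDerivAt.ofReal_comp
    refine ((hasDerivAt_const A a).div (hs.const_mul 2) (by linarith)).congr_deriv ?_
    generalize √(α + a * A) = b at *
    rw [← hss]
    field_simp
    ring
  · rw [Complex.norm_real, Real.norm_of_nonneg (by linarith)]; exact hb'
  · rw [Complex.norm_real, Real.norm_of_nonneg (by positivity), div_le_iff₀ (by linarith)]
    nlinarith
  · rw [Complex.norm_real, norm_neg, Real.norm_of_nonneg (by positivity), div_le_iff₀ (by positivity)]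
    nlinarith [mul_le_mul h1 hb (by norm_num) (by linarith)]

end BddC2

theorem hasDerivAt_intervalIntegral_of_continuousOn {f f' : ℝ → ℝ → ℂ} {u v x₀ δ : ℝ} (hδ : 0 < δ)
    (huv : u ≤ v)
    (hf : ∀ x ∈ Set.Icc (x₀ - δ) (x₀ + δ), ∀ A ∈ Set.Icc u v, HasDerivAt (fun x => f x A) (f' x A) x)
    (hfc : ∀ x ∈ Set.Icc (x₀ - δ) (x₀ + δ), ContinuousOn (f x) (Set.Icc u v))
    (hf'c : ContinuousOn (fun p : ℝ × ℝ => f' p.1 p.2) (Set.Icc (x₀ - δ) (x₀ + δ) ×ˢ Set.Icc u v)) :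
    HasDerivAt (fun x => ∫ A in u..v, f x A) (∫ A in u..v, f' x₀ A) x₀ := by
  obtain ⟨B, hB⟩ := (isCompact_Icc.prod isCompact_Icc).exists_bound_of_continuousOn hf'c
  have hx₀ : x₀ ∈ Set.Icc (x₀ - δ) (x₀ + δ) := ⟨by linarith, by linarith⟩
  have hmem : Set.Icc (x₀ - δ) (x₀ + δ) ∈ nhds x₀ := Icc_mem_nhds (by linarith) (by linarith)
  have hsub : Set.uIoc u v ⊆ Set.Icc u v := by rw [Set.uIoc_of_le huv]; exact Set.Ioc_subset_Icc_self
  have hme : ∀ g : ℝ → ℂ, ContinuousOn g (Set.Icc u v) →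
      AEStronglyMeasurable g (volume.restrict (Set.uIoc u v)) := fun g hg =>
    (hg.mono hsub).aestronglyMeasurable measurableSet_uIoc
  refine (intervalIntegral.hasDerivAt_integral_of_dominated_loc_of_deriv_le
    (bound := fun _ => B) hmem ?_ ?_ ?_ ?_ ?_ ?_).2
  · filter_upwards [hmem] with x hx
    exact hme _ (hfc x hx)
  · exact (hfc x₀ hx₀).intervalIntegrable_of_Icc huv
  · refine hme _ (hf'c.comp (f := fun A => (x₀, A)) (by fun_prop) fun A hA => ⟨hx₀, hA⟩)
  · exact ae_of_all _ fun A hA x hx => hB (x, A) ⟨hx, hsub hA⟩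
  · exact intervalIntegrable_const
  · exact ae_of_all _ fun A hA x hx => hf x hx A (hsub hA)

/-- Integration by parts against a factor vanishing at the endpoints. -/
theorem integral_deriv_mul_eq_neg {u v : ℝ} (huv : u ≤ v) {f f₁ g g₁ : ℝ → ℂ}
    (hf : ∀ x ∈ Set.Icc u v, HasDerivAt f (f₁ x) x) (hg : ∀ x ∈ Set.Icc u v, HasDerivAt g (g₁ x) x)
    (hf₁ : ContinuousOn f₁ (Set.Icc u v)) (hg₁ : ContinuousOn g₁ (Set.Icc u v))
    (hu : g u = 0) (hv : g v = 0) :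
    ∫ x in u..v, f₁ x * g x = -∫ x in u..v, f x * g₁ x := by
  have h := intervalIntegral.integral_mul_deriv_eq_deriv_mul (u := g) (v := f) (a := u) (b := v)
    (by rwa [Set.uIcc_of_le huv]) (by rwa [Set.uIcc_of_le huv])
    (hg₁.intervalIntegrable_of_Icc huv) (hf₁.intervalIntegrable_of_Icc huv)
  rw [hu, hv, zero_mul, zero_mul, sub_zero, zero_sub] at h
  simp only [mul_comm (g _), mul_comm (g₁ _)] at h
  exact h

/-- Minus the difference quotient of `prof`. -/
noncomputable def profSlope (a θ c A : ℝ) : ℝ :=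
  θ * a / (2 * √(1 + a * c)) * (√(1 + a * A))⁻¹ * (√(1 + a * A) + √(1 + a * c))⁻¹
    + 2 * (√A + √c)⁻¹

theorem prof_sub_eq {a θ c A : ℝ} (ha : 0 < a) (hc : 0 < c) (hA : 0 < A) :
    prof a θ A - prof a θ c = -((A - c) * profSlope a θ c A) := by
  have h1 : √(1 + a * A) ^ 2 = 1 + a * A := Real.sq_sqrt (by positivity)
  have h2 : √(1 + a * c) ^ 2 = 1 + a * c := Real.sq_sqrt (by positivity)
  have h3 : √A ^ 2 = A := Real.sq_sqrt hA.le
  have h4 : √c ^ 2 = c := Real.sq_sqrt hc.le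
  have p1 : 0 < √(1 + a * A) := by positivity
  have p2 : 0 < √(1 + a * c) := by positivity
  have p3 : 0 < √A := Real.sqrt_pos.2 hA
  have p4 : 0 < √c := Real.sqrt_pos.2 hc
  rw [prof, prof, profSlope]
  have e1 : θ / (2 * √(1 + a * A)) - θ / (2 * √(1 + a * c))
      = -((A - c) * (θ * a / (2 * √(1 + a * c)) * (√(1 + a * A))⁻¹ * (√(1 + a * A) + √(1 + a * c))⁻¹)) := by
    generalize √(1 + a * A) = u at *
    generalize √(1 + a * c) = v at *
    have : a * (A - c) = u ^ 2 - v ^ 2 := by rw [h1, h2]; ring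
    have e : (A - c) * (θ * a / (2 * v) * u⁻¹ * (u + v)⁻¹) = θ * (a * (A - c)) / (2 * v) * u⁻¹ * (u + v)⁻¹ := by
      ring
    rw [e, this]
    field_simp
    ring
  have e2 : 2 * √A - 2 * √c = (A - c) * (2 * (√A + √c)⁻¹) := by
    have : A - c = √A ^ 2 - √c ^ 2 := by rw [h3, h4]
    rw [this]
    field_simp
    ring
  linear_combination e1 - e2

theorem exists_inv_profSlope_bound : ∃ K : ℝ, 0 ≤ K ∧ ∀ a θ c : ℝ, 0 < a → a ≤ 1/1000 → 0 ≤ θ →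
    θ ≤ 51/10 → 1/10 ≤ c → c ≤ 20 →
    BddC2 (Set.Icc (4/5) 7) K (fun A => (((profSlope a θ c A)⁻¹ : ℝ) : ℂ)) := by
  refine ⟨3 * 33936 ^ 2 / (1/4) ^ 3, by norm_num, fun a θ c ha ha' hθ hθ' hc hc' => ?_⟩
  have q1 : 1 ≤ √(1 + a * c) := Real.one_le_sqrt.2 (by nlinarith)
  have q2 : √(1 + a * c) ≤ 2 := (Real.sqrt_le_left (by norm_num)).2 (by nlinarith)
  have q3 : 3/10 ≤ √c := Real.le_sqrt_of_sq_le (by linarith)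
  have q4 : √c ≤ 5 := (Real.sqrt_le_left (by norm_num)).2 (by nlinarith)
  have b1 := BddC2.sqrt_affine (α := 1) (a := a) ha.le (by linarith) (by nlinarith) le_rfl
  have b2 := BddC2.sqrt_affine (α := 0) (a := 1) zero_le_one le_rfl (by norm_num) zero_le_one
  simp only [zero_add, one_mul] at b2
  have l1 : ∀ A ∈ Set.Icc (4/5:ℝ) 7, 1 ≤ √(1 + a * A) := fun A hA =>
    Real.one_le_sqrt.2 (by nlinarith [hA.1])
  have l2 : ∀ A ∈ Set.Icc (4/5:ℝ) 7, 8/10 ≤ √A := fun A hA =>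
    Real.le_sqrt_of_sq_le (by linarith [hA.1])
  have l3 : ∀ A ∈ Set.Icc (4/5:ℝ) 7, √A ≤ 27/10 := fun A hA =>
    (Real.sqrt_le_left (by norm_num)).2 (by linarith [hA.2])
  have c1 := b1.inv (by norm_num) one_pos le_rfl (fun A hA => by
    rw [Complex.norm_real, Real.norm_of_nonneg (by positivity)]; exact l1 A hA)
  have c2 := (b1.add (BddC2.const (K := 2) ((√(1 + a * c) : ℝ) : ℂ) (by
    rw [Complex.norm_real, Real.norm_of_nonneg (by positivity)]; exact q2))).inv (by norm_num)
    one_pos le_rfl (fun A hA => by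
      rw [← Complex.ofReal_add, Complex.norm_real, Real.norm_of_nonneg (by positivity)]
      linarith [l1 A hA])
  have c3 := (b2.add (BddC2.const (K := 5) ((√c : ℝ) : ℂ) (by
    rw [Complex.norm_real, Real.norm_of_nonneg (by positivity)]; exact q4))).inv (by norm_num)
    one_pos le_rfl (fun A hA => by
      rw [← Complex.ofReal_add, Complex.norm_real, Real.norm_of_nonneg (by positivity)]
      linarith [l2 A hA])
  have d0 : ‖((θ * a / (2 * √(1 + a * c)) : ℝ) : ℂ)‖ ≤ 1 := by
    rw [Complex.norm_real, Real.norm_of_nonneg (by positivity), div_le_one (by positivity)]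
    nlinarith
  have d1 := (((BddC2.const (S := Set.Icc (4/5:ℝ) 7) _ d0).mul c1 (by norm_num) (by norm_num)).mul c2
    (by norm_num) (by norm_num)).add
    ((BddC2.const (S := Set.Icc (4/5:ℝ) 7) (K := 2) (2:ℂ) (by simp)).mul c3 (by norm_num) (by norm_num))
  have d2 : BddC2 (Set.Icc (4/5) 7) 33936 (fun A => ((profSlope a θ c A : ℝ) : ℂ)) := by
    have := d1.mono (K' := 33936) (by norm_num)
    convert this using 2 with A
    rw [profSlope]
    push_cast
    rfl
  have d3 := d2.inv (by norm_num) (m := 1/4) (by norm_num) (by norm_num) (fun A hA => by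
    have h2 : 1/8 ≤ (√A + √c)⁻¹ := by
      rw [inv_eq_one_div]
      exact one_div_le_one_div_of_le (by linarith [l2 A hA]) (by linarith [l3 A hA])
    have : 1/4 ≤ profSlope a θ c A := by
      rw [profSlope]
      have : 0 ≤ θ * a / (2 * √(1 + a * c)) * (√(1 + a * A))⁻¹ * (√(1 + a * A) + √(1 + a * c))⁻¹ := by
        positivity
      linarith
    rw [Complex.norm_real, Real.norm_of_nonneg (by linarith)]
    exact this)
  convert d3 using 2 with A
  push_cast
  rfl

/-- The `A`-integral `∫ e^{iμ(profInt A - x A)} q(A) dA`. -/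
noncomputable def profIntegral (a θ : ℝ) (q : ℝ → ℂ) (μ x : ℝ) : ℂ :=
  ∫ A in (4/5:ℝ)..7, Complex.exp (I * ((μ * (profInt a θ A - x * A) : ℝ) : ℂ)) * q A

section
variable {a θ : ℝ} (ha : 0 < a)
include ha

theorem hasDerivAt_profPhase (μ x : ℝ) {A : ℝ} (hA : 0 < A) :
    HasDerivAt (fun A => μ * (profInt a θ A - x * A)) (μ * (prof a θ A - x)) A := by
  have h := ((hasDerivAt_profInt (θ := θ) ha hA).sub ((hasDerivAt_id A).const_mul x)).const_mul μ
  refine h.congr_deriv ?_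
  ring

theorem hasDerivAt_profPhase' (μ x : ℝ) {A : ℝ} (hA : 0 < A) :
    HasDerivAt (fun A => μ * (prof a θ A - x)) (μ * (-profW a θ A)) A :=
  ((hasDerivAt_prof (θ := θ) ha hA).sub_const x).const_mul μ

variable (hθ : 3 ≤ θ)
include hθ

theorem norm_profIntegral_le {g : ℝ → ℂ} {G μ x : ℝ} (hμ : 0 < μ)
    (hg : ∀ A ∈ Set.Icc (4/5:ℝ) 7, DifferentiableAt ℝ g A)
    (hgb : ∀ A ∈ Set.Icc (4/5:ℝ) 7, ‖g A‖ ≤ G) (hgd : ∀ A ∈ Set.Icc (4/5:ℝ) 7, ‖deriv g A‖ ≤ G) :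
    ‖profIntegral a θ g μ x‖ ≤ 150 * G / √μ := by
  have hpos : ∀ A ∈ Set.Icc (4/5:ℝ) 7, 0 < A := fun A hA => by linarith [hA.1]
  have hG : 0 ≤ G := (norm_nonneg _).trans (hgb 1 ⟨by norm_num, by norm_num⟩)
  have h := norm_oscillatory_le_of_second_deriv (a := 4/5) (b := 7) (by norm_num) (ρ := μ / 4)
    (ε := -1) (by positivity) (Or.inr rfl)
    (fun A hA => hasDerivAt_profPhase (θ := θ) ha μ x (hpos A hA))
    (fun A hA => hasDerivAt_profPhase' (θ := θ) ha μ x (hpos A hA))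
    (fun A hA => (((hasDerivAt_profW (θ := θ) ha (hpos A hA)).continuousAt).neg.const_mul μ).continuousWithinAt)
    (fun A hA => by
      have h1 := one_div_sqrt_le_profW ha hθ (hpos A hA)
      have h2 : √A ≤ 3 := (Real.sqrt_le_left (by norm_num)).2 (by linarith [hA.2])
      have h3 : 1 / 3 ≤ 1 / √A := one_div_le_one_div_of_le (Real.sqrt_pos.2 (hpos A hA)) h2
      nlinarith) hg hgb hgd
  refine h.trans ?_
  have h4 : √(μ / 4) = √μ / 2 := by
    rw [Real.sqrt_div hμ.le, show (4:ℝ) = 2 ^ 2 by norm_num, Real.sqrt_sq (by norm_num)]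
  have := Real.sqrt_pos.2 hμ
  rw [h4, div_le_div_iff₀ (by positivity) this]
  nlinarith [mul_nonneg hG this.le]

omit hθ in
theorem hasDerivAt_profIntegral {q : ℝ → ℂ} (hq : ContinuousOn q (Set.Icc (4/5) 7)) (μ x : ℝ) :
    HasDerivAt (profIntegral a θ q μ)
      (∫ A in (4/5:ℝ)..7, Complex.exp (I * ((μ * (profInt a θ A - x * A) : ℝ) : ℂ)) *
        (-(I * μ * A) * q A)) x := by
  have hc : ContinuousOn (profInt a θ) (Set.Icc (4/5) 7) := fun A hA =>
    (hasDerivAt_profInt ha (by linarith [hA.1])).continuousAt.continuousWithinAt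
  refine hasDerivAt_intervalIntegral_of_continuousOn (δ := 1)
    (f := fun x A => Complex.exp (I * ((μ * (profInt a θ A - x * A) : ℝ) : ℂ)) * q A)
    (f' := fun x A => Complex.exp (I * ((μ * (profInt a θ A - x * A) : ℝ) : ℂ)) * (-(I * μ * A) * q A))
    one_pos (by norm_num) ?_ ?_ ?_
  · intro y _ A _
    have h1 : HasDerivAt (fun y : ℝ => I * ((μ * (profInt a θ A - y * A) : ℝ) : ℂ)) (-(I * μ * A)) y := by
      have h := (((hasDerivAt_id y).mul_const A).const_sub (profInt a θ A)).const_mul μ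
      refine (h.ofReal_comp.const_mul I).congr_deriv ?_
      push_cast
      ring
    refine (h1.cexp.mul_const (q A)).congr_deriv ?_
    ring
  · intro y _
    have : ContinuousOn (fun A => ((μ * (profInt a θ A - y * A) : ℝ) : ℂ)) (Set.Icc (4/5) 7) :=
      Complex.continuous_ofReal.comp_continuousOn
        (continuousOn_const.mul (hc.sub (by fun_prop)))
    exact (Complex.continuous_exp.comp_continuousOn (continuousOn_const.mul this)).mul hq
  · have hsnd : Set.MapsTo (Prod.snd : ℝ × ℝ → ℝ) (Set.Icc (x - 1) (x + 1) ×ˢ Set.Icc (4/5) 7)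
        (Set.Icc (4/5) 7) := fun p hp => hp.2
    have h1 := hc.comp continuousOn_snd hsnd
    have h2 := hq.comp continuousOn_snd hsnd
    have : ContinuousOn (fun p : ℝ × ℝ => ((μ * (profInt a θ p.2 - p.1 * p.2) : ℝ) : ℂ))
        (Set.Icc (x - 1) (x + 1) ×ˢ Set.Icc (4/5) 7) :=
      Complex.continuous_ofReal.comp_continuousOn
        (continuousOn_const.mul (h1.sub (by fun_prop)))
    exact (Complex.continuous_exp.comp_continuousOn (continuousOn_const.mul this)).mul
      (ContinuousOn.mul (by fun_prop) h2)
end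

/-- The integral `profIntegral` with its stationary phase at the point `c x` removed. -/
noncomputable def profAmp (a θ : ℝ) (c : ℝ → ℝ) (q : ℝ → ℂ) (μ x : ℝ) : ℂ :=
  Complex.exp (-(I * ((μ * (profInt a θ (c x) - x * c x) : ℝ) : ℂ))) * profIntegral a θ q μ x

theorem norm_exp_neg_I_mul_ofReal (x : ℝ) : ‖Complex.exp (-(I * (x : ℂ)))‖ = 1 := by
  rw [show -(I * (x : ℂ)) = ((-x : ℝ) : ℂ) * I by push_cast; ring]
  exact Complex.norm_exp_ofReal_mul_I _

theorem exists_profAmp_bound {K : ℝ} (hK : 0 ≤ K) : ∃ C : ℝ, 0 ≤ C ∧ ∀ (a θ : ℝ) (c : ℝ → ℝ) (q : ℝ → ℂ)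
    (μ x c' : ℝ), 0 < a → a ≤ 1/1000 → 3 ≤ θ → θ ≤ 51/10 → 0 < μ → c x ∈ Set.Icc (1/10) 20 →
    prof a θ (c x) = x → HasDerivAt c c' x → BddC2 (Set.Icc (4/5) 7) K q → q (4/5) = 0 → q 7 = 0 →
    ‖profAmp a θ c q μ x‖ ≤ C / √μ ∧ ∃ F' : ℂ, HasDerivAt (profAmp a θ c q μ) F' x ∧
      ‖F'‖ ≤ C / √μ := by
  obtain ⟨K', hK', hs⟩ := exists_inv_profSlope_bound
  refine ⟨150 * K + 150 * (4 * (K * K')), by positivity,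
    fun a θ c q μ x c' ha ha' hθ hθ' hμ hc hcx hcd hq q1 q2 => ?_⟩
  have hQ := hq.mul (hs a θ (c x) ha ha' (by linarith) hθ' hc.1 hc.2) hK hK'
  have hc0 : 0 < c x := by linarith [hc.1]
  obtain ⟨g₁, g₂, hg⟩ := hq
  obtain ⟨Q₁, Q₂, hQ⟩ := hQ
  have hpos : ∀ A ∈ Set.Icc (4/5:ℝ) 7, 0 < A := fun A hA => by linarith [hA.1]
  have hsq := Real.sqrt_pos.2 hμ
  have hb := norm_profIntegral_le (g := q) (G := K) (x := x) ha hθ hμ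
    (fun A hA => (hg A hA).1.differentiableAt) (fun A hA => (hg A hA).2.2.1)
    (fun A hA => by rw [(hg A hA).1.deriv]; exact (hg A hA).2.2.2.1)
  have hb1 := norm_profIntegral_le (g := Q₁) (G := 4 * (K * K')) (x := x) ha hθ hμ
    (fun A hA => (hQ A hA).2.1.differentiableAt) (fun A hA => (hQ A hA).2.2.2.1)
    (fun A hA => by rw [(hQ A hA).2.1.deriv]; exact (hQ A hA).2.2.2.2)
  have hqc : ContinuousOn q (Set.Icc (4/5) 7) := fun A hA => (hg A hA).1.continuousAt.continuousWithinAt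
  have hPc : ContinuousOn (profInt a θ) (Set.Icc (4/5) 7) := fun A hA =>
    (hasDerivAt_profInt ha (hpos A hA)).continuousAt.continuousWithinAt
  have hpc : ContinuousOn (prof a θ) (Set.Icc (4/5) 7) := fun A hA =>
    (hasDerivAt_prof (θ := θ) ha (hpos A hA)).continuousAt.continuousWithinAt
  have hec : ContinuousOn (fun A => Complex.exp (I * ((μ * (profInt a θ A - x * A) : ℝ) : ℂ)))
      (Set.Icc (4/5) 7) := by
    have : ContinuousOn (fun A => ((μ * (profInt a θ A - x * A) : ℝ) : ℂ)) (Set.Icc (4/5) 7) :=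
      Complex.continuous_ofReal.comp_continuousOn
        (continuousOn_const.mul (hPc.sub (by fun_prop)))
    exact Complex.continuous_exp.comp_continuousOn (continuousOn_const.mul this)
  have hibp : ∫ A in (4/5:ℝ)..7, Complex.exp (I * ((μ * (profInt a θ A - x * A) : ℝ) : ℂ)) *
      (-(I * μ * (A - c x)) * q A) = -profIntegral a θ Q₁ μ x := by
    have h := integral_deriv_mul_eq_neg (u := 4/5) (v := 7) (by norm_num)
      (f := fun A => Complex.exp (I * ((μ * (profInt a θ A - x * A) : ℝ) : ℂ)))
      (f₁ := fun A => Complex.exp (I * ((μ * (profInt a θ A - x * A) : ℝ) : ℂ)) *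
        (I * ((μ * (prof a θ A - x) : ℝ) : ℂ)))
      (g := fun A => q A * (((profSlope a θ (c x) A)⁻¹ : ℝ) : ℂ)) (g₁ := Q₁)
      (fun A hA => ((hasDerivAt_profPhase (θ := θ) ha μ x (hpos A hA)).ofReal_comp.const_mul I).cexp)
      (fun A hA => (hQ A hA).1)
      (hec.mul (continuousOn_const.mul (Complex.continuous_ofReal.comp_continuousOn
        (continuousOn_const.mul (hpc.sub continuousOn_const)))))
      (fun A hA => (hQ A hA).2.1.continuousAt.continuousWithinAt) (by simp [q1]) (by simp [q2])
    rw [profIntegral, ← h]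
    refine intervalIntegral.integral_congr fun A hA => ?_
    rw [Set.uIcc_of_le (by norm_num)] at hA
    have hA0 := hpos A hA
    have e := prof_sub_eq (θ := θ) ha hc0 hA0
    rw [hcx] at e
    have hspos : profSlope a θ (c x) A ≠ 0 := by
      have : 0 < profSlope a θ (c x) A := by
        rw [profSlope]
        have := Real.sqrt_pos.2 hA0
        positivity
      exact this.ne'
    have hsc : ((profSlope a θ (c x) A : ℝ) : ℂ) ≠ 0 := by exact_mod_cast hspos
    simp only [e]
    push_cast
    field_simp
  have h_int1 : IntervalIntegrable (fun A => Complex.exp (I * ((μ * (profInt a θ A - x * A) : ℝ) : ℂ)) * q A)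
      volume (4/5) 7 :=
    ContinuousOn.intervalIntegrable (by rw [Set.uIcc_of_le (by norm_num)]; exact hec.mul hqc)
  have h_int2 : IntervalIntegrable (fun A : ℝ => Complex.exp (I * ((μ * (profInt a θ A - x * A) : ℝ) : ℂ)) *
      (-(I * μ * A) * q A)) volume (4/5) 7 :=
    ContinuousOn.intervalIntegrable (by
      rw [Set.uIcc_of_le (by norm_num)]; exact hec.mul (ContinuousOn.mul (by fun_prop) hqc))
  constructor
  · rw [profAmp, norm_mul, norm_exp_neg_I_mul_ofReal, one_mul]
    refine hb.trans ?_
    gcongr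
    have := mul_nonneg hK hK'
    linarith
  · have hP : HasDerivAt (fun x => μ * (profInt a θ (c x) - x * c x)) (-(μ * c x)) x := by
      have h1 : HasDerivAt (fun x => profInt a θ (c x)) (prof a θ (c x) * c') x :=
        (hasDerivAt_profInt (θ := θ) ha hc0).comp x hcd
      refine ((h1.sub ((hasDerivAt_id x).mul hcd)).const_mul μ).congr_deriv ?_
      rw [hcx]
      simp
    have hF := ((hP.ofReal_comp.const_mul I).neg.cexp).mul
      (hasDerivAt_profIntegral (θ := θ) ha hqc μ x)
    refine ⟨_, hF, ?_⟩
    have : Complex.exp (-(I * ((μ * (profInt a θ (c x) - x * c x) : ℝ) : ℂ))) *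
          (-(I * ((-(μ * c x) : ℝ) : ℂ))) * profIntegral a θ q μ x +
        Complex.exp (-(I * ((μ * (profInt a θ (c x) - x * c x) : ℝ) : ℂ))) *
        ∫ A in (4/5:ℝ)..7, Complex.exp (I * ((μ * (profInt a θ A - x * A) : ℝ) : ℂ)) *
        (-(I * μ * A) * q A)
        = Complex.exp (-(I * ((μ * (profInt a θ (c x) - x * c x) : ℝ) : ℂ))) *
        -profIntegral a θ Q₁ μ x := by
      rw [← hibp, mul_assoc, ← mul_add, profIntegral, ← intervalIntegral.integral_const_mul,
        ← intervalIntegral.integral_add (h_int1.const_mul _) h_int2]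
      congr 1
      refine intervalIntegral.integral_congr fun A _ => ?_
      push_cast
      ring
    refine (congrArg norm this).trans_le ?_
    rw [norm_mul, norm_exp_neg_I_mul_ofReal, one_mul, norm_neg]
    refine hb1.trans ?_
    gcongr
    linarith

theorem profIntegral_eq (a θ : ℝ) (c : ℝ → ℝ) (q : ℝ → ℂ) (μ x : ℝ) :
    profIntegral a θ q μ x =
      Complex.exp (I * ((μ * (profInt a θ (c x) - x * c x) : ℝ) : ℂ)) * profAmp a θ c q μ x := by
  rw [profAmp, ← mul_assoc, ← Complex.exp_add, add_neg_cancel, Complex.exp_zero, one_mul]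

theorem norm_profIntegral_le_of_large {a θ : ℝ} (ha : 0 < a) (hθ : 3 ≤ θ) (hθ' : θ ≤ 51/10) {g : ℝ → ℂ} {G μ x : ℝ}
    (hμ : 0 < μ) (hx : 4/5 ≤ x)
    (hg : ∀ A ∈ Set.Icc (4/5:ℝ) 7, DifferentiableAt ℝ g A)
    (hgb : ∀ A ∈ Set.Icc (4/5:ℝ) 7, ‖g A‖ ≤ G) (hgd : ∀ A ∈ Set.Icc (4/5:ℝ) 7, ‖deriv g A‖ ≤ G) :
    ‖profIntegral a θ g μ x‖ ≤ 500 * G / (μ * x) := by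
  have hpos : ∀ A ∈ Set.Icc (4/5:ℝ) 7, 0 < A := fun A hA => by linarith [hA.1]
  have hG : 0 ≤ G := (norm_nonneg _).trans (hgb 1 ⟨by norm_num, by norm_num⟩)
  have hx0 : 0 < x := by linarith
  have hlow : ∀ A ∈ Set.Icc (4/5:ℝ) 7, x / 25 ≤ x - prof a θ A := fun A hA => by
    have h1 : 1 ≤ √(1 + a * A) := Real.one_le_sqrt.2 (by nlinarith [hpos A hA])
    have h2 : 8925/10000 ≤ √A := Real.le_sqrt_of_sq_le (by linarith [hA.1])
    have h3 : θ / (2 * √(1 + a * A)) ≤ (51/10) / 2 := by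
      gcongr
      linarith
    rw [prof]
    linarith
  have h := norm_oscillatory_le_of_monotone (a := 4/5) (b := 7) (by norm_num) (ρ := μ * (x / 25))
    (ε := -1) (by positivity) (Or.inr rfl)
    (fun A hA => hasDerivAt_profPhase (θ := θ) ha μ x (hpos A hA))
    (fun A hA => hasDerivAt_profPhase' (θ := θ) ha μ x (hpos A hA))
    (fun A hA => (((hasDerivAt_profW (θ := θ) ha (hpos A hA)).continuousAt).neg.const_mul μ).continuousWithinAt)
    (fun A hA => by
      rw [abs_mul, abs_of_pos hμ, abs_sub_comm]
      exact mul_le_mul_of_nonneg_left ((hlow A hA).trans (le_abs_self _)) hμ.le)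
    (fun A hA => by nlinarith [profW_pos ha hθ (hpos A hA)]) hg hgb hgd
  refine h.trans ?_
  rw [div_le_div_iff₀ (by positivity) (by positivity)]
  have : 0 ≤ G * (μ * x) := by positivity
  nlinarith

/-- A smooth function `g σ Υ` vanishing to second order at `Υ = ±3`, with bounded derivatives. -/
structure SmoothSlice (K : ℝ) (g gσ gΥ gσΥ gΥΥ : ℝ → ℝ → ℂ) : Prop where
  hΥ : ∀ σ Υ, HasDerivAt (g σ) (gΥ σ Υ) Υ
  hΥΥ : ∀ σ Υ, HasDerivAt (gΥ σ) (gΥΥ σ Υ) Υ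
  hσ : ∀ σ Υ, HasDerivAt (fun σ => g σ Υ) (gσ σ Υ) σ
  hσΥ : ∀ σ Υ, HasDerivAt (gσ σ) (gσΥ σ Υ) Υ
  cont : Continuous (fun p : ℝ × ℝ => g p.1 p.2)
  contσ : Continuous (fun p : ℝ × ℝ => gσ p.1 p.2)
  contΥΥ : ∀ σ, Continuous (gΥΥ σ)
  bound : ∀ σ ∈ Set.Icc (0:ℝ) 6, ∀ Υ ∈ Set.Icc (-3:ℝ) 3, ‖g σ Υ‖ ≤ K ∧ ‖gσ σ Υ‖ ≤ K ∧
    ‖gΥ σ Υ‖ ≤ K ∧ ‖gσΥ σ Υ‖ ≤ K ∧ ‖gΥΥ σ Υ‖ ≤ K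
  left : ∀ σ, g σ (-3) = 0 ∧ gΥ σ (-3) = 0
  right : ∀ σ, g σ 3 = 0 ∧ gΥ σ 3 = 0

/-- The quadratic phase of the `Υ`-integral, with critical value removed. -/
noncomputable def sliceExp (ν d σ Υ : ℝ) : ℂ :=
  Complex.exp (I * ((ν * (σ * (Υ - (σ/2 + d/(2*σ)))^2) : ℝ) : ℂ))

/-- The `Υ`-integral with critical value of the phase removed. -/
noncomputable def sliceInt (g : ℝ → ℝ → ℂ) (ν d σ : ℝ) : ℂ :=
  ∫ Υ in (-3:ℝ)..3, sliceExp ν d σ Υ * g σ Υ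

theorem norm_integral_sliceExp_le {ν σ G : ℝ} (hν : 0 < ν) (hσ : 0 < σ) (d : ℝ) {g : ℝ → ℂ}
    (hg : ∀ A ∈ Set.Icc (-3:ℝ) 3, DifferentiableAt ℝ g A)
    (hgb : ∀ A ∈ Set.Icc (-3:ℝ) 3, ‖g A‖ ≤ G) (hgd : ∀ A ∈ Set.Icc (-3:ℝ) 3, ‖deriv g A‖ ≤ G) :
    ‖∫ Υ in (-3:ℝ)..3, sliceExp ν d σ Υ * g Υ‖ ≤ 70 * G / √(ν * σ) := by
  have hG : 0 ≤ G := (norm_nonneg _).trans (hgb 1 ⟨by norm_num, by norm_num⟩)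
  have h := norm_oscillatory_le_of_second_deriv (a := -3) (b := 3) (by norm_num) (ρ := 2 * (ν * σ))
    (ε := 1) (φ := fun Υ => ν * (σ * (Υ - (σ/2 + d/(2*σ)))^2))
    (φ₁ := fun Υ => ν * (σ * (2 * (Υ - (σ/2 + d/(2*σ)))))) (φ₂ := fun _ => 2 * (ν * σ))
    (by positivity) (Or.inl rfl)
    (fun A _ => by
      have := ((((hasDerivAt_id A).sub_const (σ/2 + d/(2*σ))).pow 2).const_mul σ).const_mul ν
      refine this.congr_deriv ?_
      simp)
    (fun A _ => by
      have := ((((hasDerivAt_id A).sub_const (σ/2 + d/(2*σ))).const_mul 2).const_mul σ).const_mul ν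
      refine this.congr_deriv ?_
      ring) continuousOn_const (fun A _ => by simp) hg hgb hgd
  refine h.trans ?_
  have h1 : √(ν * σ) ≤ √(2 * (ν * σ)) := Real.sqrt_le_sqrt (by nlinarith [mul_pos hν hσ])
  have h2 : 0 < √(ν * σ) := Real.sqrt_pos.2 (mul_pos hν hσ)
  calc 10 * (G + G * (3 - -3)) / √(2 * (ν * σ)) = 70 * G / √(2 * (ν * σ)) := by ring
    _ ≤ 70 * G / √(ν * σ) := by gcongr

namespace SmoothSlice

variable {K : ℝ} {g gσ gΥ gσΥ gΥΥ : ℝ → ℝ → ℂ} (h : SmoothSlice K g gσ gΥ gσΥ gΥΥ)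
include h

theorem norm_sliceInt_le {ν σ : ℝ} (hν : 0 < ν) (hσ : 0 < σ) (hσ' : σ ≤ 6) (d : ℝ) :
    ‖sliceInt g ν d σ‖ ≤ 70 * K / √(ν * σ) :=
  norm_integral_sliceExp_le hν hσ d (fun A _ => (h.hΥ σ A).differentiableAt)
    (fun A hA => (h.bound σ ⟨hσ.le, hσ'⟩ A hA).1)
    (fun A hA => by rw [(h.hΥ σ A).deriv]; exact (h.bound σ ⟨hσ.le, hσ'⟩ A hA).2.2.1)

theorem hasDerivAt_sliceInt {ν σ : ℝ} (hσ : 0 < σ) (d : ℝ) :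
    HasDerivAt (sliceInt g ν d) (∫ Υ in (-3:ℝ)..3, sliceExp ν d σ Υ *
      (I * ν * (Υ - (σ/2 + d/(2*σ)) : ℝ) * (Υ + (σ/2 + d/(2*σ)) - 2 * σ : ℝ) * g σ Υ + gσ σ Υ)) σ := by
  have hne : ∀ p ∈ Set.Icc (σ - σ/2) (σ + σ/2) ×ˢ Set.Icc (-3:ℝ) 3, 2 * p.1 ≠ 0 := fun p hp => by
    have := hp.1.1
    linarith
  refine hasDerivAt_intervalIntegral_of_continuousOn (δ := σ/2)
    (f := fun σ Υ => sliceExp ν d σ Υ * g σ Υ)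
    (f' := fun σ Υ => sliceExp ν d σ Υ *
      (I * ν * (Υ - (σ/2 + d/(2*σ)) : ℝ) * (Υ + (σ/2 + d/(2*σ)) - 2 * σ : ℝ) * g σ Υ + gσ σ Υ))
    (by linarith) (by norm_num) ?_ ?_ ?_
  · intro s hs Υ _
    have hs0 : 0 < s := by linarith [hs.1]
    have h1 : HasDerivAt (fun s : ℝ => Υ - (s/2 + d/(2*s))) (-(1/2 - d/(2*s^2))) s := by
      have e := (((hasDerivAt_id s).div_const 2).add
        ((hasDerivAt_const s d).div ((hasDerivAt_id s).const_mul 2) (by simpa using hs0.ne'))).const_sub Υ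
      refine e.congr_deriv ?_
      simp
      field_simp
      ring
    have h2 := (((hasDerivAt_id s).mul (h1.pow 2)).const_mul ν).ofReal_comp.const_mul I
    have h3 := h2.cexp.mul (h.hσ s Υ)
    refine h3.congr_deriv ?_
    simp only [Pi.mul_apply, Pi.pow_apply, id, sliceExp]
    have hsc : (s:ℂ) ≠ 0 := by exact_mod_cast hs0.ne'
    rw [mul_add, mul_assoc, mul_assoc]
    push_cast
    field_simp
    ring
  · intro s _
    have := h.cont.comp (Continuous.prodMk (continuous_const (y := s)) continuous_id)
    refine Continuous.continuousOn (Continuous.mul ?_ this)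
    unfold sliceExp
    fun_prop
  · have e : ContinuousOn (fun p : ℝ × ℝ => p.1/2 + d/(2*p.1))
      (Set.Icc (σ - σ/2) (σ + σ/2) ×ˢ Set.Icc (-3:ℝ) 3) :=
      ContinuousOn.add (by fun_prop) (ContinuousOn.div (by fun_prop) (by fun_prop) hne)
    unfold sliceExp
    refine ContinuousOn.mul ?_ (ContinuousOn.add (ContinuousOn.mul ?_ h.cont.continuousOn) h.contσ.continuousOn)
    · fun_prop
    · fun_prop

theorem exists_hasDerivAt_sliceInt {ν σ : ℝ} (hν : 0 < ν) (hσ : 0 < σ) (hσ' : σ ≤ 6) (d : ℝ)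
    (hνσ : 1/2 ≤ ν * σ) :
    ∃ D', HasDerivAt (sliceInt g ν d) D' σ ∧ ‖D'‖ ≤ 1200 * K / (σ * √(ν * σ)) := by
  refine ⟨_, h.hasDerivAt_sliceInt hσ d, ?_⟩
  have hσm : σ ∈ Set.Icc (0:ℝ) 6 := ⟨hσ.le, hσ'⟩
  have hK : 0 ≤ K := (norm_nonneg _).trans (h.bound 0 (by simp) 0 (by simp)).1
  have hex : ∀ Υ, HasDerivAt (sliceExp ν d σ)
      (sliceExp ν d σ Υ * (2 * I * ν * σ * (Υ - (σ/2 + d/(2*σ)) : ℝ))) Υ := fun Υ => by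
    have := (((((hasDerivAt_id Υ).sub_const (σ/2 + d/(2*σ))).pow 2).const_mul σ).const_mul ν).ofReal_comp.const_mul I
    refine this.cexp.congr_deriv ?_
    simp only [sliceExp, Pi.pow_apply, id]
    congr 1
    push_cast
    ring
  have hec : Continuous (sliceExp ν d σ) := by
    unfold sliceExp
    fun_prop
  have he1 : ∀ Υ, ‖sliceExp ν d σ Υ‖ = 1 := fun Υ => by
    rw [sliceExp, mul_comm]
    exact Complex.norm_exp_ofReal_mul_I _
  have cg : Continuous (g σ) := continuous_iff_continuousAt.2 fun Υ => (h.hΥ σ Υ).continuousAt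
  have cgσ : Continuous (gσ σ) := continuous_iff_continuousAt.2 fun Υ => (h.hσΥ σ Υ).continuousAt
  have cgΥ : Continuous (gΥ σ) := continuous_iff_continuousAt.2 fun Υ => (h.hΥΥ σ Υ).continuousAt
  have cgΥΥ := h.contΥΥ σ
  obtain ⟨w, hw⟩ : ∃ w : ℝ, w = σ/2 + d/(2*σ) := ⟨_, rfl⟩
  rw [← hw] at hex ⊢
  have hσc : (σ:ℂ) ≠ 0 := by exact_mod_cast hσ.ne'
  have hνc : (ν:ℂ) ≠ 0 := by exact_mod_cast hν.ne'
  have i1 := integral_deriv_mul_eq_neg (u := -3) (v := 3) (by norm_num)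
    (f := sliceExp ν d σ) (g := fun Υ => (-(Υ - w : ℝ) + (2 * Υ - 2 * σ : ℝ)) * g σ Υ)
    (g₁ := fun Υ => g σ Υ + (-(Υ - w : ℝ) + (2 * Υ - 2 * σ : ℝ)) * gΥ σ Υ) (fun Υ _ => hex Υ)
    (fun Υ _ => by
      have e : HasDerivAt (fun Υ : ℝ => (-(Υ - w : ℝ) + (2 * Υ - 2 * σ : ℝ) : ℂ)) 1 Υ := by
        have e1 := ((hasDerivAt_id Υ).sub_const w).ofReal_comp.neg
        have e2 := (((hasDerivAt_id Υ).const_mul 2).sub_const (2 * σ)).ofReal_comp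
        refine (e1.add e2).congr_deriv ?_
        norm_num
      exact (e.mul (h.hΥ σ Υ)).congr_deriv (by rw [one_mul])) (by fun_prop) (by fun_prop) (by simp [(h.left σ).1]) (by simp [(h.right σ).1])
  have i2 := integral_deriv_mul_eq_neg (u := -3) (v := 3) (by norm_num)
    (f := sliceExp ν d σ) (g := gΥ σ) (g₁ := gΥΥ σ) (fun Υ _ => hex Υ)
    (fun Υ _ => h.hΥΥ σ Υ) (by fun_prop) (by fun_prop) (h.left σ).2 (h.right σ).2
  have key : ∫ Υ in (-3:ℝ)..3, sliceExp ν d σ Υ *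
      (I * ν * (Υ - w : ℝ) * (Υ + w - 2 * σ : ℝ) * g σ Υ + gσ σ Υ)
      = (1/(2*σ):ℂ) * (-∫ Υ in (-3:ℝ)..3, sliceExp ν d σ Υ *
          (g σ Υ + (2 * Υ - 2 * σ : ℝ) * gΥ σ Υ))
        + (1/(2*σ):ℂ) * (1/(2*I*ν*σ)) * (-∫ Υ in (-3:ℝ)..3, sliceExp ν d σ Υ * gΥΥ σ Υ)
        + ∫ Υ in (-3:ℝ)..3, sliceExp ν d σ Υ * gσ σ Υ := by
    have i3 : -∫ Υ in (-3:ℝ)..3, sliceExp ν d σ Υ *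
          (g σ Υ + (2 * Υ - 2 * σ : ℝ) * gΥ σ Υ) =
          (-∫ Υ in (-3:ℝ)..3, sliceExp ν d σ Υ *
          (g σ Υ + (-(Υ - w : ℝ) + (2 * Υ - 2 * σ : ℝ)) * gΥ σ Υ)) -
          ∫ Υ in (-3:ℝ)..3, sliceExp ν d σ Υ * ((Υ - w : ℝ) * gΥ σ Υ) := by
      rw [← intervalIntegral.integral_neg, ← intervalIntegral.integral_neg,
        ← intervalIntegral.integral_sub (Continuous.intervalIntegrable (by fun_prop) _ _) (Continuous.intervalIntegrable (by fun_prop) _ _)]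
      congr 1
      ext Υ
      push_cast
      ring
    rw [i3, ← i1, ← i2, ← intervalIntegral.integral_const_mul, mul_sub,
      ← intervalIntegral.integral_const_mul, ← intervalIntegral.integral_const_mul,
      ← intervalIntegral.integral_sub (Continuous.intervalIntegrable (by fun_prop) _ _) (Continuous.intervalIntegrable (by fun_prop) _ _),
      ← intervalIntegral.integral_add (Continuous.intervalIntegrable (by fun_prop) _ _) (Continuous.intervalIntegrable (by fun_prop) _ _),
      ← intervalIntegral.integral_add (Continuous.intervalIntegrable (by fun_prop) _ _) (Continuous.intervalIntegrable (by fun_prop) _ _)]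
    congr 1
    ext Υ
    push_cast
    field_simp
    ring
  rw [key]
  have hdΥ : ∀ Υ, HasDerivAt (fun Υ => g σ Υ + (2 * Υ - 2 * σ : ℝ) * gΥ σ Υ)
      (gΥ σ Υ + (2 * gΥ σ Υ + (2 * Υ - 2 * σ : ℝ) * gΥΥ σ Υ)) Υ := fun Υ => by
    have e2 := (((hasDerivAt_id Υ).const_mul 2).sub_const (2 * σ)).ofReal_comp
    refine ((h.hΥ σ Υ).add (e2.mul (h.hΥΥ σ Υ))).congr_deriv ?_
    simp
  have hlin : ∀ Υ ∈ Set.Icc (-3:ℝ) 3, ‖((2 * Υ - 2 * σ : ℝ) : ℂ)‖ ≤ 18 := fun Υ hΥ => by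
    rw [Complex.norm_real, Real.norm_eq_abs, abs_le]
    constructor <;> linarith [hΥ.1, hΥ.2]
  have hmul : ∀ Υ ∈ Set.Icc (-3:ℝ) 3, ∀ z : ℂ, ‖z‖ ≤ K → ‖((2 * Υ - 2 * σ : ℝ) : ℂ) * z‖ ≤ 18 * K :=
    fun Υ hΥ z hz => by
      rw [norm_mul]
      exact mul_le_mul (hlin Υ hΥ) hz (norm_nonneg _) (by norm_num)
  have n1 := norm_integral_sliceExp_le (G := 21 * K) hν hσ d
    (g := fun Υ => g σ Υ + (2 * Υ - 2 * σ : ℝ) * gΥ σ Υ) (fun Υ _ => (hdΥ Υ).differentiableAt)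
    (fun Υ hΥ => by
      obtain ⟨b1, _, b3, _, b5⟩ := h.bound σ hσm Υ hΥ
      refine (norm_add_le _ _).trans ?_
      linarith [hmul Υ hΥ _ b3])
    (fun Υ hΥ => by
      obtain ⟨b1, _, b3, _, b5⟩ := h.bound σ hσm Υ hΥ
      rw [(hdΥ Υ).deriv]
      have t1 := norm_add_le (gΥ σ Υ) (2 * gΥ σ Υ + (2 * Υ - 2 * σ : ℝ) * gΥΥ σ Υ)
      have t2 := norm_add_le (2 * gΥ σ Υ) ((2 * Υ - 2 * σ : ℝ) * gΥΥ σ Υ)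
      have t3 : ‖2 * gΥ σ Υ‖ = 2 * ‖gΥ σ Υ‖ := by rw [norm_mul, Complex.norm_ofNat]
      linarith [hmul Υ hΥ _ b5])
  have n2 : ‖∫ Υ in (-3:ℝ)..3, sliceExp ν d σ Υ * gΥΥ σ Υ‖ ≤ K * |3 - -3| :=
    intervalIntegral.norm_integral_le_of_norm_le_const fun Υ hΥ => by
      rw [Set.uIoc_of_le (by norm_num)] at hΥ
      rw [norm_mul, he1, one_mul]
      exact (h.bound σ hσm Υ ⟨hΥ.1.le, hΥ.2⟩).2.2.2.2
  have n3 := norm_integral_sliceExp_le (G := K) hν hσ d (g := gσ σ)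
    (fun Υ _ => (h.hσΥ σ Υ).differentiableAt) (fun Υ hΥ => (h.bound σ hσm Υ hΥ).2.1)
    (fun Υ hΥ => by rw [(h.hσΥ σ Υ).deriv]; exact (h.bound σ hσm Υ hΥ).2.2.2.1)
  have hr0 : 0 < √(ν * σ) := Real.sqrt_pos.2 (mul_pos hν hσ)
  have hrr : √(ν * σ) ^ 2 = ν * σ := Real.sq_sqrt (mul_pos hν hσ).le
  have hr : 1/2 ≤ √(ν * σ) := by nlinarith
  have s1 : ‖(1/(2*σ):ℂ)‖ = 1 / (2 * σ) := by
    rw [norm_div, norm_mul, Complex.norm_real, Real.norm_of_nonneg hσ.le]; simp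
  have s2 : ‖(1/(2*I*ν*σ):ℂ)‖ = 1 / (2 * √(ν * σ) ^ 2) := by
    rw [norm_div, norm_mul, norm_mul, norm_mul, Complex.norm_real, Complex.norm_real,
      Real.norm_of_nonneg hσ.le, Real.norm_of_nonneg hν.le, hrr]; simp [mul_assoc]
  rw [abs_of_pos (by norm_num)] at n2
  refine (norm_add_le _ _).trans ((add_le_add (norm_add_le _ _) le_rfl).trans ?_)
  rw [norm_mul, norm_mul, norm_mul, norm_neg, norm_neg, s1, s2]
  generalize √(ν * σ) = r at *
  have m1 : 1 / (2 * σ) * ‖∫ Υ in (-3:ℝ)..3, sliceExp ν d σ Υ *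
      (g σ Υ + (2 * Υ - 2 * σ : ℝ) * gΥ σ Υ)‖ ≤ 735 * K / (σ * r) := by
    calc _ ≤ 1 / (2 * σ) * (70 * (21 * K) / r) := by gcongr
      _ = 735 * K / (σ * r) := by field_simp; ring
  have m2 : 1 / (2 * σ) * (1 / (2 * r ^ 2)) * ‖∫ Υ in (-3:ℝ)..3, sliceExp ν d σ Υ * gΥΥ σ Υ‖
      ≤ 3 * K / (σ * r) := by
    calc _ ≤ 1 / (2 * σ) * (1 / (2 * r ^ 2)) * (K * (3 - -3)) := by gcongr
      _ = (3 * K / (σ * r)) * (1 / (2 * r)) := by field_simp; ring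
      _ ≤ (3 * K / (σ * r)) * 1 := by
        gcongr
        rw [div_le_one (by positivity)]
        linarith
      _ = _ := mul_one _
  have m3 : 70 * K / r ≤ 420 * K / (σ * r) := by
    rw [div_le_div_iff₀ hr0 (by positivity)]
    have : 0 ≤ K * r := by positivity
    nlinarith
  calc _ ≤ 735 * K / (σ * r) + 3 * K / (σ * r) + 420 * K / (σ * r) := by linarith
    _ = 1158 * K / (σ * r) := by ring
    _ ≤ 1200 * K / (σ * r) := by gcongr; norm_num

end SmoothSlice

theorem ContDiff.fderiv_apply_const {f : ℝ × ℝ → ℂ} (hf : ContDiff ℝ (⊤ : ℕ∞) f) (v : ℝ × ℝ) :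
    ContDiff ℝ (⊤ : ℕ∞) (fun p => fderiv ℝ f p v) :=
  (hf.fderiv_right (m := (⊤ : ℕ∞)) (by simp)).clm_apply contDiff_const

theorem ContDiff.hasDerivAt_snd {f : ℝ × ℝ → ℂ} (hf : ContDiff ℝ (⊤ : ℕ∞) f) (x y : ℝ) :
    HasDerivAt (fun y => f (x, y)) (fderiv ℝ f (x, y) (0, 1)) y := by
  have h := (hf.differentiable (by simp) (x, y)).hasFDerivAt
  exact h.comp_hasDerivAt y ((hasDerivAt_const y x).prodMk (hasDerivAt_id y))

theorem ContDiff.hasDerivAt_fst {f : ℝ × ℝ → ℂ} (hf : ContDiff ℝ (⊤ : ℕ∞) f) (x y : ℝ) :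
    HasDerivAt (fun x => f (x, y)) (fderiv ℝ f (x, y) (1, 0)) x := by
  have h := (hf.differentiable (by simp) (x, y)).hasFDerivAt
  exact h.comp_hasDerivAt x ((hasDerivAt_id x).prodMk (hasDerivAt_const x y))

theorem exists_smoothSlice {χ : ℝ × ℝ → ℝ} (hχ : ContDiff ℝ (⊤ : ℕ∞) χ)
    (hs : tsupport χ ⊆ {p : ℝ × ℝ | |p.1| < 3 ∧ |p.2| < 3}) :
    ∃ K gσ gΥ gσΥ gΥΥ, 0 ≤ K ∧
      SmoothSlice K (fun σ Υ => (χ (σ - Υ, Υ) : ℂ)) gσ gΥ gσΥ gΥΥ := by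
  obtain ⟨f, hf⟩ : ∃ f : ℝ × ℝ → ℂ, f = fun p => (χ (p.1 - p.2, p.2) : ℂ) := ⟨_, rfl⟩
  have hfc : ContDiff ℝ (⊤ : ℕ∞) f := by
    rw [hf]
    exact Complex.ofRealCLM.contDiff.comp (hχ.comp ((contDiff_fst.sub contDiff_snd).prodMk contDiff_snd))
  have hfσ := hfc.fderiv_apply_const (1, 0)
  have hfΥ := hfc.fderiv_apply_const (0, 1)
  have hfσΥ := hfσ.fderiv_apply_const (0, 1)
  have hfΥΥ := hfΥ.fderiv_apply_const (0, 1)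
  have hz : ∀ σ Υ : ℝ, |Υ| = 3 → f (σ, Υ) = 0 ∧ fderiv ℝ f (σ, Υ) (0, 1) = 0 := fun σ Υ h3 => by
    have h1 : (σ - Υ, Υ) ∉ tsupport χ := fun hmem => by
      have := (hs hmem).2
      simp only at this
      linarith
    have h2 : χ =ᶠ[nhds (σ - Υ, Υ)] 0 := notMem_tsupport_iff_eventuallyEq.1 h1
    have h4 : Tendsto (fun p : ℝ × ℝ => (p.1 - p.2, p.2)) (nhds (σ, Υ)) (nhds (σ - Υ, Υ)) :=
      Continuous.tendsto (by fun_prop : Continuous fun p : ℝ × ℝ => (p.1 - p.2, p.2)) (σ, Υ)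
    have h5 : f =ᶠ[nhds (σ, Υ)] fun _ => 0 := by
      filter_upwards [h4.eventually h2] with p hp
      rw [hf]
      simp only [Pi.zero_apply] at hp
      simp [hp]
    refine ⟨h5.eq_of_nhds, ?_⟩
    rw [h5.fderiv_eq]
    simp
  have hb : ∀ F : ℝ × ℝ → ℂ, Continuous F → ∃ B, ∀ σ ∈ Set.Icc (0:ℝ) 6, ∀ Υ ∈ Set.Icc (-3:ℝ) 3,
      ‖F (σ, Υ)‖ ≤ B := fun F hF => by
    obtain ⟨B, hB⟩ := (isCompact_Icc.prod isCompact_Icc).exists_bound_of_continuousOn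
      (s := Set.Icc (0:ℝ) 6 ×ˢ Set.Icc (-3:ℝ) 3) hF.continuousOn
    exact ⟨B, fun σ hσ Υ hΥ => hB (σ, Υ) ⟨hσ, hΥ⟩⟩
  obtain ⟨B₁, hB₁⟩ := hb f hfc.continuous
  obtain ⟨B₂, hB₂⟩ := hb _ hfσ.continuous
  obtain ⟨B₃, hB₃⟩ := hb _ hfΥ.continuous
  obtain ⟨B₄, hB₄⟩ := hb _ hfσΥ.continuous
  obtain ⟨B₅, hB₅⟩ := hb _ hfΥΥ.continuous
  refine ⟨|B₁| + |B₂| + |B₃| + |B₄| + |B₅|, fun σ Υ => fderiv ℝ f (σ, Υ) (1, 0),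
    fun σ Υ => fderiv ℝ f (σ, Υ) (0, 1),
    fun σ Υ => fderiv ℝ (fun p => fderiv ℝ f p (1, 0)) (σ, Υ) (0, 1),
    fun σ Υ => fderiv ℝ (fun p => fderiv ℝ f p (0, 1)) (σ, Υ) (0, 1), by positivity, ?_⟩
  have a1 := abs_nonneg B₁
  have a2 := abs_nonneg B₂
  have a3 := abs_nonneg B₃
  have a4 := abs_nonneg B₄
  have a5 := abs_nonneg B₅
  have hfe : (fun σ Υ => (χ (σ - Υ, Υ) : ℂ)) = fun σ Υ => f (σ, Υ) := by rw [hf]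
  rw [hfe]
  refine ⟨fun σ Υ => hfc.hasDerivAt_snd σ Υ, fun σ Υ => hfΥ.hasDerivAt_snd σ Υ,
    fun σ Υ => hfc.hasDerivAt_fst σ Υ, fun σ Υ => hfσ.hasDerivAt_snd σ Υ,
    hfc.continuous, hfσ.continuous, fun σ => hfΥΥ.continuous.comp (by fun_prop),
    fun σ hσ Υ hΥ => ⟨?_, ?_, ?_, ?_, ?_⟩, fun σ => hz σ (-3) (by norm_num), fun σ => hz σ 3 (by norm_num)⟩
  · linarith [hB₁ σ hσ Υ hΥ, le_abs_self B₁]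
  · linarith [hB₂ σ hσ Υ hΥ, le_abs_self B₂]
  · linarith [hB₃ σ hσ Υ hΥ, le_abs_self B₃]
  · linarith [hB₄ σ hσ Υ hΥ, le_abs_self B₄]
  · linarith [hB₅ σ hσ Υ hΥ, le_abs_self B₅]

theorem intervalIntegrable_of_norm_le_one_div_sqrt {R : ℝ} (hR : 0 < R) {f : ℝ → ℂ}
    (hf : ContinuousOn f (Set.Ioc 0 R)) (hb : ∀ t ∈ Set.Ioc 0 R, ‖f t‖ ≤ 1 / √t) :
    IntervalIntegrable f volume 0 R := by
  have h1 : IntervalIntegrable (fun t : ℝ => t ^ (-(1:ℝ)/2)) volume 0 R :=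
    intervalIntegral.intervalIntegrable_rpow' (by norm_num)
  rw [intervalIntegrable_iff_integrableOn_Ioc_of_le hR.le] at h1 ⊢
  refine Integrable.mono' h1 (hf.aestronglyMeasurable measurableSet_Ioc) ?_
  refine (ae_restrict_iff' measurableSet_Ioc).2 (Eventually.of_forall fun t ht => (hb t ht).trans_eq ?_)
  rw [Real.sqrt_eq_rpow, one_div, ← Real.rpow_neg ht.1.le]
  norm_num

/-- The scales `Q` for which the oscillatory integral with parameters `M`, `s` is `O(M^{-1/3} Q)`. -/
def AdmissibleGain (M s Q : ℝ) : Prop :=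
  Q = M ^ ((1:ℝ)/12) ∨ (0 < |s| ∧ 1 ≤ M * (|s| / 50) ^ 2 ∧ Q = |s| ^ (-(1:ℝ)/6))

theorem AdmissibleGain.half_le {M s Q : ℝ} (h : AdmissibleGain M s Q) (hM : 1/2 ≤ M) (hs : |s| ≤ 1) :
    1/2 ≤ Q := by
  rcases h with rfl | ⟨h0, _, rfl⟩
  · calc (1/2 : ℝ) = (1/2 : ℝ) ^ (1:ℝ) := (Real.rpow_one _).symm
      _ ≤ (1/2) ^ ((1:ℝ)/12) := Real.rpow_le_rpow_of_exponent_ge (by norm_num) (by norm_num) (by norm_num)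
      _ ≤ M ^ ((1:ℝ)/12) := Real.rpow_le_rpow (by norm_num) hM (by norm_num)
  · have := Real.one_le_rpow_of_pos_of_le_one_of_nonpos h0 hs (z := -(1:ℝ)/6) (by norm_num)
    linarith

theorem TangentialPhase.norm_le_admissible {M s d R Q : ℝ} {H K κ : ℝ → ℝ} {β : ℝ → ℂ}
    (h : TangentialPhase M s d R H K κ β) (hR : 0 < R)
    (hp : ∀ u v : ℝ, 0 < u → u ≤ v → v ≤ 2 * u → v ≤ R → 1 ≤ M * u ^ 2 →
      ‖∫ t in u..v, Complex.exp (I * ((M * H t : ℝ) : ℂ)) * β t‖ ≤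
        600 * ((u / M) ^ ((1:ℝ)/3) * (1 / √u)))
    (hQ : AdmissibleGain M s Q) :
    ‖∫ t in (0:ℝ)..R, Complex.exp (I * ((M * H t : ℝ) : ℂ)) * β t‖ ≤
      20000 * (M ^ (-(1:ℝ)/3) * Q) := by
  have hM := h.M_pos
  rcases hQ with rfl | ⟨h0, h1, rfl⟩
  · refine (h.norm_le_degenerate hR hp).trans ?_
    rw [← Real.rpow_add hM]
    norm_num
    have := Real.rpow_pos_of_pos hM (-(1/4))
    linarith
  · exact h.norm_le_nondegenerate hR hp h0 h1

/-- The `σ`-phase before rescaling, with `Θ` the critical value of the `A`-phase. -/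
noncomputable def sidePhase (Θ : ℝ → ℝ) (d σ : ℝ) : ℝ :=
  σ ^ 3 / 12 + σ - d * σ / 2 - d ^ 2 / (4 * σ) + Θ σ

/-- Bounds for the critical point `cc` and the amplitude `F` of the `A`-integral on `(0, r]`. -/
structure SideData (Λ N c0 C r : ℝ) (cc c₁ Θ : ℝ → ℝ) (F : ℝ → ℂ) : Prop where
  hN : 1 ≤ N
  hM : N ^ 3 / 2 ≤ Λ
  hr : 0 < r
  hr' : r ≤ 6
  hC : 1 ≤ C
  hs : |N ^ 2 * (1 - c0)| ≤ 1
  hΘ : ∀ σ ∈ Set.Ioc 0 r, HasDerivAt Θ (-cc σ) σ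
  hcc : ∀ σ ∈ Set.Ioc 0 r, HasDerivAt cc (c₁ σ) σ
  hc₁ : ContinuousOn c₁ (Set.Ioc 0 r)
  hccb : ∀ σ ∈ Set.Ioc 0 r, |cc σ - c0| ≤ 5 * (σ / N)
  hc₁b : ∀ σ ∈ Set.Ioc 0 r, |c₁ σ| ≤ 5 / N
  hF : ∀ σ ∈ Set.Ioc 0 r, ‖F σ‖ ≤ C / √(Λ * N) ∧ ∃ F', HasDerivAt F F' σ ∧ ‖F'‖ ≤ C / √(Λ * N) / N

namespace SideData

variable {Λ N c0 C r : ℝ} {cc c₁ Θ : ℝ → ℝ} {F : ℝ → ℂ} (h : SideData Λ N c0 C r cc c₁ Θ F)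
include h

theorem N_pos : 0 < N := lt_of_lt_of_le one_pos h.hN

theorem Λ_pos : 0 < Λ := lt_of_lt_of_le (by have := h.N_pos; positivity) h.hM

theorem div_mem {t : ℝ} (ht : t ∈ Set.Ioc 0 (N * r)) : t / N ∈ Set.Ioc 0 r :=
  ⟨div_pos ht.1 h.N_pos, (div_le_iff₀' h.N_pos).2 ht.2⟩

theorem tangentialPhase {K : ℝ} {g gσ gΥ gσΥ gΥΥ : ℝ → ℝ → ℂ}
    (hg : SmoothSlice K g gσ gΥ gσΥ gΥΥ) (hK : 1 ≤ K) (d : ℝ) :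
    TangentialPhase (Λ / N ^ 3) (N ^ 2 * (1 - c0)) (N ^ 2 * d) (N * r)
      (fun t => N ^ 3 * sidePhase Θ d (t / N)) (fun t => N ^ 2 * (c0 - cc (t / N)))
      (fun t => -(N * c₁ (t / N)))
      (fun t => ((Λ / (2000 * K * C) : ℝ) : ℂ) * (sliceInt g Λ d (t / N) * F (t / N))) := by
  have hN := h.N_pos
  have hΛ := h.Λ_pos
  have hC := h.hC
  have hd : ∀ t : ℝ, HasDerivAt (fun t => t / N) (1 / N) t := fun t => (hasDerivAt_id t).div_const N
  have hsr : 0 < √(Λ * N) := Real.sqrt_pos.2 (mul_pos hΛ hN)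
  have hprod : ∀ t, 0 < t → √(Λ * (t / N)) * √(Λ * N) = Λ * √t := fun t ht => by
    rw [← Real.sqrt_mul (by positivity), show Λ * (t / N) * (Λ * N) = Λ ^ 2 * t by field_simp,
      Real.sqrt_mul (by positivity), Real.sqrt_sq hΛ.le]
  have hnorm : ∀ z : ℂ, ‖((Λ / (2000 * K * C) : ℝ) : ℂ) * z‖ = Λ / (2000 * K * C) * ‖z‖ := fun z => by
    rw [norm_mul, Complex.norm_real, Real.norm_of_nonneg (by positivity)]
  have hHd : ∀ t ∈ Set.Ioc 0 (N * r), HasDerivAt (fun t => N ^ 3 * sidePhase Θ d (t / N))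
      (N ^ 2 * (1 - c0) + N ^ 2 * (c0 - cc (t / N)) + (N ^ 2 * d / t - t) ^ 2 / 4) t := by
    intro t ht
    have hm := h.div_mem ht
    have ht0 : t ≠ 0 := ht.1.ne'
    have h1 : HasDerivAt (fun σ => sidePhase Θ d σ)
        ((t/N) ^ 2 / 4 + 1 - d / 2 + d ^ 2 / (4 * (t/N) ^ 2) - cc (t/N)) (t / N) := by
      have hm0 : t / N ≠ 0 := hm.1.ne'
      have e1 := ((hasDerivAt_id (t/N)).pow 3).div_const 12
      have e2 := ((hasDerivAt_id (t/N)).const_mul d).div_const 2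
      have e3 := (hasDerivAt_const (t/N) (d^2)).div ((hasDerivAt_id (t/N)).const_mul 4)
        (by simpa using hm0)
      refine ((((e1.add (hasDerivAt_id _)).sub e2).sub e3).add (h.hΘ _ hm)).congr_deriv ?_
      simp
      field_simp
      ring
    refine ((h1.comp t (hd t)).const_mul (N ^ 3)).congr_deriv ?_
    field_simp
    ring
  have hβd : ∀ t ∈ Set.Ioc 0 (N * r), ∃ b : ℂ, HasDerivAt
      (fun t => ((Λ / (2000 * K * C) : ℝ) : ℂ) * (sliceInt g Λ d (t / N) * F (t / N))) b t ∧
      (1/2 ≤ Λ / N ^ 3 * t → ‖b‖ ≤ 1 / (t * √t)) := by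
    intro t ht
    have hm := h.div_mem ht
    have ht0 := ht.1
    have hst := Real.sqrt_pos.2 ht0
    obtain ⟨f1, F', f2, f3⟩ := h.hF _ hm
    have e1 := hg.hasDerivAt_sliceInt (ν := Λ) hm.1 d
    have e2 := (e1.scomp t (hd t)).mul (f2.scomp t (hd t))
    refine ⟨_, e2.const_mul _, fun hMt => ?_⟩
    have hΛt : 1/2 ≤ Λ * (t / N) := hMt.trans (by
      rw [div_mul_eq_mul_div, mul_div_assoc']
      gcongr
      exact le_self_pow₀ h.hN (by norm_num))
    obtain ⟨D', d1, d2⟩ := hg.exists_hasDerivAt_sliceInt hΛ hm.1 (hm.2.trans h.hr') d hΛt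
    have d3 := hg.norm_sliceInt_le hΛ hm.1 (hm.2.trans h.hr') d
    rw [e1.unique d1, hnorm]
    have hp := hprod t ht0
    have hs1 : 0 < √(Λ * (t / N)) := Real.sqrt_pos.2 (mul_pos hΛ hm.1)
    have b1 : ‖(1 / N) • D' * F (t / N)‖ ≤ 1200 * K * C / (Λ * (t * √t)) := by
      rw [norm_mul, norm_smul, Real.norm_of_nonneg (by positivity)]
      calc _ ≤ 1 / N * (1200 * K / (t / N * √(Λ * (t / N)))) * (C / √(Λ * N)) := by gcongr
        _ = 1200 * K * C / (t * (√(Λ * (t / N)) * √(Λ * N))) := by field_simp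
        _ = _ := by rw [hp]; congr 1; ring
    have b2 : ‖sliceInt g Λ d (t / N) * (1 / N) • F'‖ ≤ 420 * K * C / (Λ * (t * √t)) := by
      rw [norm_mul, norm_smul, Real.norm_of_nonneg (by positivity)]
      have : 1 / N * (1 / N) ≤ 6 / t := by
        rw [div_mul_div_comm, div_le_div_iff₀ (by positivity) ht0]
        have : t ≤ N * 6 := ht.2.trans (by gcongr; exact h.hr')
        nlinarith [h.hN]
      calc _ ≤ 70 * K / √(Λ * (t / N)) * (1 / N * (C / √(Λ * N) / N)) := by gcongr
        _ = 70 * K * C / (√(Λ * (t / N)) * √(Λ * N)) * (1 / N * (1 / N)) := by field_simp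
        _ ≤ 70 * K * C / (√(Λ * (t / N)) * √(Λ * N)) * (6 / t) := by gcongr
        _ = _ := by rw [hp]; field_simp; ring
    calc _ ≤ Λ / (2000 * K * C) * (1200 * K * C / (Λ * (t * √t)) + 420 * K * C / (Λ * (t * √t))) := by
          gcongr
          exact (norm_add_le _ _).trans (add_le_add b1 b2)
      _ = 1620 / 2000 * (1 / (t * √t)) := by field_simp; ring
      _ ≤ 1 * (1 / (t * √t)) := by gcongr; norm_num
      _ = _ := one_mul _
  have hβb : ∀ t ∈ Set.Ioc 0 (N * r),
      ‖((Λ / (2000 * K * C) : ℝ) : ℂ) * (sliceInt g Λ d (t / N) * F (t / N))‖ ≤ 1 / √t := by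
    intro t ht
    have hm := h.div_mem ht
    have hst := Real.sqrt_pos.2 ht.1
    have hp := hprod t ht.1
    have d3 := hg.norm_sliceInt_le hΛ hm.1 (hm.2.trans h.hr') d
    rw [hnorm, norm_mul]
    calc _ ≤ Λ / (2000 * K * C) * (70 * K / √(Λ * (t / N)) * (C / √(Λ * N))) := by
          gcongr
          exact (h.hF _ hm).1
      _ = Λ / (2000 * K * C) * (70 * K * C / (√(Λ * (t / N)) * √(Λ * N))) := by
        rw [div_mul_div_comm]
      _ = 70 / 2000 * (1 / √t) := by rw [hp]; field_simp
      _ ≤ 1 * (1 / √t) := by gcongr; norm_num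
      _ = _ := one_mul _
  refine ⟨?_, h.hs, hHd, ?_, ?_, ?_, ?_, ?_, hβb, ?_, ?_⟩
  · rw [le_div_iff₀ (by positivity)]
    linarith [h.hM]
  · intro t ht
    refine ((((h.hcc _ (h.div_mem ht)).comp t (hd t)).const_sub c0).const_mul (N ^ 2)).congr_deriv ?_
    field_simp
  · intro t ht
    have := h.hccb _ (h.div_mem ht)
    rw [abs_mul, abs_of_pos (by positivity), abs_sub_comm]
    calc N ^ 2 * |cc (t / N) - c0| ≤ N ^ 2 * (5 * (t / N / N)) := by gcongr
      _ = 5 * t := by field_simp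
  · intro t ht
    have := h.hc₁b _ (h.div_mem ht)
    rw [abs_neg, abs_mul, abs_of_pos hN]
    calc N * |c₁ (t / N)| ≤ N * (5 / N) := by gcongr
      _ = 5 := by field_simp
  · exact (continuousOn_const.mul (h.hc₁.comp (by fun_prop) fun t ht => h.div_mem ht)).neg
  · intro t ht
    obtain ⟨b, hb, _⟩ := hβd t ht
    exact hb.differentiableAt
  · intro t ht hMt
    obtain ⟨b, hb, hb'⟩ := hβd t ht
    rw [hb.deriv]
    exact hb' hMt
  · refine intervalIntegrable_of_norm_le_one_div_sqrt (mul_pos hN h.hr) ?_ ?_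
    · intro t ht
      obtain ⟨b, hb, _⟩ := hβd t ht
      refine ContinuousAt.continuousWithinAt (ContinuousAt.mul ?_ hb.continuousAt)
      exact (((hHd t ht).const_mul (Λ / N ^ 3)).ofReal_comp.const_mul I).cexp.continuousAt
    · intro t ht
      rw [norm_mul, mul_comm I, Complex.norm_exp_ofReal_mul_I, one_mul]
      exact hβb t ht

end SideData

/-- The three convexity patterns of the critical point under which the `σ`-integral is estimated. -/
def SidePattern (N r : ℝ) (c₁ : ℝ → ℝ) : Prop :=
  (∃ c₂ : ℝ → ℝ, ∀ σ ∈ Set.Ioc 0 r, N * c₁ σ ≤ -(3/10) ∧ HasDerivAt c₁ (c₂ σ) σ ∧ c₂ σ ≤ 1) ∨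
  (∃ c₂ : ℝ → ℝ, ∀ σ ∈ Set.Ioc 0 r, 7/10 ≤ N * c₁ σ ∧ HasDerivAt c₁ (c₂ σ) σ ∧ c₂ σ ≤ 1/4) ∨
  ∀ σ ∈ Set.Ioc 0 r, -(N * c₁ σ) + N * σ / 2 ≤ -(1/10)

theorem SideData.norm_le {Λ N c0 C r : ℝ} {cc c₁ Θ : ℝ → ℝ} {F : ℝ → ℂ}
    (h : SideData Λ N c0 C r cc c₁ Θ F) {K Q : ℝ} {g gσ gΥ gσΥ gΥΥ : ℝ → ℝ → ℂ}
    (hg : SmoothSlice K g gσ gΥ gσΥ gΥΥ) (hK : 1 ≤ K) (d : ℝ) (hp : SidePattern N r c₁)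
    (hQ : AdmissibleGain (Λ / N ^ 3) (N ^ 2 * (1 - c0)) Q) :
    ‖∫ σ in (0:ℝ)..r, Complex.exp (I * ((Λ * sidePhase Θ d σ : ℝ) : ℂ)) *
      (sliceInt g Λ d σ * F σ)‖ ≤ 40000000 * K * C * (Λ ^ (-(4:ℝ)/3) * Q) := by
  have hN := h.N_pos
  have hΛ := h.Λ_pos
  have hC := h.hC
  have ht := h.tangentialPhase hg hK d
  have hd : ∀ t : ℝ, HasDerivAt (fun t => t / N) (1 / N) t := fun t => (hasDerivAt_id t).div_const N
  have hκ₁ : ∀ c₂ : ℝ → ℝ, (∀ σ ∈ Set.Ioc 0 r, HasDerivAt c₁ (c₂ σ) σ) → ∀ t ∈ Set.Ioc 0 (N * r),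
      HasDerivAt (fun t => -(N * c₁ (t / N))) (-c₂ (t / N)) t := fun c₂ hc₂ t ht => by
    refine ((((hc₂ _ (h.div_mem ht)).comp t (hd t)).const_mul N).neg).congr_deriv ?_
    field_simp
  have hb := ht.norm_le_admissible (mul_pos hN h.hr) (by
    intro u v hu huv h2 hv hMu
    rcases hp with ⟨c₂, hc₂⟩ | ⟨c₂, hc₂⟩ | hc
    · exact ht.piece_of_pos (fun t ht => by linarith [(hc₂ _ (h.div_mem ht)).1])
        (hκ₁ c₂ fun σ hσ => (hc₂ σ hσ).2.1) (fun t ht => by linarith [(hc₂ _ (h.div_mem ht)).2.2])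
        hu huv h2 hv hMu
    · exact ht.piece_of_neg (fun t ht => by linarith [(hc₂ _ (h.div_mem ht)).1])
        (hκ₁ c₂ fun σ hσ => (hc₂ σ hσ).2.1) (fun t ht => by linarith [(hc₂ _ (h.div_mem ht)).2.2])
        hu huv h2 hv hMu
    · refine ht.norm_le_of_concave hu huv h2 hv hMu fun t ht => ?_
      have := hc _ (h.div_mem (t := t) ⟨by linarith [ht.1], ht.2.trans hv⟩)
      rw [mul_div_cancel₀ t hN.ne'] at this
      linarith) hQ
  have hchg := intervalIntegral.integral_comp_div (a := 0) (b := N * r)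
    (fun σ => Complex.exp (I * ((Λ * sidePhase Θ d σ : ℝ) : ℂ)) *
      (sliceInt g Λ d σ * F σ)) hN.ne'
  rw [zero_div, mul_div_cancel_left₀ r hN.ne'] at hchg
  have heq : ∫ t in (0:ℝ)..(N * r), Complex.exp (I * ((Λ / N ^ 3 * (N ^ 3 * sidePhase Θ d (t / N)) : ℝ) : ℂ)) *
      (((Λ / (2000 * K * C) : ℝ) : ℂ) * (sliceInt g Λ d (t / N) * F (t / N))) =
      ((Λ / (2000 * K * C) : ℝ) : ℂ) * (N • ∫ σ in (0:ℝ)..r,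
        Complex.exp (I * ((Λ * sidePhase Θ d σ : ℝ) : ℂ)) * (sliceInt g Λ d σ * F σ)) := by
    rw [← hchg, ← intervalIntegral.integral_const_mul]
    congr 1
    ext t
    rw [show Λ / N ^ 3 * (N ^ 3 * sidePhase Θ d (t / N)) = Λ * sidePhase Θ d (t / N) by field_simp]
    ring
  rw [heq, norm_mul, norm_smul, Complex.norm_real, Real.norm_of_nonneg hN.le,
    Real.norm_of_nonneg (by positivity)] at hb
  have hM3 : (Λ / N ^ 3) ^ (-(1:ℝ)/3) = N * Λ ^ (-(1:ℝ)/3) := by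
    rw [Real.div_rpow hΛ.le (by positivity), ← Real.rpow_natCast, ← Real.rpow_mul hN.le]
    norm_num
    rw [Real.rpow_neg hN.le, Real.rpow_one, div_inv_eq_mul, mul_comm]
  have hΛ3 : Λ ^ (-(1:ℝ)/3) = Λ * Λ ^ (-(4:ℝ)/3) := by
    rw [← Real.rpow_one_add' hΛ.le (by norm_num)]
    norm_num
  rw [hM3, hΛ3] at hb
  have hpos : 0 < Λ * N := by positivity
  refine le_of_mul_le_mul_left ?_ hpos
  calc Λ * N * ‖_‖ = 2000 * K * C * (Λ / (2000 * K * C) * (N * ‖_‖)) := by field_simp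
    _ ≤ 2000 * K * C * (20000 * (N * (Λ * Λ ^ (-(4:ℝ)/3)) * Q)) :=
      mul_le_mul_of_nonneg_left hb (by positivity)
    _ = _ := by ring

/-- `c` inverts the profile `prof a θ`. -/
structure ProfInverse (a θ : ℝ) (c : ℝ → ℝ) : Prop where
  mem : ∀ x ∈ Set.Icc (-(61/10)) (81/100 : ℝ), c x ∈ Set.Icc (1/10) 20 ∧ prof a θ (c x) = x
  lip : ∀ x ∈ Set.Icc (-(61/10)) (81/100 : ℝ), ∀ y ∈ Set.Icc (-(61/10)) (81/100 : ℝ),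
    |c y - c x| ≤ 5 * |y - x|
  deriv : ∀ x ∈ Set.Ioo (-(61/10)) (81/100 : ℝ), HasDerivAt c (-(1 / profW a θ (c x))) x

/-- The critical value, as a function of `x`. -/
noncomputable def profCrit (a θ : ℝ) (c : ℝ → ℝ) (x : ℝ) : ℝ := profInt a θ (c x) - x * c x

section
variable {a θ : ℝ} (ha : 0 < a) (ha' : a ≤ 1/1000) (hθ : 3 ≤ θ) (hθ' : θ ≤ 51/10)
include ha ha' hθ hθ'

theorem profW_bounds {A : ℝ} (hA : A ∈ Set.Icc (1/10:ℝ) 20) :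
    3/10 ≤ 1 / profW a θ A ∧ 1 / profW a θ A ≤ 5 ∧ √A - 3/100 ≤ 1 / profW a θ A ∧
      |profW' a θ A / profW a θ A ^ 3| ≤ 6/10 := by
  have hA0 : 0 < A := by linarith [hA.1]
  have hs : 0 < √A := Real.sqrt_pos.2 hA0
  have hss : √A ^ 2 = A := Real.sq_sqrt hA0.le
  have hs5 : √A ≤ 9/2 := by nlinarith [hA.2]
  have hs3 : 31/100 ≤ √A := by nlinarith [hA.1]
  have w1 := one_div_sqrt_le_profW ha hθ hA0
  have w2 := profW_le ha ha' hθ' hA0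
  have w3 := abs_profW'_le ha hθ ha' hθ' hA0 hA.2
  have w0 := profW_pos ha hθ hA0
  generalize profW a θ A = w at *
  generalize √A = s at *
  rw [div_le_iff₀ hs] at w1
  have w2' : w * s ≤ 1 + 13/10000 * s := by
    have := mul_le_mul_of_nonneg_right w2 hs.le
    rwa [add_mul, one_div, inv_mul_cancel₀ hs.ne'] at this
  refine ⟨?_, ?_, ?_, ?_⟩
  · rw [le_div_iff₀ w0]
    nlinarith
  · rw [div_le_iff₀ w0]
    nlinarith
  · rw [le_div_iff₀ w0]
    nlinarith
  · rw [abs_div, abs_of_pos (by positivity : 0 < w ^ 3), div_le_iff₀ (by positivity)]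
    refine w3.trans ?_
    gcongr
    rw [div_le_iff₀ (by positivity), ← hss]
    have : 1 ≤ (w * s) ^ 3 := one_le_pow₀ w1
    nlinarith

omit hθ' in
theorem ProfInverse.hasDerivAt_slope {c : ℝ → ℝ} (hc : ProfInverse a θ c) {ε N σ : ℝ}
    (hε : ε = 1 ∨ ε = -1) (hN : 1 ≤ N) (hx : ε * σ / N ∈ Set.Ioo (-(61/10)) (81/100 : ℝ)) :
    HasDerivAt (fun σ => -(ε / N * (1 / profW a θ (c (ε * σ / N)))))
      (-(profW' a θ (c (ε * σ / N)) / profW a θ (c (ε * σ / N)) ^ 3 / N ^ 2)) σ := by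
  have hN0 : 0 < N := by linarith
  have hεε : ε * ε = 1 := by rcases hε with rfl | rfl <;> norm_num
  have hd : HasDerivAt (fun σ => ε * σ / N) (ε / N) σ := by
    simpa using ((hasDerivAt_id σ).const_mul ε).div_const N
  have hcpos : 0 < c (ε * σ / N) := by
    linarith [(hc.mem _ (Set.Ioo_subset_Icc_self hx)).1.1]
  have hw := profW_pos ha hθ hcpos
  have h1 := ((hasDerivAt_profW (θ := θ) ha hcpos).comp _ (hc.deriv _ hx)).comp σ hd
  refine ((((hasDerivAt_const σ (1:ℝ)).div h1 hw.ne').const_mul (ε / N)).neg).congr_deriv ?_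
  simp only [Function.comp]
  field_simp
  linear_combination (-profW' a θ (c (ε * σ / N))) * hεε

theorem ProfInverse.sideData {c : ℝ → ℝ} (hc : ProfInverse a θ c) {ε Λ N C r : ℝ}
    (hε : ε = 1 ∨ ε = -1) (hN : 1 ≤ N) (hM : N ^ 3 / 2 ≤ Λ) (hr : 0 < r) (hr' : r ≤ 6) (hC : 1 ≤ C)
    (hs : |N ^ 2 * (1 - c 0)| ≤ 1)
    (hx : ∀ σ ∈ Set.Ioc 0 r, ε * σ / N ∈ Set.Ioo (-(61/10)) (81/100 : ℝ)) {F : ℝ → ℂ}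
    (hF : ∀ σ ∈ Set.Ioc 0 r, ‖F σ‖ ≤ C / √(Λ * N) ∧
      ∃ F', HasDerivAt F F' σ ∧ ‖F'‖ ≤ C / √(Λ * N) / N) :
    SideData Λ N (c 0) C r (fun σ => c (ε * σ / N))
      (fun σ => -(ε / N * (1 / profW a θ (c (ε * σ / N)))))
      (fun σ => ε * N * profCrit a θ c (ε * σ / N)) F := by
  have hN0 : 0 < N := by linarith
  have hεε : ε * ε = 1 := by rcases hε with rfl | rfl <;> norm_num
  have hεa : |ε| = 1 := by rcases hε with rfl | rfl <;> norm_num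
  have hd : ∀ σ : ℝ, HasDerivAt (fun σ => ε * σ / N) (ε / N) σ := fun σ => by
    simpa using ((hasDerivAt_id σ).const_mul ε).div_const N
  have h0 : (0:ℝ) ∈ Set.Icc (-(61/10)) (81/100 : ℝ) := by norm_num
  have hcpos : ∀ σ ∈ Set.Ioc 0 r, 0 < c (ε * σ / N) := fun σ hσ => by
    linarith [(hc.mem _ (Set.Ioo_subset_Icc_self (hx σ hσ))).1.1]
  refine ⟨hN, hM, hr, hr', hC, hs, ?_, ?_, ?_, ?_, ?_, hF⟩
  · intro σ hσ
    have hcd := hc.deriv _ (hx σ hσ)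
    have h1 := (hasDerivAt_profInt (θ := θ) ha (hcpos σ hσ)).comp _ hcd
    have h2 := h1.sub ((hasDerivAt_id _).mul hcd)
    refine ((h2.comp σ (hd σ)).const_mul (ε * N)).congr_deriv ?_
    rw [(hc.mem _ (Set.Ioo_subset_Icc_self (hx σ hσ))).2]
    simp only [id, one_mul]
    field_simp
    linear_combination (-N * c (ε * σ / N)) * hεε
  · intro σ hσ
    refine ((hc.deriv _ (hx σ hσ)).comp σ (hd σ)).congr_deriv ?_
    ring
  · intro σ hσ
    exact (hc.hasDerivAt_slope ha ha' hθ hε hN (hx σ hσ)).continuousAt.continuousWithinAt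
  · intro σ hσ
    have := hc.lip 0 h0 _ (Set.Ioo_subset_Icc_self (hx σ hσ))
    rwa [sub_zero, abs_div, abs_mul, hεa, one_mul, abs_of_pos hσ.1, abs_of_pos hN0] at this
  · intro σ hσ
    have hb := profW_bounds ha ha' hθ hθ' (hc.mem _ (Set.Ioo_subset_Icc_self (hx σ hσ))).1
    rw [abs_neg, abs_mul, abs_div, hεa, abs_of_pos hN0, abs_of_nonneg (by linarith [hb.1])]
    calc _ ≤ 1 / N * 5 := by gcongr; exact hb.2.1
      _ = 5 / N := by ring

theorem ProfInverse.sidePattern_pos {c : ℝ → ℝ} (hc : ProfInverse a θ c) {N r : ℝ} (hN : 1 ≤ N)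
    (hx : ∀ σ ∈ Set.Ioc 0 r, 1 * σ / N ∈ Set.Ioo (-(61/10)) (81/100 : ℝ)) :
    SidePattern N r (fun σ => -(1 / N * (1 / profW a θ (c (1 * σ / N))))) := by
  refine Or.inl ⟨_, fun σ hσ => ⟨?_, hc.hasDerivAt_slope ha ha' hθ (Or.inl rfl) hN (hx σ hσ), ?_⟩⟩
  all_goals have hb := profW_bounds ha ha' hθ hθ' (hc.mem _ (Set.Ioo_subset_Icc_self (hx σ hσ))).1
  all_goals have hN0 : 0 < N := by linarith
  · have : N * -(1 / N * (1 / profW a θ (c (1 * σ / N)))) = -(1 / profW a θ (c (1 * σ / N))) := by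
      field_simp
    linarith [hb.1]
  · have h1 := neg_le_of_abs_le hb.2.2.2
    rw [neg_le, le_div_iff₀ (by positivity)]
    nlinarith

omit hθ' in
theorem ProfInverse.le_of_nonpos {c : ℝ → ℝ} (hc : ProfInverse a θ c) {x : ℝ}
    (hx : x ∈ Set.Icc (-(61/10)) (0:ℝ)) : c 0 ≤ c x := by
  by_contra! hlt
  obtain ⟨m1, m2⟩ := hc.mem x ⟨hx.1, by linarith [hx.2]⟩
  obtain ⟨m3, m4⟩ := hc.mem 0 (by norm_num)
  have := prof_sub_ge (a := a) (θ := θ) ha hθ (by linarith [m1.1] : 0 < c x) hlt.le m3.2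
  rw [m2, m4] at this
  linarith [hx.2]

theorem ProfInverse.sidePattern_neg {c : ℝ → ℝ} (hc : ProfInverse a θ c) {N r : ℝ} (hN : N = 1 ∨ 2 ≤ N)
    (hr : r ≤ 6) (hs : |N ^ 2 * (1 - c 0)| ≤ 9/16) :
    SidePattern N r (fun σ => -(-1 / N * (1 / profW a θ (c (-1 * σ / N))))) := by
  have hN1 : 1 ≤ N := by rcases hN with rfl | h <;> linarith
  have hN0 : 0 < N := by linarith
  have hx : ∀ σ ∈ Set.Ioc 0 r, -1 * σ / N ∈ Set.Ioo (-(61/10)) (81/100 : ℝ) := fun σ hσ => by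
    have h1 : -1 * σ / N < 0 := div_neg_of_neg_of_pos (by linarith [hσ.1]) hN0
    exact ⟨by rw [lt_div_iff₀ hN0]; linarith [hσ.2], by linarith⟩
  have e : ∀ w, N * -(-1 / N * w) = w := fun w => by field_simp
  refine Or.inr ?_
  rcases hN with rfl | hN2
  · refine Or.inr fun σ hσ => ?_
    obtain ⟨m1, m2⟩ := hc.mem _ (Set.Ioo_subset_Icc_self (hx σ hσ))
    have hb := profW_bounds ha ha' hθ hθ' m1
    rw [e]
    have hb3 := hb.2.2.1
    generalize c (-1 * σ / 1) = A at *
    rw [prof] at m2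
    have h1 : √(1 + a * A) ≤ 102/100 := (Real.sqrt_le_left (by norm_num)).2 (by nlinarith [m1.2])
    have h2 : (0:ℝ) < √(1 + a * A) := Real.sqrt_pos.2 (by nlinarith [m1.1])
    have h3 : 3 / (2 * (102/100)) ≤ θ / (2 * √(1 + a * A)) := by gcongr
    norm_num at h3 m2 hb3 ⊢
    linarith
  · refine Or.inl ⟨_, fun σ hσ => ⟨?_, hc.hasDerivAt_slope ha ha' hθ (Or.inr rfl) hN1 (hx σ hσ), ?_⟩⟩
    all_goals have hb := profW_bounds ha ha' hθ hθ' (hc.mem _ (Set.Ioo_subset_Icc_self (hx σ hσ))).1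
    · rw [e]
      have h0 := hc.le_of_nonpos ha ha' hθ (x := -1 * σ / N) ⟨(hx σ hσ).1.le,
        (div_neg_of_neg_of_pos (by linarith [hσ.1]) hN0).le⟩
      rw [abs_mul, abs_of_pos (by positivity)] at hs
      have hN4 : 4 ≤ N ^ 2 := by nlinarith
      have h1 : |1 - c 0| ≤ 9/64 := by nlinarith [abs_nonneg (1 - c 0)]
      have h2 := (abs_le.1 h1).2
      have h3 : 9/10 ≤ √(c (-1 * σ / N)) := Real.le_sqrt_of_sq_le (by linarith)
      linarith [hb.2.2.1]
    · have h1 := neg_le_of_abs_le hb.2.2.2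
      rw [neg_le, le_div_iff₀ (by positivity)]
      nlinarith
end

/-- The `Υ`-integral with its full phase. -/
noncomputable def fullSlice (g : ℝ → ℝ → ℂ) (ν d σ : ℝ) : ℂ :=
  ∫ Υ in (-3:ℝ)..3, Complex.exp (I * ((ν * (σ * (Υ - σ/2)^2 - d * Υ) : ℝ) : ℂ)) * g σ Υ

theorem fullSlice_eq (g : ℝ → ℝ → ℂ) (ν d : ℝ) {σ : ℝ} (hσ : σ ≠ 0) :
    fullSlice g ν d σ =
      Complex.exp (I * ((ν * (-(d * σ / 2) - d ^ 2 / (4 * σ)) : ℝ) : ℂ)) * sliceInt g ν d σ := by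
  rw [fullSlice, sliceInt, ← intervalIntegral.integral_const_mul]
  congr 1
  ext Υ
  rw [sliceExp, ← mul_assoc, ← Complex.exp_add, ← mul_add, ← Complex.ofReal_add]
  congr 4
  field_simp
  ring

theorem SmoothSlice.continuous_fullSlice {K : ℝ} {g gσ gΥ gσΥ gΥΥ : ℝ → ℝ → ℂ}
    (h : SmoothSlice K g gσ gΥ gσΥ gΥΥ) (ν d : ℝ) : Continuous (fullSlice g ν d) := by
  refine intervalIntegral.continuous_parametric_intervalIntegral_of_continuous'
    (f := fun σ Υ => Complex.exp (I * ((ν * (σ * (Υ - σ/2)^2 - d * Υ) : ℝ) : ℂ)) * g σ Υ) ?_ _ _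
  have := h.cont
  unfold Function.uncurry
  fun_prop

theorem SmoothSlice.norm_fullSlice_le {K : ℝ} {g gσ gΥ gσΥ gΥΥ : ℝ → ℝ → ℂ}
    (h : SmoothSlice K g gσ gΥ gσΥ gΥΥ) {ν σ : ℝ} (hν : 0 < ν) (hσ : 0 < σ) (hσ' : σ ≤ 6) (d : ℝ) :
    ‖fullSlice g ν d σ‖ ≤ 70 * K / √(ν * σ) := by
  rw [fullSlice_eq g ν d hσ.ne', norm_mul, Complex.norm_exp_I_mul_ofReal, one_mul]
  exact h.norm_sliceInt_le hν hσ hσ' d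

theorem SmoothSlice.mono {K K' : ℝ} {g gσ gΥ gσΥ gΥΥ : ℝ → ℝ → ℂ}
    (h : SmoothSlice K g gσ gΥ gσΥ gΥΥ) (hK : K ≤ K') : SmoothSlice K' g gσ gΥ gσΥ gΥΥ :=
  { h with
    bound := fun σ hσ Υ hΥ =>
      let ⟨h1, h2, h3, h4, h5⟩ := h.bound σ hσ Υ hΥ
      ⟨h1.trans hK, h2.trans hK, h3.trans hK, h4.trans hK, h5.trans hK⟩ }

/-- Bound for the `σ`-integral over `(0, r]`, when the `A`-integral `E` is `e^{iΛΘ} F`. -/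
theorem SideData.norm_integral_le {Λ N c0 C r : ℝ} {cc c₁ Θ : ℝ → ℝ} {F E : ℝ → ℂ}
    (h : SideData Λ N c0 C r cc c₁ Θ F) {K Q : ℝ} {g gσ gΥ gσΥ gΥΥ : ℝ → ℝ → ℂ}
    (hg : SmoothSlice K g gσ gΥ gσΥ gΥΥ) (hK : 1 ≤ K) (d : ℝ) (hp : SidePattern N r c₁)
    (hQ : AdmissibleGain (Λ / N ^ 3) (N ^ 2 * (1 - c0)) Q)
    (hE : ∀ σ, E σ = Complex.exp (I * ((Λ * Θ σ : ℝ) : ℂ)) * F σ) :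
    ‖∫ σ in (0:ℝ)..r, Complex.exp (I * ((Λ * (σ ^ 3 / 12 + σ) : ℝ) : ℂ)) *
      (fullSlice g Λ d σ * E σ)‖ ≤ 40000000 * K * C * (Λ ^ (-(4:ℝ)/3) * Q) := by
  refine le_trans (le_of_eq ?_) (h.norm_le hg hK d hp hQ)
  congr 1
  rw [intervalIntegral.integral_of_le h.hr.le, intervalIntegral.integral_of_le h.hr.le]
  refine setIntegral_congr_fun measurableSet_Ioc fun σ hσ => ?_
  rw [fullSlice_eq g Λ d hσ.1.ne', hE]
  have e : ∀ A B C' s f : ℂ, A * (B * s * (C' * f)) = A * B * C' * (s * f) := fun _ _ _ _ _ => by ring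
  rw [e, ← Complex.exp_add, ← Complex.exp_add, ← mul_add, ← mul_add, ← Complex.ofReal_add,
    ← Complex.ofReal_add]
  congr 4
  rw [sidePhase]
  ring

theorem norm_integrand_le_of_large {a θ : ℝ} (ha : 0 < a) (hθ : 3 ≤ θ) (hθ' : θ ≤ 51/10)
    {Λ N K G σ : ℝ} {q : ℝ → ℂ} {g gσ gΥ gσΥ gΥΥ : ℝ → ℝ → ℂ}
    (hg : SmoothSlice K g gσ gΥ gσΥ gΥΥ) (hK : 1 ≤ K) (hN : 1 ≤ N) (hΛ : 1 ≤ Λ)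
    (hq : BddC2 (Set.Icc (4/5) 7) G q) (d : ℝ) (hσ : 4/5 * N ≤ σ) (hσ' : σ ≤ 6) :
    ‖fullSlice g Λ d σ * profIntegral a θ q (Λ * N) (1 * σ / N)‖ ≤
      60000 * K * G * Λ ^ (-(4:ℝ)/3) := by
  obtain ⟨g₁, g₂, hq'⟩ := hq
  have hG : 0 ≤ G := (norm_nonneg _).trans (hq' 1 (by norm_num)).2.2.1
  have hN0 : 0 < N := by linarith
  have hΛ0 : 0 < Λ := by linarith
  have hσ1 : 4/5 ≤ σ := by linarith
  have hσ0 : 0 < σ := by linarith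
  have hxl : 4/5 ≤ 1 * σ / N := by rw [le_div_iff₀ hN0]; linarith
  have h1 := hg.norm_fullSlice_le hΛ0 hσ0 hσ' d
  have h2 := norm_profIntegral_le_of_large ha hθ hθ' (μ := Λ * N) (by positivity) hxl
    (fun A hA => (hq' A hA).1.differentiableAt) (fun A hA => (hq' A hA).2.2.1)
    (fun A hA => by rw [(hq' A hA).1.deriv]; exact (hq' A hA).2.2.2.1)
  rw [show Λ * N * (1 * σ / N) = Λ * σ by field_simp] at h2
  have h3 : Λ * (4/5) ≤ Λ * σ := by gcongr
  have h4 : 4/5 * √Λ ≤ √(Λ * σ) := by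
    refine Real.le_sqrt_of_sq_le ?_
    rw [mul_pow, Real.sq_sqrt hΛ0.le]
    linarith
  have h5 : Λ ^ ((3:ℝ)/2) = √Λ * Λ := by
    rw [Real.sqrt_eq_rpow, ← Real.rpow_add_one' hΛ0.le (by norm_num)]
    norm_num
  have h6 : (Λ ^ ((3:ℝ)/2))⁻¹ ≤ Λ ^ (-(4:ℝ)/3) := by
    rw [← Real.rpow_neg hΛ0.le]
    exact Real.rpow_le_rpow_of_exponent_le hΛ (by norm_num)
  rw [h5] at h6
  have hsΛ := Real.sqrt_pos.2 hΛ0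
  have h7 : 70 * K / √(Λ * σ) ≤ 70 * K / (4/5 * √Λ) := by gcongr
  have h8 : 500 * G / (Λ * σ) ≤ 500 * G / (Λ * (4/5)) := by gcongr
  rw [norm_mul]
  calc _ ≤ (70 * K / (4/5 * √Λ)) * (500 * G / (Λ * (4/5))) :=
        mul_le_mul (h1.trans h7) (h2.trans h8) (norm_nonneg _) (by positivity)
    _ = 875000/16 * K * G * (√Λ * Λ)⁻¹ := by field_simp; ring
    _ ≤ 60000 * K * G * (√Λ * Λ)⁻¹ := by gcongr; norm_num
    _ ≤ 60000 * K * G * Λ ^ (-(4:ℝ)/3) := by gcongr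

section
variable {a θ : ℝ} (ha : 0 < a) (ha' : a ≤ 1/1000) (hθ : 3 ≤ θ) (hθ' : θ ≤ 51/10)
  {c : ℝ → ℝ} (hc : ProfInverse a θ c) {Λ N K C Q : ℝ} {q : ℝ → ℂ}
  {g gσ gΥ gσΥ gΥΥ : ℝ → ℝ → ℂ}
  (hg : SmoothSlice K g gσ gΥ gσΥ gΥΥ) (hK : 1 ≤ K) (hC : 1 ≤ C) (hM : N ^ 3 / 2 ≤ Λ)
  (hF : ∀ x ∈ Set.Ioo (-(61/10)) (81/100 : ℝ), ‖profAmp a θ c q (Λ * N) x‖ ≤ C / √(Λ * N) ∧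
    ∃ F', HasDerivAt (profAmp a θ c q (Λ * N)) F' x ∧ ‖F'‖ ≤ C / √(Λ * N))
  (hQ : AdmissibleGain (Λ / N ^ 3) (N ^ 2 * (1 - c 0)) Q)
include ha ha' hθ hθ' hc hg hK hC hM hF hQ

theorem norm_integral_side_neg (hN : N = 1 ∨ 2 ≤ N) (hs : |N ^ 2 * (1 - c 0)| ≤ 9/16) (d : ℝ) :
    ‖∫ σ in (0:ℝ)..6, Complex.exp (I * ((Λ * (σ ^ 3 / 12 + σ) : ℝ) : ℂ)) *
      (fullSlice g Λ d σ * (starRingEnd ℂ) (profIntegral a θ q (Λ * N) (-1 * σ / N)))‖ ≤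
      40000000 * K * C * (Λ ^ (-(4:ℝ)/3) * Q) := by
  have hN1 : 1 ≤ N := by rcases hN with rfl | h <;> linarith
  have hN0 : 0 < N := by linarith
  have hx : ∀ σ ∈ Set.Ioc (0:ℝ) 6, -1 * σ / N ∈ Set.Ioo (-(61/10)) (81/100 : ℝ) := fun σ hσ => by
    have h1 : -1 * σ / N < 0 := div_neg_of_neg_of_pos (by linarith [hσ.1]) hN0
    exact ⟨by rw [lt_div_iff₀ hN0]; linarith [hσ.2], by linarith⟩
  refine (hc.sideData ha ha' hθ hθ' (Or.inr rfl) hN1 hM (by norm_num) le_rfl hC (by linarith) hx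
    (F := fun σ => (starRingEnd ℂ) (profAmp a θ c q (Λ * N) (-1 * σ / N))) ?_).norm_integral_le hg hK d
    (hc.sidePattern_neg ha ha' hθ hθ' hN le_rfl hs) hQ ?_
  · intro σ hσ
    obtain ⟨f1, F', f2, f3⟩ := hF _ (hx σ hσ)
    have hd : HasDerivAt (fun σ => -1 * σ / N) (-1 / N) σ := by
      simpa using ((hasDerivAt_id σ).const_mul (-1)).div_const N
    refine ⟨by rwa [Complex.norm_conj], _, (f2.scomp σ hd).star, ?_⟩
    rw [norm_star, norm_smul, norm_div, norm_neg, norm_one, Real.norm_of_nonneg hN0.le,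
      one_div, inv_mul_eq_div]
    gcongr
  · intro σ
    rw [profIntegral_eq a θ c, map_mul, ← Complex.exp_conj, map_mul, Complex.conj_I,
      Complex.conj_ofReal, profCrit]
    congr 2
    push_cast
    ring

theorem norm_integral_side_pos {G : ℝ} (hN : 1 ≤ N) (hΛ : 1 ≤ Λ) (hs : |N ^ 2 * (1 - c 0)| ≤ 1)
    (hq : BddC2 (Set.Icc (4/5) 7) G q) (d : ℝ) :
    ‖∫ σ in (0:ℝ)..6, Complex.exp (I * ((Λ * (σ ^ 3 / 12 + σ) : ℝ) : ℂ)) *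
      (fullSlice g Λ d σ * profIntegral a θ q (Λ * N) (1 * σ / N))‖ ≤
      (40000000 * K * C + 720000 * K * G) * (Λ ^ (-(4:ℝ)/3) * Q) := by
  have hN0 : 0 < N := by linarith
  have hΛ0 : 0 < Λ := by linarith
  have hQ2 : 1/2 ≤ Q := hQ.half_le (by rw [le_div_iff₀ (by positivity)]; linarith) hs
  obtain ⟨g₁, g₂, hq'⟩ := id hq
  have hG : 0 ≤ G := (norm_nonneg _).trans (hq' 1 (by norm_num)).2.2.1
  obtain ⟨r, hr⟩ : ∃ r, r = min 6 (4/5 * N) := ⟨_, rfl⟩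
  have hr0 : 0 < r := by rw [hr]; exact lt_min (by norm_num) (by linarith)
  have hr6 : r ≤ 6 := hr ▸ min_le_left _ _
  have hrN : r ≤ 4/5 * N := hr ▸ min_le_right _ _
  have hd : ∀ σ, HasDerivAt (fun σ => 1 * σ / N) (1 / N) σ := fun σ => by
    simpa using ((hasDerivAt_id σ).const_mul 1).div_const N
  have hqc : ContinuousOn q (Set.Icc (4/5) 7) := fun A hA =>
    (hq' A hA).1.continuousAt.continuousWithinAt
  have hcP : Continuous (profIntegral a θ q (Λ * N)) :=
    continuous_iff_continuousAt.2 fun x => (hasDerivAt_profIntegral ha hqc _ x).continuousAt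
  have hcE : Continuous (fun σ => profIntegral a θ q (Λ * N) (1 * σ / N)) := by fun_prop
  have hcD := hg.continuous_fullSlice Λ d
  have hcI : Continuous fun σ : ℝ => Complex.exp (I * ((Λ * (σ ^ 3 / 12 + σ) : ℝ) : ℂ)) *
      (fullSlice g Λ d σ * profIntegral a θ q (Λ * N) (1 * σ / N)) := by fun_prop
  rw [← intervalIntegral.integral_add_adjacent_intervals (hcI.intervalIntegrable 0 r)
    (hcI.intervalIntegrable r 6)]
  have hx : ∀ σ ∈ Set.Ioc (0:ℝ) r, 1 * σ / N ∈ Set.Ioo (-(61/10)) (81/100 : ℝ) := fun σ hσ => by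
    have h1 : 0 < 1 * σ / N := div_pos (by linarith [hσ.1]) hN0
    exact ⟨by linarith, by rw [div_lt_iff₀ hN0]; linarith [hσ.2]⟩
  have hb1 := (hc.sideData ha ha' hθ hθ' (Or.inl rfl) hN hM hr0 hr6 hC hs hx
    (F := fun σ => profAmp a θ c q (Λ * N) (1 * σ / N)) (by
      intro σ hσ
      obtain ⟨f1, F', f2, f3⟩ := hF _ (hx σ hσ)
      have f4 := HasDerivAt.scomp σ f2 (hd σ)
      refine ⟨f1, _, f4, ?_⟩
      rw [norm_smul, norm_div, norm_one, Real.norm_of_nonneg hN0.le, one_div, inv_mul_eq_div]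
      gcongr)).norm_integral_le hg hK d
    (hc.sidePattern_pos ha ha' hθ hθ' hN hx) hQ
    (E := fun σ => profIntegral a θ q (Λ * N) (1 * σ / N)) (by
      intro σ
      rw [profIntegral_eq a θ c, profCrit]
      congr 4
      ring)
  have hb2 : ‖∫ σ in r..6, Complex.exp (I * ((Λ * (σ ^ 3 / 12 + σ) : ℝ) : ℂ)) *
      (fullSlice g Λ d σ * profIntegral a θ q (Λ * N) (1 * σ / N))‖ ≤
      60000 * K * G * Λ ^ (-(4:ℝ)/3) * |6 - r| := by
    refine intervalIntegral.norm_integral_le_of_norm_le_const fun σ hσ => ?_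
    rw [Set.uIoc_of_le hr6] at hσ
    have hrr : r = 4/5 * N := by
      rcases min_choice 6 (4/5 * N) with h | h
      · linarith [hσ.1, hσ.2]
      · rw [hr, h]
    rw [norm_mul, Complex.norm_exp_I_mul_ofReal, one_mul]
    exact norm_integrand_le_of_large ha hθ hθ' hg hK hN hΛ hq d (hrr ▸ hσ.1.le) hσ.2
  have hP := Real.rpow_nonneg hΛ0.le (-(4:ℝ)/3)
  have h7 : 60000 * K * G * Λ ^ (-(4:ℝ)/3) * |6 - r| ≤ 720000 * K * G * (Λ ^ (-(4:ℝ)/3) * Q) := by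
    rw [abs_of_nonneg (by linarith)]
    calc 60000 * K * G * Λ ^ (-(4:ℝ)/3) * (6 - r) ≤ 60000 * K * G * Λ ^ (-(4:ℝ)/3) * (12 * Q) := by
          gcongr
          linarith
      _ = _ := by ring
  calc _ ≤ _ := norm_add_le _ _
    _ ≤ _ := add_le_add hb1 (hb2.trans h7)
    _ = _ := by ring
end

theorem conj_fullSlice_neg (g : ℝ → ℝ → ℂ) (ν d σ : ℝ) :
    (starRingEnd ℂ) (fullSlice g ν d (-σ)) =
      fullSlice (fun σ Υ => (starRingEnd ℂ) (g (-σ) (-Υ))) ν d σ := by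
  rw [fullSlice, fullSlice, ← intervalIntegral.intervalIntegral_conj]
  have h := intervalIntegral.integral_comp_neg (a := -3) (b := 3) (fun Υ : ℝ =>
    (starRingEnd ℂ) (Complex.exp (I * ((ν * (-σ * (Υ - -σ/2)^2 - d * Υ) : ℝ) : ℂ)) * g (-σ) Υ))
  rw [neg_neg] at h
  rw [← h]
  congr 1
  ext Υ
  rw [map_mul, ← Complex.exp_conj, map_mul, Complex.conj_I, Complex.conj_ofReal]
  congr 2
  push_cast
  ring

/-- The `σ`-integral obtained after integrating out the remaining variables. -/
noncomputable def sigmaInt (a θ N Λ d : ℝ) (g : ℝ → ℝ → ℂ) (q : ℝ → ℂ) : ℂ :=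
  ∫ σ in (-6:ℝ)..6, Complex.exp (I * ((Λ * (σ ^ 3 / 12 + σ) : ℝ) : ℂ)) *
    (fullSlice g Λ d σ * profIntegral a θ q (Λ * N) (σ / N))

theorem norm_sigmaInt_le_add {a θ : ℝ} (ha : 0 < a) (N Λ d : ℝ) {K : ℝ} {g gσ gΥ gσΥ gΥΥ : ℝ → ℝ → ℂ}
    (hg : SmoothSlice K g gσ gΥ gσΥ gΥΥ) {q : ℝ → ℂ} (hq : ContinuousOn q (Set.Icc (4/5) 7)) :
    ‖sigmaInt a θ N Λ d g q‖ ≤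
      ‖∫ σ in (0:ℝ)..6, Complex.exp (I * ((Λ * (σ ^ 3 / 12 + σ) : ℝ) : ℂ)) *
        (fullSlice (fun σ Υ => (starRingEnd ℂ) (g (-σ) (-Υ))) Λ d σ *
          (starRingEnd ℂ) (profIntegral a θ q (Λ * N) (-1 * σ / N)))‖ +
      ‖∫ σ in (0:ℝ)..6, Complex.exp (I * ((Λ * (σ ^ 3 / 12 + σ) : ℝ) : ℂ)) *
        (fullSlice g Λ d σ * profIntegral a θ q (Λ * N) (1 * σ / N))‖ := by
  have hcP : Continuous (profIntegral a θ q (Λ * N)) :=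
    continuous_iff_continuousAt.2 fun x => (hasDerivAt_profIntegral ha hq _ x).continuousAt
  have hcD := hg.continuous_fullSlice Λ d
  have hcI : Continuous fun σ : ℝ => Complex.exp (I * ((Λ * (σ ^ 3 / 12 + σ) : ℝ) : ℂ)) *
      (fullSlice g Λ d σ * profIntegral a θ q (Λ * N) (σ / N)) := by fun_prop
  rw [sigmaInt, ← intervalIntegral.integral_add_adjacent_intervals (hcI.intervalIntegrable (-6) 0)
    (hcI.intervalIntegrable 0 6)]
  refine (norm_add_le _ _).trans (add_le_add (le_of_eq ?_) (le_of_eq ?_))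
  · rw [← Complex.norm_conj, ← intervalIntegral.intervalIntegral_conj]
    have h := intervalIntegral.integral_comp_neg (a := 0) (b := 6) (fun σ : ℝ =>
      (starRingEnd ℂ) (Complex.exp (I * ((Λ * (σ ^ 3 / 12 + σ) : ℝ) : ℂ)) *
        (fullSlice g Λ d σ * profIntegral a θ q (Λ * N) (σ / N))))
    rw [neg_zero] at h
    rw [← h]
    congr 2
    ext σ
    rw [map_mul, map_mul, conj_fullSlice_neg, ← Complex.exp_conj, map_mul, Complex.conj_I,
      Complex.conj_ofReal, neg_one_mul]
    congr 2
    push_cast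
    ring
  · simp only [one_mul]

theorem exists_sigmaInt_bound {K G : ℝ} (hK : 1 ≤ K) (hG : 0 ≤ G) : ∃ C : ℝ, 0 ≤ C ∧
    ∀ a θ : ℝ, 0 < a → a ≤ 1/1000 → 3 ≤ θ → θ ≤ 51/10 →
    ∃ c0 : ℝ, c0 ∈ Set.Icc (1/10) 20 ∧ prof a θ c0 = 0 ∧
    ∀ (N Λ d Q : ℝ) (q : ℝ → ℂ) (g gσ gΥ gσΥ gΥΥ g' gσ' gΥ' gσΥ' gΥΥ' : ℝ → ℝ → ℂ),
      (N = 1 ∨ 2 ≤ N) → N ^ 3 / 2 ≤ Λ → 1 ≤ Λ → |N ^ 2 * (1 - c0)| ≤ 9/16 →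
      BddC2 (Set.Icc (4/5) 7) G q → q (4/5) = 0 → q 7 = 0 →
      SmoothSlice K g gσ gΥ gσΥ gΥΥ → SmoothSlice K g' gσ' gΥ' gσΥ' gΥΥ' →
      (g' = fun σ Υ => (starRingEnd ℂ) (g (-σ) (-Υ))) →
      AdmissibleGain (Λ / N ^ 3) (N ^ 2 * (1 - c0)) Q →
      ‖sigmaInt a θ N Λ d g q‖ ≤ C * (Λ ^ (-(4:ℝ)/3) * Q) := by
  obtain ⟨C, hC, hamp⟩ := exists_profAmp_bound hG
  refine ⟨80000000 * K * (C + 1) + 720000 * K * G, by positivity, fun a θ ha ha' hθ hθ' => ?_⟩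
  obtain ⟨c, hc1, hc2, hc3⟩ := exists_prof_inverse ha hθ ha' hθ'
  have hc : ProfInverse a θ c := ⟨hc1, hc2, hc3⟩
  obtain ⟨m1, m2⟩ := hc1 0 (by norm_num)
  refine ⟨c 0, m1, m2, ?_⟩
  intro N Λ d Q q g gσ gΥ gσΥ gΥΥ g' gσ' gΥ' gσΥ' gΥΥ' hN hM hΛ hs hq q1 q2 hg hg' hgg hQ
  have hN1 : 1 ≤ N := by rcases hN with rfl | h <;> linarith
  have hμ : 0 < Λ * N := by positivity
  have hF : ∀ x ∈ Set.Ioo (-(61/10)) (81/100 : ℝ),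
      ‖profAmp a θ c q (Λ * N) x‖ ≤ (C + 1) / √(Λ * N) ∧
      ∃ F', HasDerivAt (profAmp a θ c q (Λ * N)) F' x ∧ ‖F'‖ ≤ (C + 1) / √(Λ * N) := by
    intro x hx
    obtain ⟨n1, n2⟩ := hc1 x (Set.Ioo_subset_Icc_self hx)
    obtain ⟨b1, F', b2, b3⟩ := hamp a θ c q (Λ * N) x _ ha ha' hθ hθ' hμ n1 n2 (hc3 x hx) hq q1 q2
    have hle : C / √(Λ * N) ≤ (C + 1) / √(Λ * N) := by gcongr; linarith
    exact ⟨b1.trans hle, F', b2, b3.trans hle⟩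
  have hqc : ContinuousOn q (Set.Icc (4/5) 7) := by
    obtain ⟨g₁, g₂, hq'⟩ := hq
    exact fun A hA => (hq' A hA).1.continuousAt.continuousWithinAt
  have hneg := norm_integral_side_neg ha ha' hθ hθ' hc hg' hK (by linarith : 1 ≤ C + 1) hM hF hQ hN hs d
  have hpos := norm_integral_side_pos ha ha' hθ hθ' hc hg hK (by linarith : 1 ≤ C + 1) hM hF hQ hN1 hΛ
    (by linarith) hq d
  rw [hgg] at hneg
  refine (norm_sigmaInt_le_add ha N Λ d hg hqc).trans ((add_le_add hneg hpos).trans (le_of_eq ?_))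
  ring

theorem exists_admissibleGain {M s x y : ℝ} (hM : 0 < M) (hx : 0 < x)
    (hxM : x ≤ 2 * M ^ (-(1:ℝ)/12)) (hy : 0 ≤ y) (hys : y ≤ 2 * |s| ^ ((1:ℝ)/6)) :
    ∃ Q, AdmissibleGain M s Q ∧ Q ≤ 6 / (x + y) := by
  have hP : 0 < M ^ ((1:ℝ)/12) := Real.rpow_pos_of_pos hM _
  have hPi : M ^ (-(1:ℝ)/12) = (M ^ ((1:ℝ)/12))⁻¹ := by rw [← Real.rpow_neg hM.le]; norm_num
  have h6 : ∀ t : ℝ, 0 ≤ t → (t ^ ((1:ℝ)/6)) ^ 6 = t := fun t ht => by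
    rw [← Real.rpow_natCast, ← Real.rpow_mul ht]; norm_num
  have h12 : (M ^ ((1:ℝ)/12)) ^ 12 = M := by
    rw [← Real.rpow_natCast, ← Real.rpow_mul hM.le]; norm_num
  have hS : 0 ≤ |s| ^ ((1:ℝ)/6) := Real.rpow_nonneg (abs_nonneg s) _
  have hS6 := h6 |s| (abs_nonneg s)
  by_cases h : 1 ≤ M * (|s| / 50) ^ 2
  · have hs : 0 < |s| := by
      rcases (abs_nonneg s).eq_or_lt with h0 | h0
      · rw [← h0] at h; norm_num at h
      · exact h0
    have hS0 : 0 < |s| ^ ((1:ℝ)/6) := Real.rpow_pos_of_pos hs _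
    have hSi : |s| ^ (-(1:ℝ)/6) = (|s| ^ ((1:ℝ)/6))⁻¹ := by rw [← Real.rpow_neg hs.le]; norm_num
    refine ⟨_, Or.inr ⟨hs, h, rfl⟩, ?_⟩
    have hk : (M ^ ((1:ℝ)/12))⁻¹ ≤ |s| ^ ((1:ℝ)/6) := by
      rw [inv_le_iff_one_le_mul₀ hP]
      refine (one_le_pow_iff_of_nonneg (by positivity) (n := 12) (by norm_num)).1 ?_
      rw [mul_pow, h12, show (|s| ^ ((1:ℝ)/6)) ^ 12 = ((|s| ^ ((1:ℝ)/6)) ^ 6) ^ 2 by ring, hS6]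
      nlinarith [sq_nonneg s, sq_abs s]
    rw [hSi, inv_eq_one_div, div_le_div_iff₀ hS0 (by linarith)]
    rw [hPi] at hxM
    linarith
  · push Not at h
    refine ⟨_, Or.inl rfl, ?_⟩
    have hk : |s| ^ ((1:ℝ)/6) ≤ 2 * (M ^ ((1:ℝ)/12))⁻¹ := by
      rw [← div_eq_mul_inv, le_div_iff₀ hP]
      refine (pow_le_pow_iff_left₀ (by positivity) (by norm_num) (n := 12) (by norm_num)).1 ?_
      rw [mul_pow, h12, show (|s| ^ ((1:ℝ)/6)) ^ 12 = ((|s| ^ ((1:ℝ)/6)) ^ 6) ^ 2 by ring, hS6]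
      nlinarith [sq_nonneg s, sq_abs s]
    rw [hPi] at hxM
    rw [le_div_iff₀ (by linarith), ← le_div_iff₀' hP]
    rw [div_eq_mul_inv]
    linarith

/-- The critical point at `x = 0` is at distance comparable to `|T - 4N| / N` from `1`. -/
theorem critical_point_near_one {a N T c0 : ℝ} (ha : 0 < a) (ha' : a ≤ 1/1000) (hN : 1 ≤ N)
    (hT : |T - 4 * N| ≤ 1 / N) :
    3 ≤ T * √(1 + a) / N ∧ T * √(1 + a) / N ≤ 51/10 ∧
    (c0 ∈ Set.Icc (1/10:ℝ) 20 → prof a (T * √(1 + a) / N) c0 = 0 →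
      |N ^ 2 * (1 - c0)| ≤ 9/16 ∧ |N * (T - 4 * N)| ≤ 4 * |N ^ 2 * (1 - c0)|) := by
  have hN0 : 0 < N := by linarith
  have hsa : √(1 + a) ^ 2 = 1 + a := Real.sq_sqrt (by linarith)
  have hsa1 : 1 ≤ √(1 + a) := Real.one_le_sqrt.2 (by linarith)
  have hsa2 : √(1 + a) ≤ 1001/1000 := (Real.sqrt_le_left (by norm_num)).2 (by nlinarith)
  obtain ⟨G, hG⟩ : ∃ G, T = 4 * N * G := ⟨T / (4 * N), by field_simp⟩
  have hTG : |T - 4 * N| = 4 * N * |G - 1| := by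
    rw [hG, show 4 * N * G - 4 * N = 4 * N * (G - 1) by ring, abs_mul, abs_of_pos (by positivity)]
  rw [hTG, le_div_iff₀ hN0] at hT
  have hG1 : N ^ 2 * |G - 1| ≤ 1/4 := by nlinarith
  have hG2 : |G - 1| ≤ 1/4 := by
    have : 1 ≤ N ^ 2 := one_le_pow₀ hN
    nlinarith [abs_nonneg (G - 1)]
  obtain ⟨g1, g2⟩ := abs_le.1 hG2
  have hθ : T * √(1 + a) / N = 4 * (G * √(1 + a)) := by rw [hG]; field_simp
  rw [hθ]
  refine ⟨by nlinarith, by nlinarith, fun hc hp => ?_⟩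
  have hc0 : 0 < c0 := by linarith [hc.1]
  have r1 : √(1 + a * c0) ^ 2 = 1 + a * c0 := Real.sq_sqrt (by positivity)
  have r2 : √c0 ^ 2 = c0 := Real.sq_sqrt hc0.le
  have r3 : 0 < √(1 + a * c0) := Real.sqrt_pos.2 (by positivity)
  have hp' : G * √(1 + a) = √c0 * √(1 + a * c0) := by
    rw [prof] at hp
    field_simp at hp
    linarith
  have hsq : G ^ 2 * (1 + a) = c0 * (1 + a * c0) := by
    have := congrArg (fun z => z ^ 2) hp'
    simpa only [mul_pow, hsa, r1, r2] using this
  have hk : (G - 1) * (G + 1) * (1 + a) = (c0 - 1) * (1 + a * (c0 + 1)) := by linarith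
  have hk2 : |G - 1| * ((G + 1) * (1 + a)) = |1 - c0| * (1 + a * (c0 + 1)) := by
    have := congrArg abs hk
    rw [mul_assoc, abs_mul (G - 1), abs_mul (c0 - 1), abs_of_pos (by nlinarith : 0 < (G + 1) * (1 + a)),
      abs_of_pos (by positivity : 0 < 1 + a * (c0 + 1)), abs_sub_comm c0 1] at this
    exact this
  have hN2 : |N ^ 2 * (1 - c0)| = N ^ 2 * |1 - c0| := by rw [abs_mul, abs_of_pos (by positivity)]
  have hNT : |N * (T - 4 * N)| = 4 * (N ^ 2 * |G - 1|) := by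
    rw [abs_mul, abs_of_pos hN0, hTG]; ring
  rw [hN2, hNT]
  have hk3 := congrArg (fun z => N ^ 2 * z) hk2
  rw [← mul_assoc, ← mul_assoc (N ^ 2)] at hk3
  have hv0 : 0 ≤ N ^ 2 * |1 - c0| := by positivity
  have hu0 : 0 ≤ N ^ 2 * |G - 1| := by positivity
  generalize N ^ 2 * |G - 1| = u at hk3 hG1 hu0 ⊢
  generalize N ^ 2 * |1 - c0| = v at hk3 hv0 ⊢
  have ac0 : a * c0 ≤ 20/1000 := by nlinarith [hc.2]
  have ac1 : 0 < a * c0 := by positivity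
  constructor
  · have h1 : v * (1 + a) ≤ u * (G + 1) * (1 + a) := by
      rw [mul_assoc u, hk3]
      exact mul_le_mul_of_nonneg_left (by linarith) hv0
    have h2 : v ≤ u * (G + 1) := le_of_mul_le_mul_right h1 (by linarith)
    have h3 : u * (G + 1) ≤ 1/4 * (9/4) := mul_le_mul hG1 (by linarith) (by linarith) (by norm_num)
    linarith
  · have h1 : u * (7/4) ≤ u * ((G + 1) * (1 + a)) :=
      mul_le_mul_of_nonneg_left (by nlinarith) hu0
    have h2 : v * (1 + a * (c0 + 1)) ≤ v * (103/100) :=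
      mul_le_mul_of_nonneg_left (by linarith) hv0
    linarith

theorem Bfun_eq (L : ℝ → ℝ) {κ A : ℝ} (hκ : 0 < κ) (hA : 0 < A) :
    Bfun L (κ ^ 3 * A ^ ((3:ℝ)/2)) = 4/3 * (κ ^ 3 * A ^ ((3:ℝ)/2)) + Real.pi / 2 - L (κ ^ 2 * A) := by
  rw [Bfun]
  congr 2
  rw [Real.mul_rpow (by positivity) (by positivity), ← Real.rpow_mul hA.le, ← Real.rpow_natCast κ 3,
    ← Real.rpow_mul hκ.le]
  norm_num

/-- The amplitude of the `A`-integral. -/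
noncomputable def reflAmp (L ψ₃ : ℝ → ℝ) (Λ N : ℝ) (A : ℝ) : ℂ :=
  Complex.exp (I * ((N * Bfun L (Λ * A ^ ((3:ℝ)/2)) : ℝ) : ℂ)) * (ψ₃ A : ℂ)

theorem bddC2_exp_of_phase {S : Set ℝ} {β β₁ β₂ : ℝ → ℝ} {N : ℝ} {f : ℝ → ℂ}
    (hf : ∀ A ∈ S, f =ᶠ[nhds A] fun A => Complex.exp (I * ((N * β A : ℝ) : ℂ)))
    (h1 : ∀ A ∈ S, HasDerivAt β (β₁ A) A) (h2 : ∀ A ∈ S, HasDerivAt β₁ (β₂ A) A)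
    (b1 : ∀ A ∈ S, |N * β₁ A| ≤ 3) (b2 : ∀ A ∈ S, |N * β₂ A| ≤ 30) : BddC2 S 40 f := by
  refine ⟨fun A => f A * (I * ((N * β₁ A : ℝ) : ℂ)),
    fun A => f A * (I * ((N * β₁ A : ℝ) : ℂ)) * (I * ((N * β₁ A : ℝ) : ℂ)) +
      f A * (I * ((N * β₂ A : ℝ) : ℂ)), fun A hA => ?_⟩
  have hd : HasDerivAt f (f A * (I * ((N * β₁ A : ℝ) : ℂ))) A := by
    have := (((h1 A hA).const_mul N).ofReal_comp.const_mul I).cexp.congr_of_eventuallyEq (hf A hA)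
    rwa [(hf A hA).eq_of_nhds]
  have hn : ‖f A‖ = 1 := by rw [(hf A hA).eq_of_nhds, Complex.norm_exp_I_mul_ofReal]
  have c1 := b1 A hA
  have c2 := b2 A hA
  have hI : ∀ x : ℝ, ‖I * (x : ℂ)‖ = |x| := fun x => by simp
  refine ⟨hd, hd.mul (((h2 A hA).const_mul N).ofReal_comp.const_mul I), by rw [hn]; norm_num, ?_, ?_⟩
  · rw [norm_mul, hn, hI]
    linarith
  · refine (norm_add_le _ _).trans ?_
    rw [norm_mul (f A * _), norm_mul (f A), norm_mul (f A), hn, hI, hI]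
    nlinarith [abs_nonneg (N * β₁ A)]

theorem bddC2_reflection {L L₁ L₂ : ℝ → ℝ} (h1 : ∀ ω, 0 < ω → HasDerivAt L (L₁ ω) ω)
    (h2 : ∀ ω, 0 < ω → HasDerivAt L₁ (L₂ ω) ω)
    (b1 : ∀ ω, 1 ≤ ω → |2 * √ω - L₁ ω| ≤ 1 / (ω * √ω))
    (b2 : ∀ ω, 1 ≤ ω → |1 / √ω - L₂ ω| ≤ 8 / (ω ^ 2 * √ω)) {Λ N : ℝ} (hΛ : 2 ≤ Λ)
    (hN : |N| ^ 3 / 2 ≤ Λ) :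
    BddC2 (Set.Icc (4/5) 7) 40
      (fun A => Complex.exp (I * ((N * Bfun L (Λ * A ^ ((3:ℝ)/2)) : ℝ) : ℂ))) := by
  obtain ⟨κ, hκ0, hκ⟩ : ∃ κ : ℝ, 0 < κ ∧ κ ^ 3 = Λ := by
    refine ⟨Λ ^ ((1:ℝ)/3), Real.rpow_pos_of_pos (by linarith) _, ?_⟩
    rw [← Real.rpow_natCast, ← Real.rpow_mul (by linarith)]
    norm_num
  have hκ1 : 5/4 ≤ κ := by
    by_contra! h
    have : κ ^ 3 < (5/4) ^ 3 := pow_lt_pow_left₀ h hκ0.le (by norm_num)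
    norm_num at this
    linarith
  have hNκ : |N| ≤ 2 * κ := by
    refine (pow_le_pow_iff_left₀ (abs_nonneg _) (by positivity) (n := 3) (by norm_num)).1 ?_
    rw [mul_pow, hκ]
    linarith
  refine bddC2_exp_of_phase (N := N)
    (β := fun A => 4/3 * (κ ^ 3 * A ^ ((3:ℝ)/2)) + Real.pi / 2 - L (κ ^ 2 * A))
    (β₁ := fun A => 2 * κ ^ 3 * √A - κ ^ 2 * L₁ (κ ^ 2 * A))
    (β₂ := fun A => κ ^ 3 / √A - κ ^ 4 * L₂ (κ ^ 2 * A)) ?_ ?_ ?_ ?_ ?_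
  all_goals intro A hA
  all_goals have hA0 : 0 < A := by linarith [hA.1]
  all_goals have hsA : 0 < √A := Real.sqrt_pos.2 hA0
  all_goals have hsq : √A ^ 2 = A := Real.sq_sqrt hA0.le
  all_goals have hω : 1 ≤ κ ^ 2 * A := by nlinarith [hA.1]
  all_goals have hω0 : 0 < κ ^ 2 * A := by linarith
  all_goals have hsω : √(κ ^ 2 * A) = κ * √A := by rw [Real.sqrt_mul (by positivity), Real.sqrt_sq hκ0.le]
  all_goals have hlin : HasDerivAt (fun A => κ ^ 2 * A) (κ ^ 2) A :=
    ((hasDerivAt_id A).const_mul (κ ^ 2)).congr_deriv (mul_one _)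
  · filter_upwards [lt_mem_nhds hA0] with x hx
    rw [← hκ, Bfun_eq L hκ0 hx]
  · have e := ((((Real.hasDerivAt_rpow_const (p := (3:ℝ)/2) (Or.inl hA0.ne')).const_mul
      (κ ^ 3)).const_mul (4/3)).add_const (Real.pi / 2)).sub ((h1 _ hω0).comp A hlin)
    refine e.congr_deriv ?_
    rw [show (3:ℝ)/2 - 1 = 1/2 by norm_num, ← Real.sqrt_eq_rpow]
    ring
  · have e := ((Real.hasDerivAt_sqrt hA0.ne').const_mul (2 * κ ^ 3)).sub
      (((h2 _ hω0).comp A hlin).const_mul (κ ^ 2))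
    refine e.congr_deriv ?_
    field_simp
  · have h := b1 _ hω
    rw [hsω] at h
    have e : 2 * κ ^ 3 * √A - κ ^ 2 * L₁ (κ ^ 2 * A) = κ ^ 2 * (2 * (κ * √A) - L₁ (κ ^ 2 * A)) := by ring
    rw [e, abs_mul, abs_mul, abs_of_pos (by positivity : 0 < κ ^ 2)]
    have hs2 : 89/100 ≤ √A := Real.le_sqrt_of_sq_le (by linarith [hA.1])
    have h64 : 7/10 ≤ A * √A := by nlinarith [hA.1]
    calc |N| * (κ ^ 2 * |2 * (κ * √A) - L₁ (κ ^ 2 * A)|)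
        ≤ 2 * κ * (κ ^ 2 * (1 / (κ ^ 2 * A * (κ * √A)))) := by gcongr
      _ = 2 / (A * √A) := by field_simp
      _ ≤ 3 := by rw [div_le_iff₀ (by positivity)]; nlinarith
  · have h := b2 _ hω
    rw [hsω] at h
    have e : κ ^ 3 / √A - κ ^ 4 * L₂ (κ ^ 2 * A) = κ ^ 4 * (1 / (κ * √A) - L₂ (κ ^ 2 * A)) := by
      field_simp
    rw [e, abs_mul, abs_mul, abs_of_pos (by positivity : 0 < κ ^ 4)]
    have hs2 : 89/100 ≤ √A := Real.le_sqrt_of_sq_le (by linarith [hA.1])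
    have hA2 : 16/25 ≤ A ^ 2 := by nlinarith [hA.1]
    have h64 : 56/100 ≤ A ^ 2 * √A := by nlinarith
    calc |N| * (κ ^ 4 * |1 / (κ * √A) - L₂ (κ ^ 2 * A)|)
        ≤ 2 * κ * (κ ^ 4 * (8 / ((κ ^ 2 * A) ^ 2 * (κ * √A)))) := by gcongr
      _ = 16 / (A ^ 2 * √A) := by field_simp; norm_num
      _ ≤ 30 := by rw [div_le_iff₀ (by positivity)]; linarith

theorem exists_bddC2_of_contDiff {ψ : ℝ → ℝ} (hψ : ContDiff ℝ (⊤ : ℕ∞) ψ) (a b : ℝ) :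
    ∃ K, 0 ≤ K ∧ BddC2 (Set.Icc a b) K (fun x => (ψ x : ℂ)) := by
  have h1 : ContDiff ℝ (⊤ : ℕ∞) (deriv ψ) := by
    rw [show ((⊤ : ℕ∞) : WithTop ℕ∞) = (⊤ : ℕ∞) + 1 by rfl] at hψ
    exact (contDiff_succ_iff_deriv.1 hψ).2.2
  have h2 : Continuous (deriv (deriv ψ)) := h1.continuous_deriv (by simp)
  obtain ⟨K0, hK0⟩ := isCompact_Icc.exists_bound_of_continuousOn (s := Set.Icc a b) hψ.continuous.continuousOn
  obtain ⟨K1, hK1⟩ := isCompact_Icc.exists_bound_of_continuousOn (s := Set.Icc a b) h1.continuous.continuousOn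
  obtain ⟨K2, hK2⟩ := isCompact_Icc.exists_bound_of_continuousOn (s := Set.Icc a b) h2.continuousOn
  refine ⟨|K0| + |K1| + |K2|, by positivity, fun x => ((deriv ψ x : ℝ) : ℂ), fun x => ((deriv (deriv ψ) x : ℝ) : ℂ),
    fun x hx => ⟨(hψ.differentiable (by simp) x).hasDerivAt.ofReal_comp,
      (h1.differentiable (by simp) x).hasDerivAt.ofReal_comp, ?_, ?_, ?_⟩⟩
  all_goals rw [Complex.norm_real]
  · linarith [hK0 x hx, le_abs_self K0, abs_nonneg K1, abs_nonneg K2]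
  · linarith [hK1 x hx, le_abs_self K1, abs_nonneg K0, abs_nonneg K2]
  · linarith [hK2 x hx, le_abs_self K2, abs_nonneg K1, abs_nonneg K0]

/-- The change of variables `S = σ - Υ`, with the variable `η` moved to the front. -/
theorem measurePreserving_shear :
    MeasurePreserving (fun p : ℝ × ℝ × ℝ × ℝ => (p.2.1 - p.2.2.1, p.2.2.1, p.2.2.2, p.1)) := by
  have e1 : MeasurePreserving (Prod.swap : ℝ × ℝ × ℝ × ℝ → (ℝ × ℝ × ℝ) × ℝ) := Measure.measurePreserving_swap
  have e2 : MeasurePreserving (MeasurableEquiv.prodAssoc : (ℝ × ℝ × ℝ) × ℝ ≃ᵐ ℝ × (ℝ × ℝ) × ℝ) :=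
    measurePreserving_prodAssoc _ _ _
  have e3 : MeasurePreserving (MeasurableEquiv.prodAssoc : (ℝ × ℝ) × ℝ ≃ᵐ ℝ × ℝ × ℝ) :=
    measurePreserving_prodAssoc _ _ _
  have e4 : MeasurePreserving (Prod.map id (MeasurableEquiv.prodAssoc : (ℝ × ℝ) × ℝ ≃ᵐ ℝ × ℝ × ℝ) :
      ℝ × (ℝ × ℝ) × ℝ → ℝ × ℝ × ℝ × ℝ) := (MeasurePreserving.id volume).prod e3
  have e5 : MeasurePreserving (fun p : (ℝ × ℝ × ℝ) × ℝ => (p.1, p.2 - p.1.1)) :=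
    (MeasurePreserving.id (volume : Measure (ℝ × ℝ × ℝ))).skew_product
      (g := fun w s => s - w.1) (by unfold Function.uncurry; fun_prop)
      (Eventually.of_forall fun w => (measurePreserving_sub_right volume w.1).map_eq)
  have e6 : MeasurePreserving (Prod.swap : ℝ × ℝ × ℝ × ℝ → (ℝ × ℝ × ℝ) × ℝ) := Measure.measurePreserving_swap
  have e7 : MeasurePreserving (Prod.swap : (ℝ × ℝ × ℝ) × ℝ → ℝ × ℝ × ℝ × ℝ) := Measure.measurePreserving_swap
  exact e7.comp (e5.comp (e6.comp (e4.comp (e2.comp e1))))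

theorem norm_integral_le_of_slices {F : ℝ × ℝ × ℝ × ℝ → ℂ} (hF : Continuous F) (hFi : Integrable F)
    {J : ℝ → ℂ} {B : ℝ} (hJ : ∀ η, ∫ p : ℝ × ℝ × ℝ, F (p.1 - p.2.1, p.2.1, p.2.2, η) = J η)
    (h0 : ∀ η ∉ Set.Icc (1/2:ℝ) (3/2), J η = 0) (hB : ∀ η ∈ Set.Icc (1/2:ℝ) (3/2), ‖J η‖ ≤ B) :
    ‖∫ v, F v‖ ≤ B := by
  have hm := measurePreserving_shear
  have h1 : ∫ v, F v = ∫ p : ℝ × ℝ × ℝ × ℝ, F (p.2.1 - p.2.2.1, p.2.2.1, p.2.2.2, p.1) := by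
    nth_rw 1 [← hm.map_eq]
    exact integral_map hm.measurable.aemeasurable hF.aestronglyMeasurable
  have h2 : Integrable (fun p : ℝ × ℝ × ℝ × ℝ => F (p.2.1 - p.2.2.1, p.2.2.1, p.2.2.2, p.1)) :=
    (hm.integrable_comp hF.aestronglyMeasurable).2 hFi
  rw [h1, Measure.volume_eq_prod, integral_prod _ h2]
  simp only [hJ]
  rw [← setIntegral_eq_integral_of_forall_compl_eq_zero h0]
  refine (norm_setIntegral_le_of_norm_le_const (by simp) hB).trans ?_
  norm_num [Measure.real]

theorem integral_triple_eq {u v : ℝ → ℝ → ℂ} {w : ℝ → ℂ}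
    (hu : ∀ σ Υ, u σ Υ ≠ 0 → σ ∈ Set.Ioc (-6:ℝ) 6 ∧ Υ ∈ Set.Ioc (-3:ℝ) 3)
    (hv : ∀ σ A, v σ A ≠ 0 → A ∈ Set.Ioc (4/5:ℝ) 7)
    (hi : Integrable (fun p : ℝ × ℝ × ℝ => w p.1 * (u p.1 p.2.1 * v p.1 p.2.2))) :
    ∫ p : ℝ × ℝ × ℝ, w p.1 * (u p.1 p.2.1 * v p.1 p.2.2) =
      ∫ σ in (-6:ℝ)..6, w σ * ((∫ Υ in (-3:ℝ)..3, u σ Υ) * ∫ A in (4/5:ℝ)..7, v σ A) := by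
  rw [Measure.volume_eq_prod, integral_prod _ hi]
  have h1 : ∀ σ, ∫ Υ in (-3:ℝ)..3, u σ Υ = ∫ Υ, u σ Υ := fun σ =>
    intervalIntegral.integral_eq_integral_of_support_subset fun Υ h => (hu σ Υ h).2
  have h2 : ∀ σ, ∫ A in (4/5:ℝ)..7, v σ A = ∫ A, v σ A := fun σ =>
    intervalIntegral.integral_eq_integral_of_support_subset fun A h => hv σ A h
  simp only [h1, h2]
  rw [intervalIntegral.integral_eq_integral_of_support_subset]
  · congr 1
    ext σ
    rw [integral_const_mul, Measure.volume_eq_prod, integral_prod_mul]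
  · intro σ hσ
    by_contra hc
    refine hσ ?_
    have : ∀ Υ, u σ Υ = 0 := fun Υ => by
      by_contra h
      exact hc (hu σ Υ h).1
    simp [this]

theorem sigmaInt_neg (a θ n Λ d : ℝ) (g : ℝ → ℝ → ℂ) (q : ℝ → ℂ) :
    sigmaInt a θ (-n) Λ d g q = (starRingEnd ℂ) (sigmaInt a θ n Λ d
      (fun σ Υ => (starRingEnd ℂ) (g (-σ) (-Υ))) (fun A => (starRingEnd ℂ) (q A))) := by
  have hP : ∀ x, (starRingEnd ℂ) (profIntegral a θ (fun A => (starRingEnd ℂ) (q A)) (Λ * n) x) =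
      profIntegral a θ q (Λ * -n) x := fun x => by
    rw [profIntegral, profIntegral, ← intervalIntegral.intervalIntegral_conj]
    congr 1
    ext A
    rw [map_mul, Complex.conj_conj, ← Complex.exp_conj, map_mul, Complex.conj_I, Complex.conj_ofReal]
    congr 2
    push_cast
    ring
  rw [sigmaInt, sigmaInt, ← intervalIntegral.intervalIntegral_conj]
  have h := intervalIntegral.integral_comp_neg (a := -6) (b := 6) (fun σ : ℝ =>
    Complex.exp (I * ((Λ * (σ ^ 3 / 12 + σ) : ℝ) : ℂ)) *
      (fullSlice g Λ d σ * profIntegral a θ q (Λ * -n) (σ / -n)))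
  rw [neg_neg] at h
  rw [← h]
  congr 1
  ext σ
  rw [map_mul, map_mul, hP, ← conj_fullSlice_neg, Complex.conj_conj, ← Complex.exp_conj, map_mul,
    Complex.conj_I, Complex.conj_ofReal, neg_div_neg_eq]
  congr 2
  push_cast
  ring

theorem exists_sigmaInt_dispersion {K G : ℝ} (hK : 1 ≤ K) (hG : 0 ≤ G) : ∃ C : ℝ, 0 ≤ C ∧
    ∀ (a N T Λ d x y : ℝ) (q : ℝ → ℂ) (g gσ gΥ gσΥ gΥΥ g' gσ' gΥ' gσΥ' gΥΥ' : ℝ → ℝ → ℂ),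
      0 < a → a ≤ 1/1000 → (|N| = 1 ∨ 2 ≤ |N|) → |N| ^ 3 / 2 ≤ Λ → 1 ≤ Λ → |T - 4 * N| ≤ 1 / |N| →
      BddC2 (Set.Icc (4/5) 7) G q → q (4/5) = 0 → q 7 = 0 →
      SmoothSlice K g gσ gΥ gσΥ gΥΥ → SmoothSlice K g' gσ' gΥ' gσΥ' gΥΥ' →
      g' = (fun σ Υ => (starRingEnd ℂ) (g (-σ) (-Υ))) →
      0 < x → x ≤ 2 * (Λ / |N| ^ 3) ^ (-(1:ℝ)/12) → 0 ≤ y → y ≤ |N * (T - 4 * N)| ^ ((1:ℝ)/6) →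
      ‖sigmaInt a (T * √(1 + a) / N) N Λ d g q‖ ≤ C * (Λ ^ (-(4:ℝ)/3) / (x + y)) := by
  obtain ⟨C, hC, h⟩ := exists_sigmaInt_bound hK hG
  have hpos : ∀ (a N T Λ d x y : ℝ) (q : ℝ → ℂ) (g gσ gΥ gσΥ gΥΥ g' gσ' gΥ' gσΥ' gΥΥ' : ℝ → ℝ → ℂ),
      0 < a → a ≤ 1/1000 → (N = 1 ∨ 2 ≤ N) → N ^ 3 / 2 ≤ Λ → 1 ≤ Λ → |T - 4 * N| ≤ 1 / N →
      BddC2 (Set.Icc (4/5) 7) G q → q (4/5) = 0 → q 7 = 0 →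
      SmoothSlice K g gσ gΥ gσΥ gΥΥ → SmoothSlice K g' gσ' gΥ' gσΥ' gΥΥ' →
      g' = (fun σ Υ => (starRingEnd ℂ) (g (-σ) (-Υ))) →
      0 < x → x ≤ 2 * (Λ / N ^ 3) ^ (-(1:ℝ)/12) → 0 ≤ y → y ≤ |N * (T - 4 * N)| ^ ((1:ℝ)/6) →
      ‖sigmaInt a (T * √(1 + a) / N) N Λ d g q‖ ≤ 6 * C * (Λ ^ (-(4:ℝ)/3) / (x + y)) := by
    intro a N T Λ d x y q g gσ gΥ gσΥ gΥΥ g' gσ' gΥ' gσΥ' gΥΥ' ha ha' hN hNΛ hΛ hT hq q4 q7 hg hg' hgg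
      hx hxM hy hys
    have hN1 : 1 ≤ N := by rcases hN with h | h <;> linarith
    obtain ⟨hθ, hθ', hc⟩ := critical_point_near_one (c0 := 1) ha ha' hN1 hT
    obtain ⟨c0, hc0, hp, hb⟩ := h a _ ha ha' hθ hθ'
    obtain ⟨_, _, hc⟩ := critical_point_near_one (c0 := c0) ha ha' hN1 hT
    obtain ⟨hs, hsT⟩ := hc hc0 hp
    have hM : 0 < Λ / N ^ 3 := by positivity
    have hys' : y ≤ 2 * |N ^ 2 * (1 - c0)| ^ ((1:ℝ)/6) := by
      calc y ≤ (4 * |N ^ 2 * (1 - c0)|) ^ ((1:ℝ)/6) :=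
            hys.trans (Real.rpow_le_rpow (abs_nonneg _) hsT (by norm_num))
        _ = 4 ^ ((1:ℝ)/6) * |N ^ 2 * (1 - c0)| ^ ((1:ℝ)/6) :=
            Real.mul_rpow (by norm_num) (abs_nonneg _)
        _ ≤ 2 * |N ^ 2 * (1 - c0)| ^ ((1:ℝ)/6) := by
            gcongr
            calc (4:ℝ) ^ ((1:ℝ)/6) ≤ 64 ^ ((1:ℝ)/6) :=
                  Real.rpow_le_rpow (by norm_num) (by norm_num) (by norm_num)
              _ = 2 := by
                  rw [show (64:ℝ) = 2 ^ (6:ℝ) by norm_num, ← Real.rpow_mul (by norm_num)]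
                  norm_num
    obtain ⟨Q, hQ, hQb⟩ := exists_admissibleGain hM hx hxM hy hys'
    refine (hb N Λ d Q q g gσ gΥ gσΥ gΥΥ g' gσ' gΥ' gσΥ' gΥΥ' hN hNΛ hΛ hs hq q4 q7 hg hg' hgg
      hQ).trans ?_
    have h0 : 0 ≤ Λ ^ (-(4:ℝ)/3) := by positivity
    calc C * (Λ ^ (-(4:ℝ)/3) * Q) ≤ C * (Λ ^ (-(4:ℝ)/3) * (6 / (x + y))) := by gcongr
      _ = _ := by ring
  refine ⟨6 * C, by positivity, ?_⟩
  intro a N T Λ d x y q g gσ gΥ gσΥ gΥΥ g' gσ' gΥ' gσΥ' gΥΥ' ha ha' hN hNΛ hΛ hT hq q4 q7 hg hg' hgg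
      hx hxM hy hys
  rcases le_or_gt 0 N with h0 | h0
  · rw [abs_of_nonneg h0] at hN hNΛ hT hxM
    exact hpos a N T Λ d x y q g gσ gΥ gσΥ gΥΥ g' gσ' gΥ' gσΥ' gΥΥ' ha ha' hN hNΛ hΛ hT hq q4 q7 hg hg'
      hgg hx hxM hy hys
  · rw [abs_of_neg h0] at hN hNΛ hT hxM
    have e := sigmaInt_neg a (T * √(1 + a) / N) (-N) Λ d g q
    rw [neg_neg] at e
    rw [e, Complex.norm_conj, ← hgg, show T * √(1 + a) / N = -T * √(1 + a) / -N by
      rw [neg_mul, neg_div_neg_eq]]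
    refine hpos a (-N) (-T) Λ d x y _ g' gσ' gΥ' gσΥ' gΥΥ' g gσ gΥ gσΥ gΥΥ ha ha' hN hNΛ hΛ ?_ hq.conj
      ?_ ?_ hg' hg ?_ hx hxM hy ?_
    · rwa [show -T - 4 * -N = -(T - 4 * N) by ring, abs_neg]
    · simp [q4]
    · simp [q7]
    · ext σ Υ
      simp [hgg]
    · rwa [show -N * (-T - 4 * -N) = N * (T - 4 * N) by ring]

theorem psiTan_shear (L : ℝ → ℝ) {h a : ℝ} {N : ℤ} (T X Y Υ σ A η : ℝ) (hl : a ^ ((3:ℝ)/2) / h ≠ 0)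
    (hN : (N : ℝ) ≠ 0) :
    (a ^ ((3:ℝ)/2) / h) * PsiTan L h a N T X Y Υ (σ - Υ) A η =
      (η * (a ^ ((3:ℝ)/2) / h)) * Y + (η * (a ^ ((3:ℝ)/2) / h)) * (σ ^ 3 / 12 + σ) +
      (η * (a ^ ((3:ℝ)/2) / h)) * (σ * (Υ - σ/2)^2 - (1 - X) * Υ) +
      (η * (a ^ ((3:ℝ)/2) / h)) * N * (profInt a (T * √(1 + a) / N) A - σ / N * A) +
      N * Bfun L (η * (a ^ ((3:ℝ)/2) / h) * A ^ ((3:ℝ)/2)) := by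
  rw [PsiTan, profInt]
  generalize a ^ ((3:ℝ)/2) / h = l at *
  generalize √(1 + a * A) + √(1 + a) = r
  rw [show T * √(1 + a) / N * (A - 1) / r = (T * √(1 + a) * (A - 1) / r) / N by ring]
  generalize T * √(1 + a) * (A - 1) / r = z
  field_simp
  ring

theorem continuous_psiTan {L : ℝ → ℝ} (hL : Continuous L) (h : ℝ) {a : ℝ} (ha : 0 < a) (N : ℤ) (T X Y : ℝ) :
    Continuous fun v : ℝ × ℝ × ℝ × ℝ => PsiTan L h a N T X Y v.2.1 v.1 v.2.2.1 v.2.2.2 := by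
  have h1 : Continuous fun v : ℝ × ℝ × ℝ × ℝ => v.2.2.1 ^ ((3:ℝ)/2) :=
    (by fun_prop : Continuous fun v : ℝ × ℝ × ℝ × ℝ => v.2.2.1).rpow_const fun _ => Or.inr (by norm_num)
  have h2 : Continuous fun u : ℝ => u ^ ((2:ℝ)/3) :=
    continuous_id.rpow_const fun _ => Or.inr (by norm_num)
  have h3 : ∀ v : ℝ × ℝ × ℝ × ℝ, √(1 + a * v.2.2.1) + √(1 + a) ≠ 0 := fun v => by positivity
  unfold PsiTan Bfun
  fun_prop (disch := exact h3 _)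

theorem norm_Wtan_le {L : ℝ → ℝ} (hL : Continuous L) {ψ : ℝ → ℝ} (hψ : Continuous ψ)
    (hψs : tsupport ψ ⊆ Set.Icc (1/2 : ℝ) (3/2)) {χ₂ : ℝ × ℝ → ℝ} (hχ₂ : Continuous χ₂)
    (hχ₂s : tsupport χ₂ ⊆ {p : ℝ × ℝ | |p.1| < 3 ∧ |p.2| < 3}) {ψ₃ : ℝ → ℝ} (hψ₃ : Continuous ψ₃)
    (hψ₃s : tsupport ψ₃ ⊆ Set.Icc (9/10 : ℝ) 6) {h a : ℝ} (hh : 0 < h) (ha : 0 < a) {N : ℤ}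
    (hN : (N : ℝ) ≠ 0) (T X Y : ℝ) {K B : ℝ} (hK : ∀ η, |ψ η| ≤ K)
    (hB : ∀ η ∈ Set.Icc (1/2:ℝ) (3/2), ‖sigmaInt a (T * √(1 + a) / N) N (η * (a ^ ((3:ℝ)/2) / h)) (1 - X)
      (fun σ Υ => (χ₂ (σ - Υ, Υ) : ℂ)) (reflAmp L ψ₃ (η * (a ^ ((3:ℝ)/2) / h)) N)‖ ≤ B) :
    ‖Wtan L ψ χ₂ ψ₃ h a N T X Y‖ ≤ a ^ 2 / (2 * Real.pi * h) ^ 3 * (9/4 * K * B) := by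
  have z1 : ∀ η, ψ η ≠ 0 → η ∈ Set.Icc (1/2:ℝ) (3/2) := fun η h => hψs (subset_tsupport _ h)
  have z2 : ∀ p, χ₂ p ≠ 0 → |p.1| < 3 ∧ |p.2| < 3 := fun p h => hχ₂s (subset_tsupport _ h)
  have z3 : ∀ A, ψ₃ A ≠ 0 → A ∈ Set.Icc (9/10:ℝ) 6 := fun A h => hψ₃s (subset_tsupport _ h)
  have hl : a ^ ((3:ℝ)/2) / h ≠ 0 := by positivity
  have hcP := continuous_psiTan hL h ha N T X Y
  obtain ⟨F, hF⟩ : ∃ F : ℝ × ℝ × ℝ × ℝ → ℂ, F = fun v => Complex.exp (Complex.I *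
      (((a ^ ((3:ℝ)/2) / h) * PsiTan L h a N T X Y v.2.1 v.1 v.2.2.1 v.2.2.2 : ℝ) : ℂ)) *
    ((v.2.2.2 ^ 2 * ψ v.2.2.2 * χ₂ (v.1, v.2.1) * ψ₃ v.2.2.1 : ℝ) : ℂ) := ⟨_, rfl⟩
  have hFne : ∀ v, F v ≠ 0 → ψ v.2.2.2 ≠ 0 ∧ χ₂ (v.1, v.2.1) ≠ 0 ∧ ψ₃ v.2.2.1 ≠ 0 := fun v hv => by
    rw [hF] at hv
    refine ⟨fun h0 => hv ?_, fun h0 => hv ?_, fun h0 => hv ?_⟩ <;> simp [h0]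
  have hFc : Continuous F := by
    rw [hF]
    fun_prop
  have hFs : HasCompactSupport F := by
    refine HasCompactSupport.intro (K := Set.Icc (-3:ℝ) 3 ×ˢ Set.Icc (-3:ℝ) 3 ×ˢ Set.Icc (9/10:ℝ) 6 ×ˢ
      Set.Icc (1/2:ℝ) (3/2)) (isCompact_Icc.prod (isCompact_Icc.prod (isCompact_Icc.prod isCompact_Icc))) ?_
    intro v hv
    by_contra hc
    obtain ⟨h1, h2, h3⟩ := hFne v hc
    obtain ⟨h4, h5⟩ := z2 _ h2
    exact hv ⟨abs_le.1 h4.le, abs_le.1 h5.le, z3 _ h3, z1 _ h1⟩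
  have hJ : ∀ η, ∫ p : ℝ × ℝ × ℝ, F (p.1 - p.2.1, p.2.1, p.2.2, η) =
      (Complex.exp (I * ((η * (a ^ ((3:ℝ)/2) / h) * Y : ℝ) : ℂ)) * ((η ^ 2 * ψ η : ℝ) : ℂ)) *
      sigmaInt a (T * √(1 + a) / N) N (η * (a ^ ((3:ℝ)/2) / h)) (1 - X)
      (fun σ Υ => (χ₂ (σ - Υ, Υ) : ℂ)) (reflAmp L ψ₃ (η * (a ^ ((3:ℝ)/2) / h)) N) := by
    intro η
    have e : (fun p : ℝ × ℝ × ℝ => F (p.1 - p.2.1, p.2.1, p.2.2, η)) = fun p =>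
        ((Complex.exp (I * ((η * (a ^ ((3:ℝ)/2) / h) * Y : ℝ) : ℂ)) * ((η ^ 2 * ψ η : ℝ) : ℂ)) *
        Complex.exp (I * ((η * (a ^ ((3:ℝ)/2) / h) * (p.1 ^ 3 / 12 + p.1) : ℝ) : ℂ))) *
        ((Complex.exp (I * ((η * (a ^ ((3:ℝ)/2) / h) * (p.1 * (p.2.1 - p.1/2)^2 - (1 - X) * p.2.1) : ℝ) : ℂ)) *
          (χ₂ (p.1 - p.2.1, p.2.1) : ℂ)) *
        (Complex.exp (I * ((η * (a ^ ((3:ℝ)/2) / h) * N * (profInt a (T * √(1 + a) / N) p.2.2 -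
          p.1 / N * p.2.2) : ℝ) : ℂ)) * reflAmp L ψ₃ (η * (a ^ ((3:ℝ)/2) / h)) N p.2.2)) := by
      ext p
      rw [hF, reflAmp]
      simp only
      rw [psiTan_shear L T X Y p.2.1 p.1 p.2.2 η hl hN]
      simp only [Complex.ofReal_add, Complex.ofReal_mul, mul_add, Complex.exp_add]
      ring
    rw [e]
    refine (integral_triple_eq (w := fun σ => (Complex.exp (I * ((η * (a ^ ((3:ℝ)/2) / h) * Y : ℝ) : ℂ)) *
        ((η ^ 2 * ψ η : ℝ) : ℂ)) *
        Complex.exp (I * ((η * (a ^ ((3:ℝ)/2) / h) * (σ ^ 3 / 12 + σ) : ℝ) : ℂ)))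
      (u := fun σ Υ => Complex.exp (I * ((η * (a ^ ((3:ℝ)/2) / h) * (σ * (Υ - σ/2)^2 - (1 - X) * Υ) : ℝ) : ℂ)) *
          (χ₂ (σ - Υ, Υ) : ℂ))
      (v := fun σ A => Complex.exp (I * ((η * (a ^ ((3:ℝ)/2) / h) * N * (profInt a (T * √(1 + a) / N) A -
          σ / N * A) : ℝ) : ℂ)) * reflAmp L ψ₃ (η * (a ^ ((3:ℝ)/2) / h)) N A) ?_ ?_ ?_).trans ?_
    · intro σ Υ hu
      have hc : χ₂ (σ - Υ, Υ) ≠ 0 := fun h0 => hu (by simp [h0])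
      obtain ⟨h4, h5⟩ := z2 _ hc
      rw [abs_lt] at h4 h5
      constructor <;> constructor <;> linarith [h4.1, h4.2, h5.1, h5.2]
    · intro σ A hv
      have hc : ψ₃ A ≠ 0 := fun h0 => hv (by simp [reflAmp, h0])
      have := z3 _ hc
      constructor <;> linarith [this.1, this.2]
    · rw [← e]
      refine Continuous.integrable_of_hasCompactSupport (by fun_prop) ?_
      refine HasCompactSupport.intro (K := Set.Icc (-6:ℝ) 6 ×ˢ Set.Icc (-3:ℝ) 3 ×ˢ Set.Icc (9/10:ℝ) 6)
        (isCompact_Icc.prod (isCompact_Icc.prod isCompact_Icc)) ?_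
      intro p hp
      by_contra hc
      obtain ⟨h1, h2, h3⟩ := hFne _ hc
      obtain ⟨h4, h5⟩ := z2 _ h2
      simp only [abs_lt] at h4 h5
      refine hp ⟨?_, ⟨h5.1.le, h5.2.le⟩, z3 _ h3⟩
      constructor <;> linarith [h4.1, h4.2, h5.1, h5.2]
    · rw [sigmaInt, ← intervalIntegral.integral_const_mul]
      simp only [mul_assoc, fullSlice, profIntegral]
  have hK0 : 0 ≤ K := (abs_nonneg _).trans (hK 0)
  have hmain := norm_integral_le_of_slices hFc (hFc.integrable_of_hasCompactSupport hFs) hJ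
    (B := 9/4 * K * B) ?_ ?_
  · rw [Wtan, norm_mul, Complex.norm_real, Real.norm_of_nonneg (by positivity)]
    rw [hF] at hmain
    gcongr
  · intro η hη
    have : ψ η = 0 := by
      by_contra hc
      exact hη (z1 _ hc)
    simp [this]
  · intro η hη
    have hB0 := (norm_nonneg _).trans (hB η hη)
    rw [norm_mul, norm_mul, mul_comm I, Complex.norm_exp_ofReal_mul_I, one_mul, Complex.norm_real, norm_mul,
      Real.norm_eq_abs (ψ η), norm_pow, Real.norm_of_nonneg (by linarith [hη.1] : 0 ≤ η)]
    have h2 : η ^ 2 ≤ 9/4 := by nlinarith [hη.1, hη.2]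
    gcongr
    · exact hK η
    · exact hB η hη

/-- dispersive bound for `W_{N,a}`, `1 ≤ |N| ≤ λ^{1/3}`, near the
swallowtail time `T = 4N`, i.e. for `|T − 4N| ≤ 1/|N|`. -/
theorem dispersion_tangential_smallN_near
    (Ai : ℂ → ℂ)
    (hAi_diff : Differentiable ℂ Ai)
    (hAi_diff' : Differentiable ℂ (deriv Ai))
    (hAi_ode : ∀ z : ℂ, deriv (deriv Ai) z = z * Ai z)
    (hAi_zero : Ai 0 = (3 : ℂ) ^ (-(2 : ℂ)/3) / Complex.Gamma (2/3))
    (hAi_zero' : deriv Ai 0 = -((3 : ℂ) ^ (-(1 : ℂ)/3)) / Complex.Gamma (1/3))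
    (hAi_real : ∀ x : ℝ, (Ai x).im = 0)
    (L : ℝ → ℝ)
    (hL_cont : Continuous L)
    (hL_zero : L 0 = Real.pi / 3)
    (hAp_ne : ∀ w : ℝ, Aplus Ai w ≠ 0)
    (hL_char : ∀ w : ℝ, Complex.exp (-(L w : ℂ) * Complex.I) = -(Aminus Ai w) / (Aplus Ai w))
    (ψ : ℝ → ℝ) (hψ : ContDiff ℝ (⊤ : ℕ∞) ψ) (hψs : tsupport ψ ⊆ Set.Icc (1/2 : ℝ) (3/2))
    (χ₂ : ℝ × ℝ → ℝ) (hχ₂ : ContDiff ℝ (⊤ : ℕ∞) χ₂) (hχ₂c : HasCompactSupport χ₂)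
    (hχ₂s : tsupport χ₂ ⊆ {p : ℝ × ℝ | |p.1| < 3 ∧ |p.2| < 3})
    (ψ₃ : ℝ → ℝ) (hψ₃ : ContDiff ℝ (⊤ : ℕ∞) ψ₃) (hψ₃s : tsupport ψ₃ ⊆ Set.Icc (9/10 : ℝ) 6)
    : ∃ a₀ ∈ Set.Ioo (0:ℝ) 1, ∃ lam₀ : ℝ, 8 ≤ lam₀ ∧ ∃ C : ℝ,
      ∀ h a : ℝ, 0 < h → h ≤ 1 → 0 < a → a ≤ a₀ → lam₀ ≤ a ^ ((3:ℝ)/2) / h →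
      ∀ N : ℤ, 1 ≤ |(N : ℝ)| → |(N : ℝ)| ≤ (a ^ ((3:ℝ)/2) / h) ^ ((1:ℝ)/3) →
      ∀ X : ℝ, 0 ≤ X → ∀ Y T : ℝ, |T - 4 * (N : ℝ)| ≤ 1 / |(N : ℝ)| →
        ‖Wtan L ψ χ₂ ψ₃ h a N T X Y‖
          ≤ C * (h ^ ((1:ℝ)/3) / h ^ 2) /
            ((|(N : ℝ)| / (a ^ ((3:ℝ)/2) / h) ^ ((1:ℝ)/3)) ^ ((1:ℝ)/4)
              + |(N : ℝ) * (T - 4 * (N : ℝ))| ^ ((1:ℝ)/6)) := by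
  obtain ⟨L₁, L₂, h1, h2, b1, b2⟩ := exists_airyPhase_bounds hAi_diff hAi_diff' hAi_ode hAi_zero hAi_zero'
    hL_cont hAp_ne hL_char
  obtain ⟨Kg, gσ, gΥ, gσΥ, gΥΥ, _, hg⟩ := exists_smoothSlice hχ₂ hχ₂s
  obtain ⟨Kg', gσ', gΥ', gσΥ', gΥΥ', _, hg'⟩ := exists_smoothSlice (χ := fun p => χ₂ (-p))
    (hχ₂.comp contDiff_neg) (by
      intro p hp
      have e : tsupport (fun p => χ₂ (-p)) ⊆ -tsupport χ₂ :=
        closure_minimal (fun p hp => subset_tsupport χ₂ hp) (isClosed_tsupport χ₂).neg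
      simpa using hχ₂s (e hp))
  obtain ⟨K₃, hK₃, hq₃⟩ := exists_bddC2_of_contDiff hψ₃ (4/5) 7
  obtain ⟨Kψ, hKψ⟩ : ∃ K, ∀ η, |ψ η| ≤ K := by
    obtain ⟨K, hK⟩ := hψ.continuous.bounded_above_of_compact_support
      (isCompact_Icc.of_isClosed_subset (isClosed_tsupport ψ) hψs)
    exact ⟨K, hK⟩
  have hKψ0 : 0 ≤ Kψ := (abs_nonneg _).trans (hKψ 0)
  obtain ⟨C, hC, hmain⟩ := exists_sigmaInt_dispersion (K := max 1 (max Kg Kg')) (G := 4 * (40 * K₃))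
    (le_max_left _ _) (by positivity)
  have zψ₃ : ∀ A ∉ Set.Icc (9/10:ℝ) 6, ψ₃ A = 0 := fun A hA => by
    by_contra hc
    exact hA (hψ₃s (subset_tsupport _ hc))
  refine ⟨1/1000, by norm_num, 8, le_rfl, 9 * Kψ * C / (2 * Real.pi) ^ 3, ?_⟩
  intro h a hh _ ha ha' hlam N hN hNl X _ Y T hT
  have hN0 : (N : ℝ) ≠ 0 := by
    intro h0
    norm_num [h0] at hN
  have hNint : |(N : ℝ)| = 1 ∨ 2 ≤ |(N : ℝ)| := by
    rw [← Int.cast_abs] at hN ⊢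
    have : (1 : ℤ) ≤ |N| := by exact_mod_cast hN
    rcases this.eq_or_lt with h | h
    · left; rw [← h]; norm_num
    · right; exact_mod_cast h
  obtain ⟨l, hl⟩ : ∃ l, l = a ^ ((3:ℝ)/2) / h := ⟨_, rfl⟩
  have hl0 : 0 < l := by rw [hl]; positivity
  have hn3 : |(N : ℝ)| ^ 3 ≤ l := by
    calc |(N : ℝ)| ^ 3 ≤ (l ^ ((1:ℝ)/3)) ^ 3 := by rw [hl]; gcongr
      _ = l := by
        rw [← Real.rpow_natCast, ← Real.rpow_mul hl0.le]
        norm_num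
  obtain ⟨x, hx⟩ : ∃ x, x = (|(N : ℝ)| / l ^ ((1:ℝ)/3)) ^ ((1:ℝ)/4) := ⟨_, rfl⟩
  obtain ⟨y, hy⟩ : ∃ y, y = |(N : ℝ) * (T - 4 * N)| ^ ((1:ℝ)/6) := ⟨_, rfl⟩
  have hx0 : 0 < x := by rw [hx]; positivity
  have hy0 : 0 ≤ y := by rw [hy]; positivity
  have hxe : x = (|(N : ℝ)| ^ 3 / l) ^ ((1:ℝ)/12) := by
    rw [hx, ← Real.rpow_natCast, Real.div_rpow (by positivity) (by positivity), Real.div_rpow (by positivity) hl0.le,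
      ← Real.rpow_mul hl0.le, ← Real.rpow_mul (abs_nonneg _)]
    norm_num
  have hbound := norm_Wtan_le hL_cont hψ.continuous hψs hχ₂.continuous hχ₂s hψ₃.continuous hψ₃s hh ha hN0 T X Y
    (B := C * (4 * l ^ (-(4:ℝ)/3) / (x + y))) hKψ ?_
  · rw [← hl, ← hx, ← hy]
    refine hbound.trans (le_of_eq ?_)
    have e : a ^ 2 / h ^ 3 * l ^ (-(4:ℝ)/3) = h ^ ((1:ℝ)/3) / h ^ 2 := by
      rw [hl, Real.div_rpow (by positivity) hh.le, ← Real.rpow_mul ha.le,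
        show (3:ℝ)/2 * (-(4:ℝ)/3) = -(2:ℕ) by norm_num, Real.rpow_neg ha.le, Real.rpow_natCast,
        show (-(4:ℝ)/3) = -((1:ℝ)/3 + (1:ℕ)) by norm_num, Real.rpow_neg hh.le, Real.rpow_add hh,
        Real.rpow_natCast]
      field_simp
    rw [← e]
    field_simp
  · intro η hη
    rw [← hl]
    have hη0 : 0 < η := by linarith [hη.1]
    have hΛ : l / 2 ≤ η * l := by nlinarith [hη.1]
    have hΛ0 : 0 < η * l := by positivity
    have hNΛ : |(N : ℝ)| ^ 3 / 2 ≤ η * l := by linarith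
    have hl8 : 8 ≤ l := by rw [hl]; exact hlam
    have hxM : x ≤ 2 * (η * l / |(N : ℝ)| ^ 3) ^ (-(1:ℝ)/12) := by
      have hη2 : η ^ ((1:ℝ)/12) ≤ 2 := by
        calc η ^ ((1:ℝ)/12) ≤ 2 ^ ((1:ℝ)/12) := Real.rpow_le_rpow hη0.le (by linarith [hη.2]) (by norm_num)
          _ ≤ 2 ^ (1:ℝ) := Real.rpow_le_rpow_of_exponent_le (by norm_num) (by norm_num)
          _ = 2 := Real.rpow_one _
      calc x = (η * (η * l / |(N : ℝ)| ^ 3)⁻¹) ^ ((1:ℝ)/12) := by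
            rw [hxe]
            congr 1
            field_simp
        _ = η ^ ((1:ℝ)/12) * (η * l / |(N : ℝ)| ^ 3) ^ (-(1:ℝ)/12) := by
            rw [Real.mul_rpow hη0.le (by positivity), Real.inv_rpow (by positivity),
              ← Real.rpow_neg (by positivity), neg_div]
        _ ≤ _ := by gcongr
    have hq : BddC2 (Set.Icc (4/5) 7) (4 * (40 * K₃)) (reflAmp L ψ₃ (η * l) N) :=
      (bddC2_reflection h1 h2 b1 b2 (by linarith) hNΛ).mul hq₃ (by norm_num) hK₃
    refine (hmain a N T (η * l) (1 - X) x y _ (fun σ Υ => (χ₂ (σ - Υ, Υ) : ℂ)) gσ gΥ gσΥ gΥΥ _ gσ' gΥ' gσΥ' gΥΥ'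
      ha ha' hNint hNΛ (by linarith) hT hq ?_ ?_ (hg.mono (by simp)) (hg'.mono (by simp)) ?_ hx0 hxM hy0
      hy.le).trans ?_
    · rw [reflAmp, zψ₃ _ (by norm_num)]
      simp
    · rw [reflAmp, zψ₃ _ (by norm_num)]
      simp
    · ext σ Υ
      simp only [Complex.conj_ofReal, Prod.neg_mk]
      congr 3
      ring
    · have hp : (η * l) ^ (-(4:ℝ)/3) ≤ 4 * l ^ (-(4:ℝ)/3) := by
        calc (η * l) ^ (-(4:ℝ)/3) ≤ (l / 2) ^ (-(4:ℝ)/3) :=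
              Real.rpow_le_rpow_of_nonpos (by positivity) hΛ (by norm_num)
          _ = l ^ (-(4:ℝ)/3) * 2 ^ ((4:ℝ)/3) := by
              rw [Real.div_rpow hl0.le (by norm_num), neg_div, Real.rpow_neg (x := 2) (by norm_num), div_inv_eq_mul]
          _ ≤ l ^ (-(4:ℝ)/3) * 2 ^ (2:ℝ) := by
              gcongr <;> norm_num
          _ = _ := by rw [Real.rpow_two]; ring
      gcongr
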